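/- arXiv:1105.4533 — 2 statements merged into one kernel-verified Lean document; each statement's English description precedes it below -/
import Mathlib

section
/- Let n ≥ 2 and let μ be the uniform (normalized) probability measure on the sphere 𝕊^{n−1} ⊂ ℝ^n. For every smooth function f : 𝕊^{n−1} → ℝ, Var_μ(f) ≤ (4e/n) · Σ_{i,j=1}^n ‖D_{ij} f‖₂² / (1 + log(‖D_{ij} f‖₂ / ‖D_{ij} f‖₁)), where D_{ij} f = x_i ∂_j f − x_j ∂_i f (computed on a smooth extension of f to a neighborhood of the sphere) and summands with ‖D_{ij} f‖₁ = 0 are interpreted as 0. -/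
open MeasureTheory

/-- The uniform (normalized) probability measure on the unit sphere of `ℝ^n`. -/
noncomputable def sphereUniform (n : ℕ) :
    Measure (Metric.sphere (0 : EuclideanSpace ℝ (Fin n)) 1) :=
  ((volume : Measure (EuclideanSpace ℝ (Fin n))).toSphere Set.univ)⁻¹ •
    (volume : Measure (EuclideanSpace ℝ (Fin n))).toSphere

/-- The angular derivative `D_{ij} f = x_i ∂_j f - x_j ∂_i f`, computed on a smooth
extension `F` of `f` to `ℝ^n` (it is intrinsic to the sphere). -/
noncomputable def Dang (n : ℕ) (i j : Fin n) (F : EuclideanSpace ℝ (Fin n) → ℝ)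
    (x : EuclideanSpace ℝ (Fin n)) : ℝ :=
  x i * fderiv ℝ F x (EuclideanSpace.single j 1) -
    x j * fderiv ℝ F x (EuclideanSpace.single i 1)

/-- `L^p` norm on the sphere with respect to the uniform probability measure. -/
noncomputable def sphNorm (n : ℕ) (p : ℝ) (g : EuclideanSpace ℝ (Fin n) → ℝ) : ℝ :=
  (∫ x, |g (x : EuclideanSpace ℝ (Fin n))| ^ p ∂sphereUniform n) ^ (1 / p)

/-- Variance on the sphere with respect to the uniform probability measure. -/
noncomputable def sphVar (n : ℕ) (g : EuclideanSpace ℝ (Fin n) → ℝ) : ℝ :=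
  (∫ x, g (x : EuclideanSpace ℝ (Fin n)) ^ 2 ∂sphereUniform n) -
    (∫ x, g (x : EuclideanSpace ℝ (Fin n)) ∂sphereUniform n) ^ 2

section Algebra

open MvPolynomial Finset

variable {n : ℕ}

theorem MvPolynomial.pderiv_pderiv_comm (i j : Fin n) (p : MvPolynomial (Fin n) ℝ) :
    pderiv i (pderiv j p) = pderiv j (pderiv i p) := by
  have h : ⁅pderiv (R := ℝ) i, pderiv (R := ℝ) j⁆ = 0 := by
    apply MvPolynomial.derivation_ext
    intro k
    rw [Derivation.commutator_apply]
    simp only [pderiv_X, Pi.single_apply, Derivation.coe_zero, Pi.zero_apply]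
    split_ifs <;> simp
  have h2 := congrArg (fun D => D p) h
  simp only [Derivation.commutator_apply, Derivation.coe_zero, Pi.zero_apply] at h2
  exact sub_eq_zero.mp h2

/-- The sum over words `w` of length `k` of `E (∂_w F) * E (∂_w G)`. -/
noncomputable def gradForm (E : MvPolynomial (Fin n) ℝ →ₗ[ℝ] ℝ) :
    ℕ → MvPolynomial (Fin n) ℝ → MvPolynomial (Fin n) ℝ → ℝ
  | 0, F, G => E F * E G
  | k + 1, F, G => ∑ i, gradForm E k (pderiv i F) (pderiv i G)

variable (E : MvPolynomial (Fin n) ℝ →ₗ[ℝ] ℝ)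

theorem gradForm_succ (k : ℕ) (F G : MvPolynomial (Fin n) ℝ) :
    gradForm E (k + 1) F G = ∑ i, gradForm E k (pderiv i F) (pderiv i G) := rfl

theorem gradForm_add_left (k : ℕ) (F F' G : MvPolynomial (Fin n) ℝ) :
    gradForm E k (F + F') G = gradForm E k F G + gradForm E k F' G := by
  induction k generalizing F F' G with
  | zero => simp [gradForm, add_mul]
  | succ k ih => simp [gradForm, ih, sum_add_distrib]

theorem gradForm_smul_left (k : ℕ) (a : ℝ) (F G : MvPolynomial (Fin n) ℝ) :
    gradForm E k (a • F) G = a * gradForm E k F G := by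
  induction k generalizing F G with
  | zero => simp [gradForm, mul_assoc]
  | succ k ih => simp [gradForm, ih, mul_sum]

theorem gradForm_zero_left (k : ℕ) (G : MvPolynomial (Fin n) ℝ) :
    gradForm E k 0 G = 0 := by
  simpa using gradForm_smul_left E k 0 0 G

theorem gradForm_sum_left {ι : Type*} (k : ℕ) (s : Finset ι) (F : ι → MvPolynomial (Fin n) ℝ)
    (G : MvPolynomial (Fin n) ℝ) :
    gradForm E k (∑ i ∈ s, F i) G = ∑ i ∈ s, gradForm E k (F i) G := by
  classical
  induction s using Finset.induction_on with
  | empty => simp [gradForm_zero_left]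
  | insert a s ha ih => rw [sum_insert ha, sum_insert ha, gradForm_add_left, ih]

theorem gradForm_self_nonneg (k : ℕ) (F : MvPolynomial (Fin n) ℝ) : 0 ≤ gradForm E k F F := by
  induction k generalizing F with
  | zero => exact mul_self_nonneg _
  | succ k ih => exact sum_nonneg fun i _ => ih _

theorem gradForm_add_self_le (k : ℕ) (F G : MvPolynomial (Fin n) ℝ) :
    gradForm E k (F + G) (F + G) ≤ 2 * gradForm E k F F + 2 * gradForm E k G G := by
  induction k generalizing F G with
  | zero =>
    simp only [gradForm, map_add]
    nlinarith [sq_nonneg (E F - E G)]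
  | succ k ih =>
    simp only [gradForm, map_add, mul_sum, ← sum_add_distrib]
    exact sum_le_sum fun i _ => ih _ _

theorem pderiv_X_mul (i j : Fin n) (p : MvPolynomial (Fin n) ℝ) :
    pderiv j (X i * p) = (if i = j then p else 0) + X i * pderiv j p := by
  rw [pderiv_mul, pderiv_X, Pi.single_apply]
  split_ifs <;> simp

variable {E}

theorem gradForm_X_mul (hX : ∀ i p, E (X i * p) = E (pderiv i p)) (k : ℕ) (i : Fin n)
    (F G : MvPolynomial (Fin n) ℝ) :
    gradForm E (k + 1) (X i * F) G =
      gradForm E (k + 1) (pderiv i F) G + (k + 1) * gradForm E k F (pderiv i G) := by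
  induction k generalizing F G with
  | zero =>
    simp only [gradForm, pderiv_X_mul, map_add, hX, add_mul, sum_add_distrib]
    rw [sum_eq_single i (by intro j _ hj; simp [hj.symm]) (by simp)]
    simp [MvPolynomial.pderiv_pderiv_comm i, add_comm]
  | succ k ih =>
    rw [gradForm]
    simp only [pderiv_X_mul, gradForm_add_left, sum_add_distrib, ih]
    rw [sum_eq_single i (by intro j _ hj; simp [hj.symm, gradForm_zero_left]) (by simp)]
    rw [if_pos rfl, gradForm_succ E (k + 1) (pderiv i F), gradForm_succ E k F (pderiv i G),
      ← mul_sum]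
    simp only [MvPolynomial.pderiv_pderiv_comm i]
    push_cast
    ring

theorem gradForm_zero_X_mul (hX : ∀ i p, E (X i * p) = E (pderiv i p)) (i : Fin n)
    (F G : MvPolynomial (Fin n) ℝ) :
    gradForm E 0 (X i * F) G = gradForm E 0 (pderiv i F) G := by
  simp [gradForm, hX]

/-- The Hermite expansion of `E (F * G)`, truncated at order `K`. -/
noncomputable def hermiteSum (E : MvPolynomial (Fin n) ℝ →ₗ[ℝ] ℝ) (K : ℕ)
    (F G : MvPolynomial (Fin n) ℝ) : ℝ :=
  ∑ k ∈ range K, gradForm E k F G / (k.factorial : ℝ)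

theorem hermiteSum_sum_left {ι : Type*} (K : ℕ) (s : Finset ι) (F : ι → MvPolynomial (Fin n) ℝ)
    (G : MvPolynomial (Fin n) ℝ) :
    hermiteSum E K (∑ i ∈ s, F i) G = ∑ i ∈ s, hermiteSum E K (F i) G := by
  simp only [hermiteSum, gradForm_sum_left, sum_div]
  exact sum_comm

theorem hermiteSum_X_mul (hX : ∀ i p, E (X i * p) = E (pderiv i p)) (K : ℕ) (i : Fin n)
    (F G : MvPolynomial (Fin n) ℝ) :
    hermiteSum E (K + 1) (X i * F) G =
      hermiteSum E (K + 1) (pderiv i F) G + hermiteSum E K F (pderiv i G) := by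
  simp only [hermiteSum]
  rw [sum_range_succ', sum_range_succ' _ K, gradForm_zero_X_mul hX]
  simp only [gradForm_X_mul hX, add_div, sum_add_distrib]
  have : ∀ k : ℕ, ((k : ℝ) + 1) * gradForm E k F (pderiv i G) / ((k + 1).factorial : ℝ) =
      gradForm E k F (pderiv i G) / (k.factorial : ℝ) := by
    intro k
    rw [Nat.factorial_succ]
    push_cast
    rw [mul_div_mul_left]
    positivity
  simp only [this]
  ring

theorem apply_mul_eq_hermiteSum_of_isHomogeneous (h1 : E 1 = 1)
    (hX : ∀ i p, E (X i * p) = E (pderiv i p))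
    (d : ℕ) (F : MvPolynomial (Fin n) ℝ) (hF : F.IsHomogeneous d) (K : ℕ) (hK : d < K)
    (G : MvPolynomial (Fin n) ℝ) : E (F * G) = hermiteSum E K F G := by
  induction d using Nat.strong_induction_on generalizing F K G with
  | _ d ih =>
  obtain ⟨K, rfl⟩ : ∃ K', K = K' + 1 := ⟨K - 1, by omega⟩
  rcases d with _ | d
  · obtain ⟨a, rfl⟩ : ∃ a, F = C a :=
      ⟨_, totalDegree_eq_zero_iff_eq_C.mp (Nat.le_zero.mp hF.totalDegree_le)⟩
    have hC : ∀ p : MvPolynomial (Fin n) ℝ, C a * p = a • p := fun p => C_mul'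
    rw [hermiteSum, sum_range_succ', sum_eq_zero]
    · have : E (C a) = a := by rw [← mul_one (C a), hC, map_smul, h1]; simp
      simp [gradForm, hC, this]
    · intro k _
      simp [gradForm, gradForm_zero_left]
  · have hE := hF.sum_X_mul_pderiv
    have key : ((d + 1 : ℕ) : ℝ) * E (F * G) = ((d + 1 : ℕ) : ℝ) * hermiteSum E (K + 1) F G := by
      have e1 : ((d + 1 : ℕ) : ℝ) * E (F * G) = E ((∑ i, X i * pderiv i F) * G) := by
        rw [hE, nsmul_eq_mul, ← map_natCast C, mul_assoc, C_mul', map_smul, smul_eq_mul]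
      have e2 : ((d + 1 : ℕ) : ℝ) * hermiteSum E (K + 1) F G =
          hermiteSum E (K + 1) (∑ i, X i * pderiv i F) G := by
        rw [hE, nsmul_eq_mul, ← map_natCast C, C_mul']
        simp only [hermiteSum, gradForm_smul_left, mul_sum, mul_div_assoc]
      rw [e1, e2, hermiteSum_sum_left, sum_mul, map_sum]
      refine sum_congr rfl fun i _ => ?_
      have hi : (pderiv i F).IsHomogeneous d := hF.pderiv
      have hii : (pderiv i (pderiv i F)).IsHomogeneous (d - 1) := hi.pderiv
      rw [mul_assoc, hX, pderiv_mul, map_add, hermiteSum_X_mul hX,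
        ih (d - 1) (by omega) _ hii (K + 1) (by omega), ih d (by omega) _ hi K (by omega)]
    exact mul_left_cancel₀ (by positivity) key

theorem apply_mul_eq_hermiteSum (h1 : E 1 = 1) (hX : ∀ i p, E (X i * p) = E (pderiv i p))
    (F : MvPolynomial (Fin n) ℝ) (K : ℕ) (hK : F.totalDegree < K)
    (G : MvPolynomial (Fin n) ℝ) : E (F * G) = hermiteSum E K F G := by
  rw [← sum_homogeneousComponent F, sum_mul, map_sum, hermiteSum_sum_left]
  refine sum_congr rfl fun d hd => apply_mul_eq_hermiteSum_of_isHomogeneous h1 hX d _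
    (homogeneousComponent_isHomogeneous d F) K ?_ G
  have := mem_range.mp hd
  omega

theorem apply_mul_self_nonneg (h1 : E 1 = 1) (hX : ∀ i p, E (X i * p) = E (pderiv i p))
    (F : MvPolynomial (Fin n) ℝ) : 0 ≤ E (F * F) := by
  rw [apply_mul_eq_hermiteSum h1 hX F _ (Nat.lt_succ_self _)]
  exact sum_nonneg fun k _ => div_nonneg (gradForm_self_nonneg E k F) (by positivity)

theorem apply_mul_sq_le (h1 : E 1 = 1) (hX : ∀ i p, E (X i * p) = E (pderiv i p))
    (F G : MvPolynomial (Fin n) ℝ) : E (F * G) ^ 2 ≤ E (F * F) * E (G * G) := by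
  have h : ∀ t : ℝ, 0 ≤ E (G * G) * (t * t) + (2 * E (F * G)) * t + E (F * F) := by
    intro t
    have := apply_mul_self_nonneg h1 hX (F + t • G)
    have e : (F + t • G) * (F + t • G) = F * F + (2 * t) • (F * G) + (t * t) • (G * G) := by
      simp only [← C_mul', map_mul, map_ofNat]
      ring
    rw [e] at this
    simp only [map_add, map_smul, smul_eq_mul] at this
    linarith
  have := discrim_le_zero h
  rw [discrim] at this
  nlinarith

/-- The Laplacian of a polynomial. -/
noncomputable def polyLaplacian (p : MvPolynomial (Fin n) ℝ) : MvPolynomial (Fin n) ℝ :=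
  ∑ i, pderiv i (pderiv i p)

/-- Harmonic homogeneous polynomials of degree `k`. -/
def IsSolidHarmonic (k : ℕ) (p : MvPolynomial (Fin n) ℝ) : Prop :=
  p.IsHomogeneous k ∧ polyLaplacian p = 0

theorem IsSolidHarmonic.pderiv {k : ℕ} {p : MvPolynomial (Fin n) ℝ} (hp : IsSolidHarmonic k p)
    (i : Fin n) : IsSolidHarmonic (k - 1) (pderiv i p) := by
  refine ⟨hp.1.pderiv, ?_⟩
  have h := congrArg (MvPolynomial.pderiv i) hp.2
  rw [polyLaplacian, map_sum, map_zero] at h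
  rw [polyLaplacian, ← h]
  refine sum_congr rfl fun j _ => ?_
  rw [MvPolynomial.pderiv_pderiv_comm i j, MvPolynomial.pderiv_pderiv_comm i j]

theorem IsSolidHarmonic.sum_apply_pderiv_mul_self
    (hX : ∀ i p, E (X i * p) = E (MvPolynomial.pderiv i p))
    {k : ℕ} {p : MvPolynomial (Fin n) ℝ} (hp : IsSolidHarmonic k p) :
    ∑ i, E (MvPolynomial.pderiv i p * MvPolynomial.pderiv i p) = k * E (p * p) := by
  have h1 : E ((∑ i, X i * MvPolynomial.pderiv i p) * p) = k * E (p * p) := by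
    rw [hp.1.sum_X_mul_pderiv, nsmul_eq_mul, ← map_natCast C, mul_assoc, C_mul', map_smul,
      smul_eq_mul]
  have h2 : E (polyLaplacian p * p) = 0 := by rw [hp.2]; simp
  rw [← h1, sum_mul, map_sum]
  rw [polyLaplacian, sum_mul, map_sum] at h2
  rw [← add_zero (∑ i, E _), ← h2, ← sum_add_distrib]
  refine sum_congr rfl fun i _ => ?_
  rw [mul_assoc, hX, pderiv_mul, map_add, add_comm]

theorem gradForm_mul_le (h1 : E 1 = 1) (hX : ∀ i p, E (X i * p) = E (pderiv i p)) (k : ℕ)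
    {d e : ℕ} {p q : MvPolynomial (Fin n) ℝ} (hp : IsSolidHarmonic d p)
    (hq : IsSolidHarmonic e q) :
    gradForm E k (p * q) (p * q) ≤
      2 ^ k * ((d + e).descFactorial k : ℝ) * (E (p * p) * E (q * q)) := by
  induction k generalizing d e p q with
  | zero => simpa [gradForm, ← sq] using apply_mul_sq_le h1 hX p q
  | succ k ih =>
    have hstep : ∀ (d e : ℕ) (p q : MvPolynomial (Fin n) ℝ), IsSolidHarmonic d p →
        IsSolidHarmonic e q → ∑ i, gradForm E k (pderiv i p * q) (pderiv i p * q) ≤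
        2 ^ k * ((d + e - 1).descFactorial k : ℝ) * (d * (E (p * p) * E (q * q))) := by
      intro d e p q hp hq
      rcases d with _ | d
      · obtain ⟨a, rfl⟩ : ∃ a, p = C a :=
          ⟨_, totalDegree_eq_zero_iff_eq_C.mp (Nat.le_zero.mp hp.1.totalDegree_le)⟩
        simp [gradForm_zero_left]
      · calc _ ≤ ∑ i, 2 ^ k * ((d + e).descFactorial k : ℝ) *
              (E (pderiv i p * pderiv i p) * E (q * q)) :=
              sum_le_sum fun i _ => ih (hp.pderiv i) hq
          _ = _ := by
              rw [← mul_sum, ← sum_mul, hp.sum_apply_pderiv_mul_self hX,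
                show d + 1 + e - 1 = d + e by omega]
              ring
    have h2 := hstep d e p q hp hq
    have h3 := hstep e d q p hq hp
    have h4 : gradForm E (k + 1) (p * q) (p * q) ≤
        2 * ∑ i, gradForm E k (pderiv i p * q) (pderiv i p * q) +
        2 * ∑ i, gradForm E k (pderiv i q * p) (pderiv i q * p) := by
      rw [gradForm, mul_sum, mul_sum, ← sum_add_distrib]
      refine sum_le_sum fun i _ => ?_
      rw [pderiv_mul, mul_comm p]
      exact gradForm_add_self_le E k _ _
    refine h4.trans ((add_le_add (mul_le_mul_of_nonneg_left h2 zero_le_two)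
      (mul_le_mul_of_nonneg_left h3 zero_le_two)).trans (le_of_eq ?_))
    rw [add_comm e d]
    rcases Nat.eq_zero_or_pos (d + e) with h0 | h0
    · obtain ⟨rfl, rfl⟩ : d = 0 ∧ e = 0 := by omega
      simp
    · obtain ⟨m, hm⟩ : ∃ m, d + e = m + 1 := ⟨d + e - 1, by omega⟩
      have hm' : (d : ℝ) + e = m + 1 := by exact_mod_cast hm
      rw [hm, Nat.succ_descFactorial_succ, Nat.add_sub_cancel, pow_succ]
      push_cast
      rw [← hm']
      ring

/-- Hypercontractive moment bound for solid harmonics under a functional that satisfies the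
Gaussian integration by parts formula. -/
theorem apply_sq_mul_sq_le (h1 : E 1 = 1) (hX : ∀ i p, E (X i * p) = E (pderiv i p))
    {d : ℕ} {p : MvPolynomial (Fin n) ℝ} (hp : IsSolidHarmonic d p) :
    E ((p * p) * (p * p)) ≤ 9 ^ d * E (p * p) ^ 2 := by
  rw [apply_mul_eq_hermiteSum_of_isHomogeneous h1 hX _ _ (hp.1.mul hp.1) _ (Nat.lt_succ_self _)]
  calc _ ≤ ∑ k ∈ range (d + d + 1), 2 ^ k * ((d + d).choose k : ℝ) * E (p * p) ^ 2 := by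
        refine sum_le_sum fun k _ => ?_
        rw [div_le_iff₀ (by positivity)]
        refine (gradForm_mul_le h1 hX k hp hp).trans (le_of_eq ?_)
        rw [Nat.descFactorial_eq_factorial_mul_choose]
        push_cast
        ring
    _ = _ := by
        rw [← sum_mul]
        congr 1
        have := add_pow (2 : ℝ) 1 (d + d)
        simp only [one_pow, mul_one] at this
        rw [← this, ← two_mul, pow_mul]
        norm_num

/-- The infinitesimal rotation `X i ∂_j - X j ∂_i` on polynomials. -/
noncomputable def polyRot (i j : Fin n) (p : MvPolynomial (Fin n) ℝ) : MvPolynomial (Fin n) ℝ :=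
  X i * pderiv j p - X j * pderiv i p

theorem polyLaplacian_add (p q : MvPolynomial (Fin n) ℝ) :
    polyLaplacian (p + q) = polyLaplacian p + polyLaplacian q := by
  simp [polyLaplacian, sum_add_distrib]

theorem polyLaplacian_smul (a : ℝ) (p : MvPolynomial (Fin n) ℝ) :
    polyLaplacian (a • p) = a • polyLaplacian p := by
  simp [polyLaplacian, smul_sum]

theorem polyLaplacian_sub (p q : MvPolynomial (Fin n) ℝ) :
    polyLaplacian (p - q) = polyLaplacian p - polyLaplacian q := by
  simp [polyLaplacian, sum_sub_distrib]

theorem polyLaplacian_X_mul (i : Fin n) (p : MvPolynomial (Fin n) ℝ) :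
    polyLaplacian (X i * p) = 2 * pderiv i p + X i * polyLaplacian p := by
  simp only [polyLaplacian, pderiv_X_mul, map_add, sum_add_distrib, ← mul_sum, apply_ite (pderiv _),
    map_zero, sum_ite_eq, mem_univ, if_true]
  ring

theorem polyLaplacian_pderiv (i : Fin n) (p : MvPolynomial (Fin n) ℝ) :
    polyLaplacian (pderiv i p) = pderiv i (polyLaplacian p) := by
  simp only [polyLaplacian, map_sum]
  refine sum_congr rfl fun j _ => ?_
  rw [MvPolynomial.pderiv_pderiv_comm i j, MvPolynomial.pderiv_pderiv_comm i j]

theorem polyLaplacian_isHomogeneous {k : ℕ} {p : MvPolynomial (Fin n) ℝ}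
    (hp : p.IsHomogeneous k) : (polyLaplacian p).IsHomogeneous (k - 2) :=
  IsHomogeneous.sum _ _ _ fun _ _ => hp.pderiv.pderiv

theorem polyRot_isHomogeneous {k : ℕ} {p : MvPolynomial (Fin n) ℝ} (hp : p.IsHomogeneous k)
    (i j : Fin n) : (polyRot i j p).IsHomogeneous k := by
  rcases k with _ | k
  · obtain ⟨a, rfl⟩ : ∃ a, p = C a :=
      ⟨_, totalDegree_eq_zero_iff_eq_C.mp (Nat.le_zero.mp hp.totalDegree_le)⟩
    simp [polyRot, isHomogeneous_zero]
  · have h : ∀ i j : Fin n, (X i * pderiv j p).IsHomogeneous (k + 1) := fun i j => by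
      have := (isHomogeneous_X ℝ i).mul (hp.pderiv (i := j))
      rwa [Nat.add_sub_cancel, add_comm] at this
    exact (h i j).sub (h j i)

theorem IsSolidHarmonic.polyRot {k : ℕ} {p : MvPolynomial (Fin n) ℝ} (hp : IsSolidHarmonic k p)
    (i j : Fin n) : IsSolidHarmonic k (polyRot i j p) := by
  refine ⟨polyRot_isHomogeneous hp.1 i j, ?_⟩
  rw [_root_.polyRot, polyLaplacian_sub, polyLaplacian_X_mul, polyLaplacian_X_mul,
    polyLaplacian_pderiv, polyLaplacian_pderiv, hp.2, MvPolynomial.pderiv_pderiv_comm i j]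
  simp

theorem sum_sum_X_mul_X_mul_pderiv {k : ℕ} {p : MvPolynomial (Fin n) ℝ}
    (hp : p.IsHomogeneous k) :
    ∑ i, ∑ j, X i * (X j * pderiv j (pderiv i p)) = ((k : ℝ) * (k - 1)) • p := by
  have h : ∀ i, ∑ j, X i * (X j * pderiv j (pderiv i p)) = ((k : ℝ) - 1) • (X i * pderiv i p) := by
    intro i
    rcases k with _ | k
    · obtain ⟨a, rfl⟩ : ∃ a, p = C a :=
        ⟨_, totalDegree_eq_zero_iff_eq_C.mp (Nat.le_zero.mp hp.totalDegree_le)⟩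
      simp
    · rw [← mul_sum, (hp.pderiv (i := i)).sum_X_mul_pderiv]
      simp [← Nat.cast_smul_eq_nsmul ℝ]
  simp only [h, ← smul_sum, hp.sum_X_mul_pderiv]
  rw [← Nat.cast_smul_eq_nsmul ℝ, smul_smul, mul_comm]

theorem polyRot_polyRot_sum {k : ℕ} {p : MvPolynomial (Fin n) ℝ} (hp : IsSolidHarmonic k p) :
    ∑ i, ∑ j, polyRot i j (polyRot i j p) = (-(2 * (k * (k + n - 2)) : ℝ)) • p := by
  have e : ∀ i j, polyRot i j (polyRot i j p) =
      ((if i = j then X i * pderiv j p else 0) + (if j = i then X j * pderiv i p else 0)) +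
      (X i * X i * pderiv j (pderiv j p) + X j * X j * pderiv i (pderiv i p))
      - (X i * pderiv i p + X j * pderiv j p)
      - (X i * (X j * pderiv j (pderiv i p)) + X j * (X i * pderiv i (pderiv j p))) := by
    intro i j
    simp only [polyRot, map_sub, pderiv_X_mul]
    by_cases hij : i = j
    · subst hij
      simp
      ring
    · have hji : ¬ j = i := fun h => hij h.symm
      simp only [hij, hji, if_false, if_true]
      ring
  have hE : ∑ i, X i * pderiv i p = (k : ℝ) • p := by
    rw [hp.1.sum_X_mul_pderiv, Nat.cast_smul_eq_nsmul]
  have hL := hp.2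
  rw [polyLaplacian] at hL
  have hS := sum_sum_X_mul_X_mul_pderiv hp.1
  have hS' : ∑ i, ∑ j, X j * (X i * pderiv i (pderiv j p)) = ((k : ℝ) * (k - 1)) • p := by
    rw [sum_comm, hS]
  have hL' : ∑ i, ∑ j : Fin n, X j * X j * pderiv i (pderiv i p) = 0 := by
    rw [sum_comm]
    simp [← mul_sum, hL]
  have hL1 : ∑ i, ∑ j : Fin n, X i * X i * pderiv j (pderiv j p) = 0 := by
    simp [← mul_sum, hL]
  simp only [e, sum_sub_distrib, sum_add_distrib, hS, hS', hL', hL1, sum_ite_eq,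
    sum_ite_eq', mem_univ, if_true, sum_const, card_univ, Fintype.card_fin,
    ← Nat.cast_smul_eq_nsmul ℝ, ← smul_sum, hE]
  module

variable (n) in
/-- The polynomial `∑ X i ^ 2`. -/
noncomputable def radiusSq : MvPolynomial (Fin n) ℝ := ∑ i, X i * X i

theorem radiusSq_isHomogeneous : (radiusSq n).IsHomogeneous 2 :=
  IsHomogeneous.sum _ _ _ fun i _ => (isHomogeneous_X ℝ i).mul (isHomogeneous_X ℝ i)

theorem polyLaplacian_radiusSq_mul {k : ℕ} {q : MvPolynomial (Fin n) ℝ} (hq : q.IsHomogeneous k) :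
    polyLaplacian (radiusSq n * q) =
      (2 * n + 4 * k : ℝ) • q + radiusSq n * polyLaplacian q := by
  have hE : ∑ i, X i * pderiv i q = (k : ℝ) • q := by
    rw [hq.sum_X_mul_pderiv, Nat.cast_smul_eq_nsmul]
  have hsum : ∀ f : Fin n → MvPolynomial (Fin n) ℝ,
      polyLaplacian (∑ i, f i) = ∑ i, polyLaplacian (f i) := fun f => by
    simp only [polyLaplacian, map_sum]
    exact sum_comm
  have h : ∀ i, polyLaplacian (X i * X i * q) =
      (2 : ℝ) • q + (4 : ℝ) • (X i * pderiv i q) + X i * X i * polyLaplacian q := by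
    intro i
    rw [mul_assoc, polyLaplacian_X_mul, polyLaplacian_X_mul, pderiv_X_mul, if_pos rfl]
    simp only [← C_mul', map_ofNat]
    ring
  rw [radiusSq, sum_mul, hsum]
  simp only [h, sum_add_distrib, ← smul_sum, hE, ← sum_mul, sum_const, card_univ,
    Fintype.card_fin, ← Nat.cast_smul_eq_nsmul ℝ]
  module

theorem radiusSq_pow_mul_isHomogeneous (j : ℕ) {k : ℕ} {q : MvPolynomial (Fin n) ℝ}
    (hq : q.IsHomogeneous k) : (radiusSq n ^ j * q).IsHomogeneous (2 * j + k) :=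
  (radiusSq_isHomogeneous.pow j).mul hq

theorem polyLaplacian_radiusSq_pow_mul (hn : 0 < n) (j : ℕ) {k : ℕ}
    {h : MvPolynomial (Fin n) ℝ} (hh : IsSolidHarmonic k h) :
    ∃ c : ℝ, 0 < c ∧ polyLaplacian (radiusSq n ^ (j + 1) * h) = c • (radiusSq n ^ j * h) := by
  have hn' : (0 : ℝ) < n := by exact_mod_cast hn
  induction j with
  | zero =>
    refine ⟨2 * n + 4 * k, by positivity, ?_⟩
    rw [zero_add, pow_one, pow_zero, one_mul, polyLaplacian_radiusSq_mul hh.1, hh.2, mul_zero,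
      add_zero]
  | succ j ih =>
    obtain ⟨c, hc, e⟩ := ih
    refine ⟨2 * n + 4 * (2 * (j + 1) + k : ℕ) + c, by positivity, ?_⟩
    rw [pow_succ', mul_assoc, polyLaplacian_radiusSq_mul (radiusSq_pow_mul_isHomogeneous _ hh.1), e,
      mul_smul_comm, ← mul_assoc, ← pow_succ', ← add_smul]

variable (n) in
/-- The span of the polynomials `|x| ^ (2 * j) * h` of degree `k` with `h` a solid harmonic. -/
noncomputable def harmonicSpan (k : ℕ) : Submodule ℝ (MvPolynomial (Fin n) ℝ) :=
  Submodule.span ℝ {p | ∃ j i h, 2 * j + i = k ∧ IsSolidHarmonic i h ∧ p = radiusSq n ^ j * h}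

theorem isHomogeneous_of_mem_harmonicSpan {k : ℕ} {p : MvPolynomial (Fin n) ℝ}
    (hp : p ∈ harmonicSpan n k) : p.IsHomogeneous k := by
  have : harmonicSpan n k ≤ homogeneousSubmodule (Fin n) ℝ k := by
    refine Submodule.span_le.mpr ?_
    rintro _ ⟨j, i, h, rfl, hh, rfl⟩
    exact radiusSq_pow_mul_isHomogeneous j hh.1
  exact this hp

theorem exists_polyLaplacian_eq_of_mem_harmonicSpan (hn : 0 < n) {k : ℕ}
    {p : MvPolynomial (Fin n) ℝ} (hp : p ∈ harmonicSpan n k) :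
    ∃ r ∈ harmonicSpan n (k + 2), polyLaplacian r = p := by
  induction hp using Submodule.span_induction with
  | mem p hp =>
    obtain ⟨j, i, h, rfl, hh, rfl⟩ := hp
    obtain ⟨c, hc, e⟩ := polyLaplacian_radiusSq_pow_mul hn j hh
    refine ⟨c⁻¹ • (radiusSq n ^ (j + 1) * h), Submodule.smul_mem _ _
      (Submodule.subset_span ⟨j + 1, i, h, by ring, hh, rfl⟩), ?_⟩
    rw [polyLaplacian_smul, e, inv_smul_smul₀ hc.ne']
  | zero => exact ⟨0, Submodule.zero_mem _, by simp [polyLaplacian]⟩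
  | add p q _ _ hp hq =>
    obtain ⟨r, hr, rfl⟩ := hp
    obtain ⟨s, hs, rfl⟩ := hq
    exact ⟨r + s, Submodule.add_mem _ hr hs, polyLaplacian_add r s⟩
  | smul a p _ hp =>
    obtain ⟨r, hr, rfl⟩ := hp
    exact ⟨a • r, Submodule.smul_mem _ a hr, polyLaplacian_smul a r⟩

theorem mem_harmonicSpan_of_isHomogeneous (hn : 0 < n) (k : ℕ) {p : MvPolynomial (Fin n) ℝ}
    (hp : p.IsHomogeneous k) : p ∈ harmonicSpan n k := by
  have hsolid : ∀ (k : ℕ) (p : MvPolynomial (Fin n) ℝ), IsSolidHarmonic k p →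
      p ∈ harmonicSpan n k :=
    fun k p hp => Submodule.subset_span ⟨0, k, p, by ring, hp, by simp⟩
  induction k using Nat.strong_induction_on generalizing p with
  | _ k ih =>
  by_cases hk : k < 2
  · refine hsolid k p ⟨hp, sum_eq_zero fun i _ => ?_⟩
    have h1 : (pderiv i p).IsHomogeneous 0 := by
      have := hp.pderiv (i := i)
      rwa [show k - 1 = 0 by omega] at this
    rw [totalDegree_eq_zero_iff_eq_C.mp (Nat.le_zero.mp h1.totalDegree_le), pderiv_C]
  · obtain ⟨m, rfl⟩ : ∃ m, k = m + 2 := ⟨k - 2, by omega⟩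
    obtain ⟨r, hr, e⟩ := exists_polyLaplacian_eq_of_mem_harmonicSpan hn
      (ih m (by omega) (polyLaplacian_isHomogeneous hp))
    rw [← sub_add_cancel p r]
    refine Submodule.add_mem _ (hsolid _ _ ⟨hp.sub (isHomogeneous_of_mem_harmonicSpan hr), ?_⟩) hr
    rw [polyLaplacian_sub, e, sub_self]

/-- Every polynomial agrees on the unit sphere with a finite sum of solid harmonics. -/
theorem exists_solidHarmonic_sum (hn : 0 < n) (p : MvPolynomial (Fin n) ℝ) :
    ∃ (N : ℕ) (Y : ℕ → MvPolynomial (Fin n) ℝ), (∀ k, IsSolidHarmonic k (Y k)) ∧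
      ∀ x : Fin n → ℝ, ∑ i, x i * x i = 1 → eval x p = ∑ k ∈ range N, eval x (Y k) := by
  suffices h : ∃ q : MvPolynomial (Fin n) ℝ,
      (∀ k, IsSolidHarmonic k (homogeneousComponent k q)) ∧
      ∀ x : Fin n → ℝ, ∑ i, x i * x i = 1 → eval x p = eval x q by
    obtain ⟨q, hq, e⟩ := h
    refine ⟨q.totalDegree + 1, fun k => homogeneousComponent k q, hq, fun x hx => ?_⟩
    rw [e x hx, ← map_sum, sum_homogeneousComponent]
  have hzero : ∀ k, IsSolidHarmonic k (0 : MvPolynomial (Fin n) ℝ) := fun k =>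
    ⟨isHomogeneous_zero _ _ _, by simp [polyLaplacian]⟩
  have hadd : ∀ p p' : MvPolynomial (Fin n) ℝ,
      (∃ q : MvPolynomial (Fin n) ℝ, (∀ k, IsSolidHarmonic k (homogeneousComponent k q)) ∧
        ∀ x : Fin n → ℝ, ∑ i, x i * x i = 1 → eval x p = eval x q) →
      (∃ q : MvPolynomial (Fin n) ℝ, (∀ k, IsSolidHarmonic k (homogeneousComponent k q)) ∧
        ∀ x : Fin n → ℝ, ∑ i, x i * x i = 1 → eval x p' = eval x q) →
      ∃ q : MvPolynomial (Fin n) ℝ, (∀ k, IsSolidHarmonic k (homogeneousComponent k q)) ∧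
        ∀ x : Fin n → ℝ, ∑ i, x i * x i = 1 → eval x (p + p') = eval x q := by
    rintro p p' ⟨q, hq, e⟩ ⟨q', hq', e'⟩
    refine ⟨q + q', fun k => ?_, fun x hx => by rw [map_add, map_add, e x hx, e' x hx]⟩
    rw [map_add]
    exact ⟨(hq k).1.add (hq' k).1, by rw [polyLaplacian_add, (hq k).2, (hq' k).2, add_zero]⟩
  rw [← sum_homogeneousComponent p]
  refine sum_induction _ _ hadd ⟨0, fun k => by rw [map_zero]; exact hzero k, by simp⟩
    fun k _ => ?_
  have hmem := mem_harmonicSpan_of_isHomogeneous hn k (homogeneousComponent_isHomogeneous k p)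
  generalize homogeneousComponent k p = P at hmem
  induction hmem using Submodule.span_induction with
  | mem P hP =>
    obtain ⟨j, i, h, -, hh, rfl⟩ := hP
    refine ⟨h, fun m => ?_, fun x hx => ?_⟩
    · rw [homogeneousComponent_of_mem hh.1]
      split_ifs with hm
      · exact hm ▸ hh
      · exact hzero m
    · simp [radiusSq, hx]
  | zero => exact ⟨0, fun k => by rw [map_zero]; exact hzero k, by simp⟩
  | add P Q _ _ hP hQ => exact hadd P Q hP hQ
  | smul a P _ hP =>
    obtain ⟨q, hq, e⟩ := hP
    refine ⟨a • q, fun k => ?_, fun x hx => by simp [e x hx]⟩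
    rw [map_smul]
    refine ⟨(homogeneousSubmodule (Fin n) ℝ k).smul_mem a (hq k).1, ?_⟩
    rw [polyLaplacian_smul, (hq k).2, smul_zero]

end Algebra

section Sphere

variable {n : ℕ}

local notation "𝔼" n => EuclideanSpace ℝ (Fin n)

theorem isProbabilityMeasure_sphereUniform (hn : 0 < n) :
    IsProbabilityMeasure (sphereUniform n) := by
  have : Nonempty (Fin n) := ⟨⟨0, hn⟩⟩
  refine ⟨?_⟩
  simp only [sphereUniform, Measure.smul_apply, smul_eq_mul]
  refine ENNReal.inv_mul_cancel ?_ (measure_ne_top _ _)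
  exact Measure.measure_univ_ne_zero.2 (Measure.toSphere_ne_zero _)

instance : IsFiniteMeasure (sphereUniform n) := by
  rcases Nat.eq_zero_or_pos n with rfl | hn
  · have : (volume : Measure (𝔼 0)).toSphere = 0 := by simp [Measure.toSphere_eq_zero_iff_finrank]
    rw [sphereUniform, this, smul_zero]
    infer_instance
  · have := isProbabilityMeasure_sphereUniform hn
    infer_instance

theorem integrable_sphereUniform {f : (𝔼 n) → ℝ} (hf : Continuous f) :
    Integrable (fun x : Metric.sphere (0 : 𝔼 n) 1 => f x) (sphereUniform n) :=
  (hf.comp continuous_subtype_val).integrable_of_hasCompactSupport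
    (HasCompactSupport.of_compactSpace _)

open scoped Pointwise in
theorem toSphere_map_linearIsometryEquiv (e : (𝔼 n) ≃ₗᵢ[ℝ] 𝔼 n)
    {T : Metric.sphere (0 : 𝔼 n) 1 → Metric.sphere (0 : 𝔼 n) 1} (hT : ∀ x, (T x : 𝔼 n) = e x) :
    MeasurePreserving T (volume : Measure (𝔼 n)).toSphere (volume : Measure (𝔼 n)).toSphere := by
  have hTm : Measurable T := by
    refine (Topology.IsInducing.subtypeVal.continuous_iff.2 ?_).measurable
    simpa only [Function.comp_def, hT] using e.continuous.comp continuous_subtype_val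
  refine ⟨hTm, ?_⟩
  ext s hs
  rw [Measure.map_apply hTm hs, Measure.toSphere_apply' _ (hTm hs), Measure.toSphere_apply' _ hs,
    ← e.measurePreserving.measure_preimage_emb e.toHomeomorph.measurableEmbedding
      (Set.Ioo (0 : ℝ) 1 • (Subtype.val '' s))]
  congr 2
  ext x
  simp only [Set.mem_smul, Set.mem_image, Set.mem_preimage, Subtype.exists]
  constructor
  · rintro ⟨a, ha, _, ⟨y, hy, hys, rfl⟩, rfl⟩
    exact ⟨a, ha, _, ⟨_, (T ⟨y, hy⟩).2, hys, rfl⟩, by rw [hT, map_smul]⟩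
  · rintro ⟨a, ha, _, ⟨y, hy, hys, rfl⟩, h⟩
    have hy' : e.symm y ∈ Metric.sphere (0 : 𝔼 n) 1 := by simpa using hy
    refine ⟨a, ha, _, ⟨e.symm y, hy', ?_, rfl⟩, ?_⟩
    · have : T ⟨e.symm y, hy'⟩ = ⟨y, hy⟩ := Subtype.ext (by simp [hT])
      rwa [this]
    · apply e.injective
      simpa using h

theorem integral_sphereUniform_comp_linearIsometryEquiv (e : (𝔼 n) ≃ₗᵢ[ℝ] 𝔼 n)
    {f : (𝔼 n) → ℝ} (hf : Continuous f) :
    ∫ x, f (e x) ∂sphereUniform n = ∫ x, f x ∂sphereUniform n := by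
  let T : Metric.sphere (0 : 𝔼 n) 1 → Metric.sphere (0 : 𝔼 n) 1 :=
    fun x => ⟨e x, by simp⟩
  have hT := toSphere_map_linearIsometryEquiv e (T := T) fun _ => rfl
  have : (sphereUniform n).map T = sphereUniform n := by
    rw [sphereUniform, Measure.map_smul, hT.map_eq]
  conv_rhs => rw [← this]
  exact (integral_map hT.measurable.aemeasurable
    (hf.comp continuous_subtype_val).aestronglyMeasurable).symm

theorem continuous_Dang {F : (𝔼 n) → ℝ} (hF : ContDiff ℝ 1 F) (i j : Fin n) :
    Continuous (Dang n i j F) := by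
  have := hF.continuous_fderiv one_ne_zero
  unfold Dang
  fun_prop

/-- The unit vector at angle `t` in the coordinate plane `(i, j)`. -/
noncomputable def planeVector (i j : Fin n) (t : ℝ) : 𝔼 n :=
  Real.cos t • EuclideanSpace.single i 1 + Real.sin t • EuclideanSpace.single j 1

theorem inner_planeVector (i j : Fin n) (t : ℝ) (x : 𝔼 n) :
    inner ℝ (planeVector i j t) x = Real.cos t * x i + Real.sin t * x j := by
  simp [planeVector, inner_add_left, inner_smul_left, EuclideanSpace.inner_single_left]

theorem norm_planeVector {i j : Fin n} (hij : i ≠ j) (t : ℝ) : ‖planeVector i j t‖ = 1 := by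
  have : ‖planeVector i j t‖ ^ 2 = 1 := by
    rw [← real_inner_self_eq_norm_sq, inner_planeVector]
    simp [planeVector, hij, hij.symm]
    nlinarith [Real.sin_sq_add_cos_sq t]
  exact (pow_eq_one_iff_of_nonneg (norm_nonneg _) two_ne_zero).1 this

theorem hasDerivAt_planeVector (i j : Fin n) (t : ℝ) :
    HasDerivAt (planeVector i j) (planeVector i j (t + Real.pi / 2)) t := by
  have := ((Real.hasDerivAt_cos t).smul_const (EuclideanSpace.single i (1 : ℝ))).add
    ((Real.hasDerivAt_sin t).smul_const (EuclideanSpace.single j (1 : ℝ)))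
  rw [planeVector, Real.cos_add_pi_div_two, Real.sin_add_pi_div_two]
  exact this

theorem continuous_planeVector (i j : Fin n) : Continuous (planeVector i j) :=
  continuous_iff_continuousAt.2 fun t => (hasDerivAt_planeVector i j t).continuousAt

theorem hasDerivAt_integral_sphereUniform {G G' : ℝ → (𝔼 n) → ℝ} (hG : ∀ t, Continuous (G t))
    (hG' : Continuous fun q : ℝ × (𝔼 n) => G' q.1 q.2)
    (h : ∀ x t, HasDerivAt (fun s => G s x) (G' t x) t) (t : ℝ) :
    HasDerivAt (fun s => ∫ x, G s x ∂sphereUniform n) (∫ x, G' t x ∂sphereUniform n) t := by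
  obtain ⟨C, hC⟩ := ((isCompact_Icc (a := t - 1) (b := t + 1)).prod
    (isCompact_sphere (0 : 𝔼 n) 1)).exists_bound_of_continuousOn hG'.continuousOn
  have hs : Set.Icc (t - 1) (t + 1) ∈ nhds t := Icc_mem_nhds (by linarith) (by linarith)
  refine (hasDerivAt_integral_of_dominated_loc_of_deriv_le
    (bound := fun _ => C) hs
    (Filter.Eventually.of_forall fun t => (integrable_sphereUniform (hG t)).aestronglyMeasurable)
    (integrable_sphereUniform (hG t))
    (integrable_sphereUniform (hG'.comp (Continuous.prodMk_right t))).aestronglyMeasurable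
    (Filter.Eventually.of_forall fun x t ht => hC (t, x) ⟨ht, x.2⟩)
    (integrable_const _)
    (Filter.Eventually.of_forall fun x t _ => h x t)).2

theorem integral_Dang {F : (𝔼 n) → ℝ} (hF : ContDiff ℝ 1 F) (i j : Fin n) :
    ∫ x, Dang n i j F x ∂sphereUniform n = 0 := by
  rcases eq_or_ne i j with rfl | hij
  · simp [Dang]
  let v := planeVector i j
  let R : ℝ → (𝔼 n) ≃ₗᵢ[ℝ] 𝔼 n := fun t => (ℝ ∙ v t).reflection
  have hR : ∀ t x, R t x = (2 * inner ℝ (v t) x) • v t - x := by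
    intro t x
    simp only [R, Submodule.reflection_singleton_apply, v, norm_planeVector hij]
    simp [two_smul, add_smul, two_mul]
  let w : ℝ → (𝔼 n) → 𝔼 n := fun t x =>
    (2 * inner ℝ (v t) x) • v (t + Real.pi / 2) + (2 * inner ℝ (v (t + Real.pi / 2)) x) • v t
  have hRw : ∀ t x, HasDerivAt (fun s => R s x) (w t x) t := by
    intro t x
    simp only [hR]
    have h1 := hasDerivAt_planeVector i j t
    have h2 := (h1.inner ℝ (hasDerivAt_const t x)).const_mul 2
    simpa [w, v] using (h2.smul h1).sub_const x
  have hv : Continuous v := continuous_planeVector i j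
  have hFc := hF.continuous_fderiv one_ne_zero
  have hcont : Continuous fun q : ℝ × (𝔼 n) => fderiv ℝ F (R q.1 q.2) (w q.1 q.2) := by
    simp only [hR, w]
    fun_prop
  have hderiv : ∀ (x : 𝔼 n) (t : ℝ),
      HasDerivAt (fun s => F (R s x)) (fderiv ℝ F (R t x) (w t x)) t := fun x t =>
    ((hF.differentiable one_ne_zero) (R t x)).hasFDerivAt.comp_hasDerivAt t (hRw t x)
  have hw : ∀ x : 𝔼 n, fderiv ℝ F (R 0 x) (w 0 x) = 2 * Dang n i j F (R 0 x) := by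
    intro x
    have hv0 : v 0 = EuclideanSpace.single i 1 := by simp [v, planeVector]
    have hv1 : v (0 + Real.pi / 2) = EuclideanSpace.single j 1 := by simp [v, planeVector]
    simp only [w, Dang, hR, hv0, hv1, map_add, map_smul]
    simp [hij.symm, EuclideanSpace.inner_single_left]
    ring
  have hconst : (fun t => ∫ x : Metric.sphere (0 : 𝔼 n) 1, F (R t x) ∂sphereUniform n) =
      fun _ => ∫ x : Metric.sphere (0 : 𝔼 n) 1, F x ∂sphereUniform n :=
    funext fun t => integral_sphereUniform_comp_linearIsometryEquiv (R t) hF.continuous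
  have h0 := hasDerivAt_integral_sphereUniform (fun t => hF.continuous.comp (R t).continuous)
    hcont hderiv 0
  simp only [Function.comp_def] at h0
  rw [hconst] at h0
  have h0 := h0.unique (hasDerivAt_const _ _)
  simp only [hw, integral_const_mul,
    integral_sphereUniform_comp_linearIsometryEquiv (R 0) (continuous_Dang hF i j)] at h0
  linarith

open MvPolynomial Finset

/-- A polynomial as a function on Euclidean space. -/
noncomputable def evalP (p : MvPolynomial (Fin n) ℝ) (x : 𝔼 n) : ℝ := eval x.ofLp p

theorem evalP_add (p q : MvPolynomial (Fin n) ℝ) (x : 𝔼 n) :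
    evalP (p + q) x = evalP p x + evalP q x := map_add _ _ _

theorem evalP_mul (p q : MvPolynomial (Fin n) ℝ) (x : 𝔼 n) :
    evalP (p * q) x = evalP p x * evalP q x := map_mul _ _ _

theorem evalP_smul (c : ℝ) (p : MvPolynomial (Fin n) ℝ) (x : 𝔼 n) :
    evalP (c • p) x = c * evalP p x := by simp [evalP]

theorem evalP_sum {ι : Type*} (s : Finset ι) (p : ι → MvPolynomial (Fin n) ℝ) (x : 𝔼 n) :
    evalP (∑ k ∈ s, p k) x = ∑ k ∈ s, evalP (p k) x := map_sum _ _ _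

theorem evalP_X (i : Fin n) (x : 𝔼 n) : evalP (X i) x = x i := eval_X i

theorem contDiff_evalP (p : MvPolynomial (Fin n) ℝ) {m : WithTop ℕ∞} :
    ContDiff ℝ m (evalP p) := by
  induction p using MvPolynomial.induction_on with
  | C a =>
    have : evalP (C a : MvPolynomial (Fin n) ℝ) = fun _ => a := funext fun x => eval_C a
    exact this ▸ contDiff_const
  | add p q hp hq => simpa only [funext (evalP_add p q)] using hp.add hq
  | mul_X p i hp =>
    have : ContDiff ℝ m fun x : 𝔼 n => x i := by fun_prop
    simpa only [funext (evalP_mul p (X i)), evalP_X] using hp.mul this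

theorem continuous_evalP (p : MvPolynomial (Fin n) ℝ) : Continuous (evalP p) :=
  (contDiff_evalP p (m := 0)).continuous

theorem fderiv_evalP_single (p : MvPolynomial (Fin n) ℝ) (x : 𝔼 n) (j : Fin n) :
    fderiv ℝ (evalP p) x (EuclideanSpace.single j 1) = evalP (pderiv j p) x := by
  have hd : ∀ q : MvPolynomial (Fin n) ℝ, DifferentiableAt ℝ (evalP q) x := fun q =>
    (contDiff_evalP q (m := 1)).differentiable one_ne_zero x
  induction p using MvPolynomial.induction_on with
  | C a =>
    have : evalP (C a : MvPolynomial (Fin n) ℝ) = fun _ => a := funext fun x => eval_C a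
    simp [this, evalP]
  | add p q hp hq =>
    have := fderiv_fun_add (hd p) (hd q)
    rw [funext (evalP_add p q), this, map_add, evalP_add, ← hp, ← hq]
    rfl
  | mul_X p i hp =>
    have h1 := fderiv_fun_mul (hd p) (hd (X i))
    have h2 : fderiv ℝ (evalP (X i : MvPolynomial (Fin n) ℝ)) x =
        (EuclideanSpace.proj i : (𝔼 n) →L[ℝ] ℝ) := by
      rw [funext (evalP_X i)]
      exact (EuclideanSpace.proj i : (𝔼 n) →L[ℝ] ℝ).fderiv
    rw [funext (evalP_mul p (X i)), h1, h2, Derivation.leibniz, evalP_add, smul_eq_mul,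
      smul_eq_mul, evalP_mul, evalP_mul, ← hp, pderiv_X]
    by_cases hij : i = j
    · subst hij; simp [evalP]
    · simp [evalP, hij]

theorem Dang_evalP (i j : Fin n) (p : MvPolynomial (Fin n) ℝ) :
    Dang n i j (evalP p) = evalP (polyRot i j p) := by
  ext x
  simp [Dang, fderiv_evalP_single, polyRot, evalP]

theorem Dang_mul {u v : (𝔼 n) → ℝ} (hu : ContDiff ℝ 1 u) (hv : ContDiff ℝ 1 v) (i j : Fin n)
    (x : 𝔼 n) :
    Dang n i j (fun y => u y * v y) x = u x * Dang n i j v x + Dang n i j u x * v x := by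
  have := fderiv_fun_mul ((hu.differentiable one_ne_zero) x) ((hv.differentiable one_ne_zero) x)
  simp [Dang, this]
  ring

theorem integral_Dang_mul {u v : (𝔼 n) → ℝ} (hu : ContDiff ℝ 1 u) (hv : ContDiff ℝ 1 v)
    (i j : Fin n) :
    ∫ x, Dang n i j u x * v x ∂sphereUniform n = -∫ x, u x * Dang n i j v x ∂sphereUniform n := by
  have h := integral_Dang (hu.mul hv) i j
  have h1 := hu.continuous
  have h2 := hv.continuous
  have h3 := continuous_Dang hu i j
  have h4 := continuous_Dang hv i j
  change ∫ x, Dang n i j (fun y => u y * v y) x ∂sphereUniform n = 0 at h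
  simp only [Dang_mul hu hv] at h
  rw [integral_add (integrable_sphereUniform (f := fun x => u x * Dang n i j v x) (by fun_prop))
    (integrable_sphereUniform (f := fun x => Dang n i j u x * v x) (by fun_prop))] at h
  linarith

theorem integral_mul_evalP_sum {ι : Type*} (s : Finset ι) {f : (𝔼 n) → ℝ} (hf : Continuous f)
    (p : ι → MvPolynomial (Fin n) ℝ) :
    ∫ x, f x * evalP (∑ k ∈ s, p k) x ∂sphereUniform n =
      ∑ k ∈ s, ∫ x, f x * evalP (p k) x ∂sphereUniform n := by
  simp only [evalP_sum, mul_sum]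
  exact integral_finsetSum _ fun k _ => integrable_sphereUniform (hf.mul (continuous_evalP (p k)))

theorem sum_integral_Dang_mul_polyRot {k : ℕ} {p : MvPolynomial (Fin n) ℝ}
    (hp : IsSolidHarmonic k p) {f : (𝔼 n) → ℝ} (hf : ContDiff ℝ 1 f) :
    ∑ i, ∑ j, ∫ x, Dang n i j f x * evalP (polyRot i j p) x ∂sphereUniform n =
      2 * (k * (k + n - 2)) * ∫ x, f x * evalP p x ∂sphereUniform n := by
  have h : ∀ i j, ∫ x, Dang n i j f x * evalP (polyRot i j p) x ∂sphereUniform n =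
      -∫ x, f x * evalP (polyRot i j (polyRot i j p)) x ∂sphereUniform n := fun i j => by
    rw [integral_Dang_mul hf (contDiff_evalP _), Dang_evalP]
  simp only [h, sum_neg_distrib]
  simp only [← integral_mul_evalP_sum _ hf.continuous]
  rw [polyRot_polyRot_sum hp, ← integral_neg, ← integral_const_mul]
  congr 1 with x
  rw [evalP_smul]
  ring

/-- Integration of polynomials over the sphere. -/
noncomputable def sphereInt : MvPolynomial (Fin n) ℝ →ₗ[ℝ] ℝ where
  toFun p := ∫ x, evalP p x ∂sphereUniform n
  map_add' p q := by
    simp only [evalP_add]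
    exact integral_add (integrable_sphereUniform (continuous_evalP p))
      (integrable_sphereUniform (continuous_evalP q))
  map_smul' c p := by
    simp only [evalP_smul]
    exact integral_const_mul _ _

theorem sphereInt_apply (p : MvPolynomial (Fin n) ℝ) :
    sphereInt p = ∫ x, evalP p x ∂sphereUniform n := rfl

theorem sphereInt_one (hn : 0 < n) : sphereInt (1 : MvPolynomial (Fin n) ℝ) = 1 := by
  have := isProbabilityMeasure_sphereUniform hn
  simp [sphereInt_apply, evalP]

theorem sphereInt_polyRot (i j : Fin n) (p : MvPolynomial (Fin n) ℝ) :
    sphereInt (polyRot i j p) = 0 := by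
  rw [sphereInt_apply, ← Dang_evalP]
  exact integral_Dang (contDiff_evalP p) i j

theorem sphereInt_radiusSq_mul (p : MvPolynomial (Fin n) ℝ) :
    sphereInt (radiusSq n * p) = sphereInt p := by
  simp only [sphereInt_apply]
  congr 1 with x
  have hx : ‖(x : 𝔼 n)‖ ^ 2 = 1 := by simp
  rw [EuclideanSpace.real_norm_sq_eq] at hx
  have : evalP (radiusSq n) x = 1 := by
    simpa only [radiusSq, evalP_sum, evalP_mul, evalP_X, sq] using hx
  rw [evalP_mul, this, one_mul]

theorem sphereInt_pderiv {k : ℕ} {p : MvPolynomial (Fin n) ℝ} (hp : p.IsHomogeneous k)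
    (i : Fin n) : sphereInt (pderiv i p) = (n + k - 1 : ℝ) * sphereInt (X i * p) := by
  have h : ∑ j, polyRot j i (X j * p) =
      X i * p + radiusSq n * pderiv i p - (n : ℝ) • (X i * p) - (k : ℝ) • (X i * p) := by
    have h1 : ∀ j, polyRot j i (X j * p) = (if j = i then X j * p else 0) +
        X j * X j * pderiv i p - X i * p - X i * (X j * pderiv j p) := by
      intro j
      simp only [polyRot, pderiv_X_mul]
      by_cases hji : j = i
      · simp only [hji, if_true]
        ring
      · simp only [hji, if_false, if_true]
        ring
    simp only [h1, sum_sub_distrib, sum_add_distrib, sum_const, sum_ite_eq',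
      mem_univ, if_true, card_univ, Fintype.card_fin, ← mul_sum, hp.sum_X_mul_pderiv, ← sum_mul]
    simp [radiusSq, smul_eq_C_mul, mul_left_comm]
  have h2 := congrArg sphereInt h
  rw [map_sum, sum_congr rfl fun j _ => sphereInt_polyRot j i _] at h2
  simp only [map_sub, map_add, map_smul, smul_eq_mul, sphereInt_radiusSq_mul, sum_const_zero] at h2
  linarith

/-- The radial moments relating the sphere to a Gaussian-type functional, normalised so that the
moments of orders `0` and `1` are `1`. -/
noncomputable def radialMoment (n : ℕ) : ℕ → ℝ
  | 0 => 1
  | 1 => 1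
  | d + 2 => (n + d) * radialMoment n d

theorem radialMoment_pos (hn : 0 < n) : ∀ d, 0 < radialMoment n d
  | 0 => one_pos
  | 1 => one_pos
  | d + 2 => by
    have := radialMoment_pos hn d
    rw [radialMoment]
    positivity

theorem radialMoment_mul_le (hn : 0 < n) (a b : ℕ) :
    radialMoment n (2 * a) * radialMoment n (2 * b) ≤ radialMoment n (2 * a + 2 * b) := by
  induction a with
  | zero => simp [radialMoment]
  | succ a ih =>
    have h : 2 * (a + 1) + 2 * b = 2 * a + 2 * b + 2 := by ring
    have hpos := radialMoment_pos hn (2 * a + 2 * b)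
    rw [h, mul_add_one, radialMoment, radialMoment, mul_assoc]
    refine mul_le_mul ?_ ih (mul_pos (radialMoment_pos hn _) (radialMoment_pos hn _)).le
      (by positivity)
    push_cast
    linarith [Nat.cast_nonneg (α := ℝ) b]

/-- The functional on polynomials with the same spherical part as `sphereInt`, satisfying Gaussian
integration by parts. -/
noncomputable def gaussInt (n : ℕ) : MvPolynomial (Fin n) ℝ →ₗ[ℝ] ℝ :=
  (basisMonomials (Fin n) ℝ).constr ℝ fun s => radialMoment n s.degree * sphereInt (monomial s 1)

theorem gaussInt_monomial (s : Fin n →₀ ℕ) :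
    gaussInt n (monomial s 1) = radialMoment n s.degree * sphereInt (monomial s 1) := by
  have := (basisMonomials (Fin n) ℝ).constr_basis ℝ
    (fun s => radialMoment n s.degree * sphereInt (monomial s 1)) s
  rwa [coe_basisMonomials] at this

theorem gaussInt_of_isHomogeneous {d : ℕ} {p : MvPolynomial (Fin n) ℝ} (hp : p.IsHomogeneous d) :
    gaussInt n p = radialMoment n d * sphereInt p := by
  have h : ∀ s ∈ p.support, gaussInt n (monomial s (p.coeff s)) =
      radialMoment n d * sphereInt (monomial s (p.coeff s)) := by
    intro s hs
    have hm : (monomial s (p.coeff s)) = p.coeff s • monomial s (1 : ℝ) := by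
      simp [smul_monomial]
    have hd : s.degree = d := by
      simpa [Finsupp.degree_eq_weight_one, Pi.one_def] using hp (mem_support_iff.1 hs)
    rw [hm, map_smul, map_smul, gaussInt_monomial, hd]
    simp only [smul_eq_mul]
    ring
  rw [p.as_sum, map_sum, map_sum, sum_congr rfl h, mul_sum]

theorem gaussInt_one (hn : 0 < n) : gaussInt n 1 = 1 := by
  rw [gaussInt_of_isHomogeneous (isHomogeneous_one _ _), sphereInt_one hn]
  simp [radialMoment]

theorem gaussInt_X_mul (hn : 2 ≤ n) (i : Fin n) (p : MvPolynomial (Fin n) ℝ) :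
    gaussInt n (X i * p) = gaussInt n (pderiv i p) := by
  have key : ∀ (k : ℕ) (q : MvPolynomial (Fin n) ℝ), q.IsHomogeneous k →
      gaussInt n (X i * q) = gaussInt n (pderiv i q) := by
    intro k q hq
    have h := sphereInt_pderiv hq i
    have h1 : (X i * q).IsHomogeneous (k + 1) := by
      simpa only [add_comm] using (isHomogeneous_X ℝ i).mul hq
    rw [gaussInt_of_isHomogeneous h1]
    cases k with
    | zero =>
      have h0 : pderiv i q = 0 := by
        rw [← totalDegree_zero_iff_isHomogeneous, totalDegree_eq_zero_iff_eq_C] at hq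
        rw [hq, pderiv_C]
      have hn' : (2 : ℝ) ≤ n := by exact_mod_cast hn
      rw [h0, map_zero] at h ⊢
      have : sphereInt (X i * q) = 0 := by
        refine (mul_eq_zero.1 h.symm).resolve_left ?_
        push_cast
        linarith
      rw [this, mul_zero]
    | succ k =>
      have h2 : (pderiv i q).IsHomogeneous k := by simpa using hq.pderiv
      rw [gaussInt_of_isHomogeneous h2, h, radialMoment]
      push_cast
      ring
  conv_lhs => rw [← sum_homogeneousComponent p, mul_sum, map_sum]
  conv_rhs => rw [← sum_homogeneousComponent p, map_sum, map_sum]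
  exact sum_congr rfl fun k _ => key k _ (homogeneousComponent_isHomogeneous k p)

/-- Hypercontractivity for spherical harmonics, from `L²` to `L⁴`. -/
theorem integral_solidHarmonic_pow_four_le (hn : 2 ≤ n) {d : ℕ} {p : MvPolynomial (Fin n) ℝ}
    (hp : IsSolidHarmonic d p) :
    ∫ x, evalP p x ^ 4 ∂sphereUniform n ≤ 9 ^ d * (∫ x, evalP p x ^ 2 ∂sphereUniform n) ^ 2 := by
  have hn0 : 0 < n := by omega
  have h := apply_sq_mul_sq_le (gaussInt_one hn0) (gaussInt_X_mul hn) hp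
  have h2 : (p * p).IsHomogeneous (2 * d) := by simpa only [two_mul] using hp.1.mul hp.1
  rw [gaussInt_of_isHomogeneous h2, gaussInt_of_isHomogeneous (h2.mul h2)] at h
  have e2 : sphereInt (p * p) = ∫ x, evalP p x ^ 2 ∂sphereUniform n := by
    simp only [sphereInt_apply, evalP_mul, sq]
  have e4 : sphereInt (p * p * (p * p)) = ∫ x, evalP p x ^ 4 ∂sphereUniform n := by
    rw [sphereInt_apply]
    congr 1 with x
    simp only [evalP_mul]
    ring
  rw [e2, e4] at h
  have h4 : 0 ≤ ∫ x, evalP p x ^ 4 ∂sphereUniform n :=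
    integral_nonneg fun x => by positivity
  have hw := radialMoment_mul_le hn0 d d
  have hpos := radialMoment_pos hn0 (2 * d)
  refine le_of_mul_le_mul_left ?_ (mul_pos hpos hpos)
  calc _ ≤ _ := mul_le_mul_of_nonneg_right hw h4
    _ ≤ _ := h
    _ = _ := by ring

theorem sq_integral_mul_le {u v : (𝔼 n) → ℝ} (hu : Continuous u) (hv : Continuous v) :
    (∫ x, u x * v x ∂sphereUniform n) ^ 2 ≤
      (∫ x, u x ^ 2 ∂sphereUniform n) * ∫ x, v x ^ 2 ∂sphereUniform n := by
  have h : ∀ t : ℝ, 0 ≤ (∫ x, v x ^ 2 ∂sphereUniform n) * (t * t) +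
      (2 * ∫ x, u x * v x ∂sphereUniform n) * t + ∫ x, u x ^ 2 ∂sphereUniform n := by
    intro t
    have h0 : 0 ≤ ∫ x, (u x + t * v x) ^ 2 ∂sphereUniform n :=
      integral_nonneg fun x => sq_nonneg _
    have h1 : ∀ x : 𝔼 n, (u x + t * v x) ^ 2 =
        t * t * v x ^ 2 + 2 * t * (u x * v x) + u x ^ 2 := fun x => by ring
    simp only [h1] at h0
    rw [integral_add (integrable_sphereUniform
        (f := fun x => t * t * v x ^ 2 + 2 * t * (u x * v x)) (by fun_prop))
      (integrable_sphereUniform (f := fun x => u x ^ 2) (by fun_prop)),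
      integral_add (integrable_sphereUniform (f := fun x => t * t * v x ^ 2) (by fun_prop))
      (integrable_sphereUniform (f := fun x => 2 * t * (u x * v x)) (by fun_prop)),
      integral_const_mul, integral_const_mul] at h0
    linarith
  have := discrim_le_zero h
  rw [discrim] at this
  linarith

theorem integral_abs_le_sqrt (hn : 0 < n) {g : (𝔼 n) → ℝ} (hg : Continuous g) :
    ∫ x, |g x| ∂sphereUniform n ≤ √(∫ x, g x ^ 2 ∂sphereUniform n) := by
  have := isProbabilityMeasure_sphereUniform hn
  refine Real.le_sqrt_of_sq_le ?_
  simpa using sq_integral_mul_le hg.abs (continuous_const (y := (1 : ℝ)))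

theorem IsSolidHarmonic.smul {k : ℕ} {p : MvPolynomial (Fin n) ℝ} (hp : IsSolidHarmonic k p)
    (a : ℝ) : IsSolidHarmonic k (a • p) :=
  ⟨by simpa only [smul_eq_C_mul, zero_add] using (isHomogeneous_C _ a).mul hp.1,
    by rw [polyLaplacian_smul, hp.2, smul_zero]⟩

theorem sphereInt_mul_eq_zero (hn : 2 ≤ n) {k l : ℕ} (hkl : k ≠ l) {p q : MvPolynomial (Fin n) ℝ}
    (hp : IsSolidHarmonic k p) (hq : IsSolidHarmonic l q) : sphereInt (p * q) = 0 := by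
  have h1 := sum_integral_Dang_mul_polyRot hp (contDiff_evalP q)
  have h2 := sum_integral_Dang_mul_polyRot hq (contDiff_evalP p)
  simp only [Dang_evalP, ← evalP_mul, ← sphereInt_apply] at h1 h2
  simp only [mul_comm (_root_.polyRot _ _ q), mul_comm q] at h1
  rw [h1] at h2
  have hn' : (2 : ℝ) ≤ n := by exact_mod_cast hn
  have hk : (0 : ℝ) < k + l := by
    have : 0 < k + l := by omega
    exact_mod_cast this
  have h3 : ((k : ℝ) - l) * (k + l + (n - 2)) * sphereInt (p * q) = 0 := by
    linear_combination h2 / 2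
  have h4 : (k : ℝ) - l ≠ 0 := sub_ne_zero.2 (by exact_mod_cast hkl)
  exact (mul_eq_zero.1 h3).resolve_left (mul_ne_zero h4 (by linarith))

theorem sphereInt_sum_mul_sum (hn : 2 ≤ n) {Y : ℕ → MvPolynomial (Fin n) ℝ}
    (hY : ∀ k, IsSolidHarmonic k (Y k)) (s : Finset ℕ) :
    sphereInt ((∑ k ∈ s, Y k) * ∑ k ∈ s, Y k) = ∑ k ∈ s, sphereInt (Y k * Y k) := by
  simp only [sum_mul, mul_sum, map_sum]
  refine sum_congr rfl fun k hk => sum_eq_single k (fun l _ hl => ?_) fun h => absurd hk h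
  exact sphereInt_mul_eq_zero hn (by tauto) (hY _) (hY _)

theorem sphereInt_mul_self (p : MvPolynomial (Fin n) ℝ) :
    sphereInt (p * p) = ∫ x, evalP p x ^ 2 ∂sphereUniform n := by
  simp only [sphereInt_apply, evalP_mul, sq]

theorem sphereInt_mul_self_nonneg (p : MvPolynomial (Fin n) ℝ) : 0 ≤ sphereInt (p * p) := by
  rw [sphereInt_mul_self]
  exact integral_nonneg fun x => sq_nonneg _

theorem sub_mul_le_div {a b B c : ℝ} (hb : 0 ≤ b) (hB : 0 ≤ B) (hc : 0 < c) (h : a ^ 2 ≤ B * b) :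
    a - c * b ≤ B / (4 * c) := by
  have hs : 0 ≤ B / (4 * c) := by positivity
  have e : B * b = 4 * (B / (4 * c)) * (c * b) := by field_simp
  have := abs_le_of_sq_le_sq' (a := a) (b := B / (4 * c) + c * b)
    (by nlinarith [sq_nonneg (B / (4 * c) - c * b)]) (by positivity)
  linarith [this.2]

/-- Correlation of a function with a spherical harmonic, by `L¹` and `L²` norms. -/
theorem sq_integral_mul_solidHarmonic_le (hn : 2 ≤ n) {g : (𝔼 n) → ℝ} (hg : Continuous g) {k : ℕ}
    {p : MvPolynomial (Fin n) ℝ} (hp : IsSolidHarmonic k p) :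
    (∫ x, g x * evalP p x ∂sphereUniform n) ^ 2 ≤
      (∫ x, |g x| ∂sphereUniform n) * √(∫ x, g x ^ 2 ∂sphereUniform n) * 3 ^ k *
        sphereInt (p * p) := by
  have hpc := continuous_evalP p
  have h1 : |∫ x, g x * evalP p x ∂sphereUniform n| ≤
      ∫ x, √|g x| * (√|g x| * |evalP p x|) ∂sphereUniform n := by
    refine (abs_integral_le_integral_abs).trans_eq ?_
    congr 1 with x
    rw [← mul_assoc, Real.mul_self_sqrt (abs_nonneg _), abs_mul]
  have h2 := sq_integral_mul_le (n := n) (u := fun x => √|g x|)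
    (v := fun x => √|g x| * |evalP p x|) (by fun_prop) (by fun_prop)
  simp only [mul_pow, Real.sq_sqrt (abs_nonneg _), sq_abs] at h2
  have h3 := sq_integral_mul_le (n := n) (u := fun x => |g x|) (v := fun x => evalP p x ^ 2)
    (by fun_prop) (by fun_prop)
  have h4 := integral_solidHarmonic_pow_four_le hn hp
  simp only [sq_abs, ← pow_mul] at h3
  have h5 : ∫ x, |g x| * evalP p x ^ 2 ∂sphereUniform n ≤
      √(∫ x, g x ^ 2 ∂sphereUniform n) * 3 ^ k * sphereInt (p * p) := by
    have hp0 := sphereInt_mul_self_nonneg p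
    refine (abs_le_of_sq_le_sq' ?_ (by positivity)).2
    have hg0 : 0 ≤ ∫ x, g x ^ 2 ∂sphereUniform n := integral_nonneg fun x => sq_nonneg _
    rw [mul_pow, mul_pow, Real.sq_sqrt hg0, sphereInt_mul_self, ← pow_mul, mul_comm k, pow_mul]
    calc _ ≤ _ := h3
      _ ≤ _ := mul_le_mul_of_nonneg_left h4 hg0
      _ = _ := by norm_num; ring
  calc _ = |∫ x, g x * evalP p x ∂sphereUniform n| ^ 2 := (sq_abs _).symm
    _ ≤ _ := pow_le_pow_left₀ (abs_nonneg _) h1 2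
    _ ≤ _ := h2
    _ ≤ _ := mul_le_mul_of_nonneg_left h5 (integral_nonneg fun x => abs_nonneg _)
    _ = _ := by ring

theorem sum_integral_mul_sub_le (hn : 2 ≤ n) {g : (𝔼 n) → ℝ} (hg : Continuous g)
    {H : ℕ → MvPolynomial (Fin n) ℝ} (hH : ∀ k, IsSolidHarmonic k (H k)) (m N : ℕ) :
    ∑ k ∈ Ico 1 N, ((∫ x, g x * evalP (H k) x ∂sphereUniform n) -
      k * n / 4 * sphereInt (H k * H k)) ≤
      ((∫ x, |g x| ∂sphereUniform n) * √(∫ x, g x ^ 2 ∂sphereUniform n) *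
        ∑ k ∈ Ico 1 (m + 1), 3 ^ k + (∫ x, g x ^ 2 ∂sphereUniform n) / (m + 1)) / n := by
  have hn0 : (0 : ℝ) < n := by exact_mod_cast (by omega : 0 < n)
  have hg1 : 0 ≤ ∫ x, |g x| ∂sphereUniform n := integral_nonneg fun x => abs_nonneg _
  have hg2 : 0 ≤ ∫ x, g x ^ 2 ∂sphereUniform n := integral_nonneg fun x => sq_nonneg _
  have hlow : ∑ k ∈ Ico 1 N with k ≤ m, ((∫ x, g x * evalP (H k) x ∂sphereUniform n) -
      k * n / 4 * sphereInt (H k * H k)) ≤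
      (∫ x, |g x| ∂sphereUniform n) * √(∫ x, g x ^ 2 ∂sphereUniform n) *
        (∑ k ∈ Ico 1 (m + 1), 3 ^ k) / n := by
    rw [mul_sum, sum_div]
    refine (sum_le_sum fun k hk => ?_).trans
      (sum_le_sum_of_subset_of_nonneg (fun k hk => ?_) fun _ _ _ => by positivity)
    · have hk1 : (1 : ℝ) ≤ k := by
        have := (mem_Ico.1 (mem_filter.1 hk).1).1
        exact_mod_cast this
      refine (sub_mul_le_div (sphereInt_mul_self_nonneg _) (by positivity) (by positivity)
        (sq_integral_mul_solidHarmonic_le hn hg (hH k))).trans ?_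
      have : 4 * (k * n / 4 : ℝ) = k * n := by ring
      rw [this]
      gcongr
      nlinarith
    · simp only [mem_filter, mem_Ico] at hk ⊢
      omega
  have hhigh : ∑ k ∈ Ico 1 N with ¬ k ≤ m, ((∫ x, g x * evalP (H k) x ∂sphereUniform n) -
      k * n / 4 * sphereInt (H k * H k)) ≤ (∫ x, g x ^ 2 ∂sphereUniform n) / (m + 1) / n := by
    set s := {k ∈ Ico 1 N | ¬ k ≤ m}
    have hcs := sq_integral_mul_le hg (continuous_evalP (∑ k ∈ s, H k))
    rw [← sphereInt_mul_self] at hcs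
    have hb := sub_mul_le_div (c := (m + 1) * n / 4) (sphereInt_mul_self_nonneg _) hg2
      (by positivity) hcs
    have e4 : 4 * (((m : ℝ) + 1) * n / 4) = (m + 1) * n := by ring
    rw [e4, ← div_div, sphereInt_sum_mul_sum hn hH,
      integral_mul_evalP_sum _ hg, mul_sum] at hb
    refine le_trans ?_ hb
    rw [sum_sub_distrib]
    refine sub_le_sub_left (sum_le_sum fun k hk => ?_) _
    refine mul_le_mul_of_nonneg_right ?_ (sphereInt_mul_self_nonneg _)
    have : m + 1 ≤ k := by
      have := (mem_filter.1 hk).2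
      omega
    have : (m + 1 : ℝ) ≤ k := by exact_mod_cast this
    gcongr
  rw [← sum_filter_add_sum_filter_not _ (fun k => k ≤ m), add_div]
  exact add_le_add hlow hhigh

theorem exp_neg_mul_sum_add_le {L : ℝ} (hL : 0 ≤ L) :
    Real.exp (-L) * ∑ k ∈ Ico 1 (⌊L / 3⌋₊ + 1), (3 : ℝ) ^ k + 1 / (⌊L / 3⌋₊ + 1) ≤
      4 * Real.exp 1 / (1 + L) := by
  set m := ⌊L / 3⌋₊
  have hm : (m : ℝ) ≤ L / 3 := Nat.floor_le (by positivity)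
  have hm' : L / 3 < m + 1 := Nat.lt_floor_add_one _
  have hsum : ∑ k ∈ Ico 1 (m + 1), (3 : ℝ) ^ k ≤ 3 / 2 * 3 ^ m := by
    have : ∀ m : ℕ, ∑ k ∈ Ico 1 (m + 1), (3 : ℝ) ^ k = 3 / 2 * 3 ^ m - 3 / 2 := by
      intro m
      induction m with
      | zero => simp
      | succ m ih =>
        rw [sum_Ico_succ_top (by omega), ih, pow_succ]
        ring
    rw [this]
    linarith
  have h3 : (3 : ℝ) ≤ Real.exp (3 / 2) := by
    have := Real.quadratic_le_exp_of_nonneg (x := 3 / 2) (by norm_num)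
    linarith
  have hpow : (3 : ℝ) ^ m ≤ Real.exp (L / 2) :=
    calc (3 : ℝ) ^ m ≤ Real.exp (3 / 2) ^ m := by gcongr
      _ = Real.exp (m * (3 / 2)) := by rw [← Real.exp_nat_mul]
      _ ≤ _ := Real.exp_le_exp.2 (by linarith)
  have hexp : Real.exp (-L) * Real.exp (L / 2) * (1 + L) ≤ 2 := by
    have h1 : Real.exp (-L) * Real.exp (L / 2) = Real.exp (-(L / 2)) := by
      rw [← Real.exp_add]
      ring_nf
    rw [h1, Real.exp_neg, inv_mul_le_iff₀ (Real.exp_pos _)]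
    linarith [Real.add_one_le_exp (L / 2)]
  have hfirst : Real.exp (-L) * ∑ k ∈ Ico 1 (m + 1), (3 : ℝ) ^ k ≤ 3 / (1 + L) := by
    rw [le_div_iff₀ (by positivity)]
    calc _ ≤ Real.exp (-L) * (3 / 2 * Real.exp (L / 2)) * (1 + L) := by
          gcongr
          linarith
      _ ≤ 3 := by linarith
  have hsecond : 1 / ((m : ℝ) + 1) ≤ 4 / (1 + L) := by
    rw [div_le_div_iff₀ (by positivity) (by positivity)]
    linarith [Nat.cast_nonneg (α := ℝ) m]
  calc _ ≤ 3 / (1 + L) + 4 / (1 + L) := add_le_add hfirst hsecond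
    _ = 7 / (1 + L) := by ring
    _ ≤ _ := by
      gcongr
      linarith [Real.exp_one_gt_d9]

theorem sphNorm_one (g : (𝔼 n) → ℝ) : sphNorm n 1 g = ∫ x, |g x| ∂sphereUniform n := by
  simp [sphNorm]

theorem sphNorm_two (g : (𝔼 n) → ℝ) : sphNorm n 2 g = √(∫ x, g x ^ 2 ∂sphereUniform n) := by
  simp [sphNorm, Real.sqrt_eq_rpow]

theorem sum_integral_mul_sub_le_of_log (hn : 2 ≤ n) {g : (𝔼 n) → ℝ} (hg : Continuous g)
    {H : ℕ → MvPolynomial (Fin n) ℝ} (hH : ∀ k, IsSolidHarmonic k (H k)) (N : ℕ) :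
    ∑ k ∈ Ico 1 N, ((∫ x, g x * evalP (H k) x ∂sphereUniform n) -
      k * n / 4 * sphereInt (H k * H k)) ≤
      4 * Real.exp 1 / n * if sphNorm n 1 g = 0 then 0 else
        sphNorm n 2 g ^ 2 / (1 + Real.log (sphNorm n 2 g / sphNorm n 1 g)) := by
  have hg2 : 0 ≤ ∫ x, g x ^ 2 ∂sphereUniform n := integral_nonneg fun x => sq_nonneg _
  have hle : sphNorm n 1 g ≤ sphNorm n 2 g := by
    rw [sphNorm_one, sphNorm_two]
    exact integral_abs_le_sqrt (by omega) hg
  have h1 : 0 ≤ sphNorm n 1 g := by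
    rw [sphNorm_one]
    exact integral_nonneg fun x => abs_nonneg _
  have hsq : ∫ x, g x ^ 2 ∂sphereUniform n = sphNorm n 2 g ^ 2 := by
    rw [sphNorm_two, Real.sq_sqrt hg2]
  have key := fun m => sum_integral_mul_sub_le hn hg hH m N
  simp only [← sphNorm_one, ← sphNorm_two] at key
  simp only [hsq] at key
  split_ifs with h0
  · have hae : ∫ x, g x ^ 2 ∂sphereUniform n = 0 := by
      rw [sphNorm_one, integral_eq_zero_iff_of_nonneg (fun x => abs_nonneg _)
        (integrable_sphereUniform hg.abs)] at h0
      refine integral_eq_zero_of_ae (h0.mono fun x hx => ?_)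
      simpa using hx
    have := key 0
    rw [h0, ← hsq, hae] at this
    simpa using this
  · set a := sphNorm n 1 g
    set b := sphNorm n 2 g
    have ha : 0 < a := lt_of_le_of_ne h1 (Ne.symm h0)
    have hb : 0 < b := ha.trans_le hle
    have hL : 0 ≤ Real.log (b / a) := Real.log_nonneg ((one_le_div ha).2 hle)
    refine (key ⌊Real.log (b / a) / 3⌋₊).trans ?_
    have hab : a = Real.exp (-Real.log (b / a)) * b := by
      rw [Real.exp_neg, Real.exp_log (by positivity)]
      field_simp
    have hnum := mul_le_mul_of_nonneg_left (exp_neg_mul_sum_add_le hL) (sq_nonneg b)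
    rw [div_mul_eq_mul_div]
    refine div_le_div_of_nonneg_right ?_ (by positivity)
    calc _ = b ^ 2 * (Real.exp (-Real.log (b / a)) *
          ∑ k ∈ Ico 1 (⌊Real.log (b / a) / 3⌋₊ + 1), (3 : ℝ) ^ k +
          1 / (⌊Real.log (b / a) / 3⌋₊ + 1)) := by
          nth_rw 1 [hab]
          ring
      _ ≤ _ := hnum
      _ = _ := by ring

theorem two_mul_integral_sub_le (hn : 2 ≤ n) {f : (𝔼 n) → ℝ} (hf : ContDiff ℝ 1 f)
    {k : ℕ} (hk : 1 ≤ k) {p : MvPolynomial (Fin n) ℝ} (hp : IsSolidHarmonic k p) :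
    2 * (∫ x, f x * evalP p x ∂sphereUniform n) - sphereInt (p * p) ≤
      ∑ i, ∑ j, ((∫ x, Dang n i j f x *
          evalP ((k * (k + n - 2) : ℝ)⁻¹ • polyRot i j p) x ∂sphereUniform n) -
        k * n / 4 * sphereInt (((k * (k + n - 2) : ℝ)⁻¹ • polyRot i j p) *
          ((k * (k + n - 2) : ℝ)⁻¹ • polyRot i j p))) := by
  have hn' : (2 : ℝ) ≤ n := by exact_mod_cast hn
  have hk' : (1 : ℝ) ≤ k := by exact_mod_cast hk
  set c : ℝ := k * (k + n - 2)
  have hc : 0 < c := by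
    have : (0 : ℝ) < k + n - 2 := by linarith
    positivity
  have hkc : k * n / 4 ≤ c / 2 := by
    have : (k : ℝ) * n ≤ k * (2 * (k + n - 2)) := by
      gcongr
      linarith
    linarith
  have h1 := sum_integral_Dang_mul_polyRot hp hf
  have h2 := sum_integral_Dang_mul_polyRot hp (contDiff_evalP p)
  simp only [Dang_evalP, ← evalP_mul, ← sphereInt_apply] at h2
  have e1 : ∀ i j, ∫ x, Dang n i j f x * evalP (c⁻¹ • polyRot i j p) x ∂sphereUniform n =
      c⁻¹ * ∫ x, Dang n i j f x * evalP (polyRot i j p) x ∂sphereUniform n := fun i j => by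
    simp only [evalP_smul, mul_left_comm _ c⁻¹]
    exact integral_const_mul _ _
  have e2 : ∀ i j, sphereInt ((c⁻¹ • polyRot i j p) * (c⁻¹ • polyRot i j p)) =
      c⁻¹ ^ 2 * sphereInt (polyRot i j p * polyRot i j p) := fun i j => by
    rw [smul_mul_smul_comm, map_smul, smul_eq_mul, sq]
  simp only [e1, e2, sum_sub_distrib, ← mul_sum, h1, h2]
  have hp0 := sphereInt_mul_self_nonneg p
  have e3 : c⁻¹ * (2 * c * ∫ x, f x * evalP p x ∂sphereUniform n) =
      2 * ∫ x, f x * evalP p x ∂sphereUniform n := by field_simp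
  have e4 : c / 2 * (c⁻¹ ^ 2 * (2 * c * sphereInt (p * p))) = sphereInt (p * p) := by field_simp
  rw [e3]
  nth_rw 1 [← e4]
  gcongr

theorem exists_solidHarmonic_near (hn : 0 < n) {f : (𝔼 n) → ℝ} (hf : Continuous f) {ε : ℝ}
    (hε : 0 < ε) : ∃ (N : ℕ) (Y : ℕ → MvPolynomial (Fin n) ℝ), (∀ k, IsSolidHarmonic k (Y k)) ∧
      ∀ x : Metric.sphere (0 : 𝔼 n) 1, |f x - ∑ k ∈ range N, evalP (Y k) x| ≤ ε := by
  let coord : Fin n → C(Metric.sphere (0 : 𝔼 n) 1, ℝ) := fun i =>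
    ⟨fun x => (x : 𝔼 n) i, by fun_prop⟩
  let A := (aeval coord : MvPolynomial (Fin n) ℝ →ₐ[ℝ] C(Metric.sphere (0 : 𝔼 n) 1, ℝ)).range
  have hA : A.SeparatesPoints := by
    intro x y hxy
    obtain ⟨i, hi⟩ : ∃ i, (x : 𝔼 n) i ≠ (y : 𝔼 n) i := by
      by_contra! h
      exact hxy (Subtype.ext (PiLp.ext h))
    exact ⟨coord i, ⟨coord i, ⟨X i, aeval_X _ _⟩, rfl⟩, hi⟩
  obtain ⟨⟨_, p, rfl⟩, hp⟩ :=
    ContinuousMap.exists_mem_subalgebra_near_continuous_of_separatesPoints A hA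
      (fun x => f x) (hf.comp continuous_subtype_val) ε hε
  obtain ⟨N, Y, hY, hpY⟩ := exists_solidHarmonic_sum hn p
  refine ⟨N, Y, hY, fun x => ?_⟩
  have hx : ‖(x : 𝔼 n)‖ ^ 2 = 1 := by simp
  rw [EuclideanSpace.real_norm_sq_eq] at hx
  have h := hpY (x : 𝔼 n).ofLp (by simpa only [sq] using hx)
  have e : ∀ q : MvPolynomial (Fin n) ℝ, (aeval coord q) x = evalP q x := fun q => by
    induction q using MvPolynomial.induction_on with
    | C a => simp [evalP]
    | add p q hp hq => rw [map_add, ContinuousMap.add_apply, hp, hq, evalP_add]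
    | mul_X p i hp => rw [map_mul, ContinuousMap.mul_apply, hp, aeval_X, evalP_mul, evalP_X]; rfl
  have h' := hp x
  simp only [AlgHom.toRingHom_eq_coe, RingHom.coe_coe, e] at h'
  rw [abs_sub_comm]
  change |_ - f x| < ε at h'
  simp only [evalP] at h' ⊢
  rw [h] at h'
  exact h'.le

theorem sphVar_le_sum (hn : 2 ≤ n) {f : (𝔼 n) → ℝ} (hf : Continuous f) {ε : ℝ} {N : ℕ}
    {Y : ℕ → MvPolynomial (Fin n) ℝ} (hY : ∀ k, IsSolidHarmonic k (Y k))
    (hfY : ∀ x : Metric.sphere (0 : 𝔼 n) 1, |f x - ∑ k ∈ range N, evalP (Y k) x| ≤ ε) :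
    sphVar n f ≤ ε ^ 2 + ∑ k ∈ Ico 1 N,
      (2 * (∫ x, f x * evalP (Y k) x ∂sphereUniform n) - sphereInt (Y k * Y k)) := by
  have hprob := isProbabilityMeasure_sphereUniform (n := n) (by omega)
  obtain ⟨c, hc⟩ : ∃ c : ℝ, ∀ x : 𝔼 n, ∑ k ∈ range N, evalP (Y k) x =
      c + evalP (∑ k ∈ Ico 1 N, Y k) x := by
    rcases Nat.eq_zero_or_pos N with rfl | hN
    · exact ⟨0, fun x => by simp [evalP]⟩
    · have h0 := (hY 0).1
      rw [← totalDegree_zero_iff_isHomogeneous, totalDegree_eq_zero_iff_eq_C] at h0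
      refine ⟨coeff 0 (Y 0), fun x => ?_⟩
      rw [evalP_sum, range_eq_Ico, sum_eq_sum_Ico_succ_bot hN, h0]
      simp [evalP]
  set q := ∑ k ∈ Ico 1 N, Y k
  have hqc := continuous_evalP q
  have hq0 : ∫ x, evalP q x ∂sphereUniform n = 0 := by
    have h1 : IsSolidHarmonic 0 (1 : MvPolynomial (Fin n) ℝ) :=
      ⟨isHomogeneous_one _ _, by simp [polyLaplacian]⟩
    rw [← sphereInt_apply, map_sum]
    refine sum_eq_zero fun k hk => ?_
    have := sphereInt_mul_eq_zero hn (by have := (mem_Ico.1 hk).1; omega) (hY k) h1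
    rwa [mul_one] at this
  have hr : ∫ x, (f x - c - evalP q x) ^ 2 ∂sphereUniform n ≤ ε ^ 2 := by
    have h : ∀ x : Metric.sphere (0 : 𝔼 n) 1, (f x - c - evalP q x) ^ 2 ≤ ε ^ 2 := fun x => by
      have := hfY x
      rw [hc, ← sub_sub] at this
      exact sq_le_sq' (by linarith [(abs_le.1 this).1]) (abs_le.1 this).2
    calc _ ≤ ∫ _, ε ^ 2 ∂sphereUniform n :=
          integral_mono (integrable_sphereUniform (f := fun x => (f x - c - evalP q x) ^ 2)
            (by fun_prop)) (integrable_const _) h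
      _ = ε ^ 2 := by simp
  have hexp : ∫ x, (f x - c - evalP q x) ^ 2 ∂sphereUniform n =
      (∫ x, f x ^ 2 ∂sphereUniform n) + c ^ 2 + sphereInt (q * q)
        - 2 * c * (∫ x, f x ∂sphereUniform n) - 2 * ∫ x, f x * evalP q x ∂sphereUniform n := by
    have e : ∀ x : 𝔼 n, (f x - c - evalP q x) ^ 2 = f x ^ 2 + c ^ 2 + evalP q x ^ 2 -
        2 * c * f x - 2 * (f x * evalP q x) + 2 * c * evalP q x := fun x => by ring
    simp only [e]
    rw [integral_add, integral_sub, integral_sub, integral_add, integral_add, integral_const_mul,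
      integral_const_mul, integral_const_mul, hq0, sphereInt_mul_self]
    rotate_left
    iterate 10 exact Continuous.integrable_of_hasCompactSupport (by fun_prop) (.of_compactSpace _)
    simp
  have hsum : ∑ k ∈ Ico 1 N,
      (2 * (∫ x, f x * evalP (Y k) x ∂sphereUniform n) - sphereInt (Y k * Y k)) =
      2 * (∫ x, f x * evalP q x ∂sphereUniform n) - sphereInt (q * q) := by
    rw [sum_sub_distrib, ← mul_sum, sphereInt_sum_mul_sum hn hY, integral_mul_evalP_sum _ hf]
  rw [hsum, sphVar]
  nlinarith [sq_nonneg ((∫ x, f x ∂sphereUniform n) - c)]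

end Sphere

/-- Talagrand's inequality on the sphere `𝕊^{n-1}`; smooth functions on the sphere are
given as restrictions of smooth functions `F` on `ℝ^n`. -/
theorem stmt8 (n : ℕ) (hn : 2 ≤ n) (F : EuclideanSpace ℝ (Fin n) → ℝ)
    (hF : ContDiff ℝ (⊤ : ℕ∞) F) :
    sphVar n F ≤ (4 * Real.exp 1 / n) * ∑ i : Fin n, ∑ j : Fin n,
      if sphNorm n 1 (Dang n i j F) = 0 then 0 else
        sphNorm n 2 (Dang n i j F) ^ 2 /
          (1 + Real.log (sphNorm n 2 (Dang n i j F) / sphNorm n 1 (Dang n i j F))) := by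
  have hF1 : ContDiff ℝ 1 F := hF.of_le (by exact_mod_cast le_top)
  refine le_of_forall_pos_le_add fun δ hδ => ?_
  obtain ⟨N, Y, hY, hFY⟩ :=
    exists_solidHarmonic_near (by omega) hF.continuous (Real.sqrt_pos.2 hδ)
  have hvar := sphVar_le_sum hn hF.continuous hY hFY
  rw [Real.sq_sqrt hδ.le] at hvar
  refine hvar.trans ?_
  rw [add_comm, Finset.mul_sum]
  gcongr
  refine (Finset.sum_le_sum fun k hk =>
    two_mul_integral_sub_le hn hF1 (Finset.mem_Ico.1 hk).1 (hY k)).trans ?_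
  rw [Finset.sum_comm]
  refine Finset.sum_le_sum fun i _ => ?_
  rw [Finset.sum_comm, Finset.mul_sum]
  exact Finset.sum_le_sum fun j _ => sum_integral_mul_sub_le_of_log hn (continuous_Dang hF1 i j)
    (fun k => ((hY k).polyRot i j).smul _) N
end

section
/- There exists a numerical constant C > 0 such that for every N ≥ 1 and every smooth function f : ℝ^N → ℝ with |f| ≤ 1, Var_{γ_N}(f) ≤ C · Σ_{i=1}^N ‖∂_i f‖₁ (1 + ‖∂_i f‖₁) / [1 + log⁺(1/‖∂_i f‖₁)]^{1/2}. -/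
open MeasureTheory

/-- The standard Gaussian probability measure on `ℝ^N`. -/
noncomputable def gaussN (N : ℕ) : Measure (Fin N → ℝ) :=
  Measure.pi fun _ => ProbabilityTheory.gaussianReal 0 1

/-- `L¹(γ_N)` norm. -/
noncomputable def gaussNorm1 (N : ℕ) (g : (Fin N → ℝ) → ℝ) : ℝ :=
  ∫ x, |g x| ∂gaussN N

/-- Variance with respect to `γ_N`. -/
noncomputable def gaussVar (N : ℕ) (f : (Fin N → ℝ) → ℝ) : ℝ :=
  (∫ x, f x ^ 2 ∂gaussN N) - (∫ x, f x ∂gaussN N) ^ 2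

/-- The `i`-th partial derivative. -/
noncomputable def pderiv (N : ℕ) (i : Fin N) (f : (Fin N → ℝ) → ℝ) (x : Fin N → ℝ) : ℝ :=
  fderiv ℝ f x (Pi.single i 1)

open MeasureTheory ProbabilityTheory Filter Topology Set
open scoped ENNReal NNReal

/-- A coupling `(X, Y)` is hypercontractive if `E[F(X) G(Y)] ≤ ‖F(X)‖_{4/3} ‖G(Y)‖_{4/3}` for all
nonnegative measurable `F` and `G`. -/
def HypercontractiveCoupling {Ω α β : Type*} [MeasurableSpace Ω] [MeasurableSpace α]
    [MeasurableSpace β] (P : Measure Ω) (X : Ω → α) (Y : Ω → β) : Prop :=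
  ∀ F : α → ℝ≥0∞, ∀ G : β → ℝ≥0∞, Measurable F → Measurable G →
    ∫⁻ ω, F (X ω) * G (Y ω) ∂P ≤
      (∫⁻ ω, F (X ω) ^ (4 / 3 : ℝ) ∂P) ^ (3 / 4 : ℝ) *
        (∫⁻ ω, G (Y ω) ^ (4 / 3 : ℝ) ∂P) ^ (3 / 4 : ℝ)

namespace HypercontractiveCoupling

variable {Ω Ω' α α' β β' : Type*} [MeasurableSpace Ω] [MeasurableSpace Ω'] [MeasurableSpace α]
  [MeasurableSpace β] [MeasurableSpace α'] [MeasurableSpace β'] {P : Measure Ω} {P' : Measure Ω'}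
  {X : Ω → α} {Y : Ω → β} {X' : Ω' → α'} {Y' : Ω' → β'}

lemma comp (h : HypercontractiveCoupling P X Y) {φ : α → α'} {ψ : β → β'} (hφ : Measurable φ)
    (hψ : Measurable ψ) : HypercontractiveCoupling P (φ ∘ X) (ψ ∘ Y) :=
  fun _ _ hF hG ↦ h _ _ (hF.comp hφ) (hG.comp hψ)

lemma comp_measurePreserving (h : HypercontractiveCoupling P X Y) {e : Ω' → Ω}
    (he : MeasurePreserving e P' P) (hX : Measurable X) (hY : Measurable Y) :
    HypercontractiveCoupling P' (X ∘ e) (Y ∘ e) := by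
  intro F G hF hG
  have := h F G hF hG
  rw [← he.lintegral_comp (by fun_prop), ← he.lintegral_comp (by fun_prop),
    ← he.lintegral_comp (by fun_prop)] at this
  exact this

lemma map {X : Ω' → α} {Y : Ω' → β} {e : Ω → Ω'} (he : Measurable e) (hX : Measurable X)
    (hY : Measurable Y) (h : HypercontractiveCoupling P (X ∘ e) (Y ∘ e)) :
    HypercontractiveCoupling (P.map e) X Y := by
  intro F G hF hG
  have := h F G hF hG
  rwa [lintegral_map (by fun_prop) he, lintegral_map (by fun_prop) he,
    lintegral_map (by fun_prop) he]

lemma prod [SFinite P] [SFinite P'] (h : HypercontractiveCoupling P X Y)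
    (h' : HypercontractiveCoupling P' X' Y')
    (hX : Measurable X) (hY : Measurable Y) (hX' : Measurable X') (hY' : Measurable Y') :
    HypercontractiveCoupling (P.prod P') (fun ω ↦ (X ω.1, X' ω.2)) (fun ω ↦ (Y ω.1, Y' ω.2)) := by
  intro F G hF hG
  rw [lintegral_prod _ (by fun_prop), lintegral_prod _ (by fun_prop),
    lintegral_prod _ (by fun_prop)]
  have hF₁ : Measurable fun x ↦ (∫⁻ ω', F (x, X' ω') ^ (4 / 3 : ℝ) ∂P') := by
    have : Measurable fun z : α × Ω' ↦ F (z.1, X' z.2) ^ (4 / 3 : ℝ) := by fun_prop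
    exact this.lintegral_prod_right'
  have hG₁ : Measurable fun x ↦ (∫⁻ ω', G (x, Y' ω') ^ (4 / 3 : ℝ) ∂P') := by
    have : Measurable fun z : β × Ω' ↦ G (z.1, Y' z.2) ^ (4 / 3 : ℝ) := by fun_prop
    exact this.lintegral_prod_right'
  calc ∫⁻ ω, ∫⁻ ω', F (X ω, X' ω') * G (Y ω, Y' ω') ∂P' ∂P
      ≤ ∫⁻ ω, (∫⁻ ω', F (X ω, X' ω') ^ (4 / 3 : ℝ) ∂P') ^ (3 / 4 : ℝ) *
          (∫⁻ ω', G (Y ω, Y' ω') ^ (4 / 3 : ℝ) ∂P') ^ (3 / 4 : ℝ) ∂P :=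
        lintegral_mono fun ω ↦
          h' (fun x' ↦ F (X ω, x')) (fun y' ↦ G (Y ω, y')) (by fun_prop) (by fun_prop)
    _ ≤ _ := by
        have := h (fun x ↦ (∫⁻ ω', F (x, X' ω') ^ (4 / 3 : ℝ) ∂P') ^ (3 / 4 : ℝ))
          (fun y ↦ (∫⁻ ω', G (y, Y' ω') ^ (4 / 3 : ℝ) ∂P') ^ (3 / 4 : ℝ))
          (by fun_prop) (by fun_prop)
        simp_rw [← ENNReal.rpow_mul] at this
        norm_num at this
        simpa using this

lemma pi [SigmaFinite P] (h : HypercontractiveCoupling P X Y) (hX : Measurable X)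
    (hY : Measurable Y) (n : ℕ) :
    HypercontractiveCoupling (Measure.pi fun _ : Fin n ↦ P) (fun ω i ↦ X (ω i))
      (fun ω i ↦ Y (ω i)) := by
  induction n with
  | zero =>
    intro F G hF hG
    have hF' (ω : Fin 0 → Ω) : F (fun i ↦ X (ω i)) = F Fin.elim0 := congrArg F (Subsingleton.elim _ _)
    have hG' (ω : Fin 0 → Ω) : G (fun i ↦ Y (ω i)) = G Fin.elim0 := congrArg G (Subsingleton.elim _ _)
    simp [hF', hG', ← ENNReal.rpow_mul]
  | succ n ih =>
    have hp := (h.prod ih hX hY (by fun_prop) (by fun_prop)).comp_measurePreserving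
      (measurePreserving_piFinSuccAbove (fun _ : Fin (n + 1) ↦ P) 0) (by fun_prop) (by fun_prop)
    convert hp.comp (MeasurableEquiv.piFinSuccAbove (fun _ : Fin (n + 1) ↦ α) 0).symm.measurable
      (MeasurableEquiv.piFinSuccAbove (fun _ : Fin (n + 1) ↦ β) 0).symm.measurable using 1
    · ext ω i
      refine Fin.cases ?_ (fun j ↦ ?_) i <;> simp [MeasurableEquiv.piFinSuccAbove, Fin.tail]
    · ext ω i
      refine Fin.cases ?_ (fun j ↦ ?_) i <;> simp [MeasurableEquiv.piFinSuccAbove, Fin.tail]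

end HypercontractiveCoupling

lemma two_point_norm_aux {u v : ℝ} (hu : 0 ≤ u) (hv : 0 ≤ v) :
    (((u ^ 3 + v ^ 3) / 2) ^ 2 + ((u ^ 3 - v ^ 3) / 2) ^ 2 / 3) ^ 2 ≤ ((u ^ 4 + v ^ 4) / 2) ^ 3 := by
  obtain ⟨s, d, rfl, rfl⟩ : ∃ s d : ℝ, u = s + d ∧ v = s - d :=
    ⟨(u + v) / 2, (u - v) / 2, by ring, by ring⟩
  have hds : d ^ 2 ≤ s ^ 2 := by nlinarith
  obtain ⟨a, ha⟩ : ∃ a, a = s ^ 2 := ⟨_, rfl⟩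
  obtain ⟨b, hb⟩ : ∃ b, b = d ^ 2 := ⟨_, rfl⟩
  have hb0 : 0 ≤ b := hb ▸ sq_nonneg d
  rw [← ha, ← hb] at hds
  have ha0 : 0 ≤ a := hb0.trans hds
  have e1 : (((s + d) ^ 4 + (s - d) ^ 4) / 2) ^ 3 = (a ^ 2 + 6 * a * b + b ^ 2) ^ 3 := by
    subst ha hb; ring
  have e2 : ((((s + d) ^ 3 + (s - d) ^ 3) / 2) ^ 2 + (((s + d) ^ 3 - (s - d) ^ 3) / 2) ^ 2 / 3) ^ 2
      = (a ^ 3 + 9 * a ^ 2 * b + 11 * a * b ^ 2 + b ^ 3 / 3) ^ 2 := by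
    subst ha hb; ring
  rw [e1, e2]
  obtain ⟨c, rfl⟩ : ∃ c, a = b + c := ⟨a - b, by ring⟩
  have hc : 0 ≤ c := by linarith
  rw [← sub_nonneg]
  ring_nf
  positivity

/-- Bonami's two-point inequality in the symmetric form `E[f(ε) g(ε')] ≤ ‖f‖_{4/3} ‖g‖_{4/3}`. -/
lemma two_point_inequality {ρ : ℝ} (h0 : 0 ≤ ρ) (h1 : ρ ≤ 1 / 3) {f₁ f₂ g₁ g₂ : ℝ}
    (hf₁ : 0 ≤ f₁) (hf₂ : 0 ≤ f₂) (hg₁ : 0 ≤ g₁) (hg₂ : 0 ≤ g₂) :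
    (1 + ρ) / 4 * (f₁ * g₁ + f₂ * g₂) + (1 - ρ) / 4 * (f₁ * g₂ + f₂ * g₁) ≤
      ((f₁ ^ (4 / 3 : ℝ) + f₂ ^ (4 / 3 : ℝ)) / 2) ^ (3 / 4 : ℝ) *
        ((g₁ ^ (4 / 3 : ℝ) + g₂ ^ (4 / 3 : ℝ)) / 2) ^ (3 / 4 : ℝ) := by
  have key {x y : ℝ} (hx : 0 ≤ x) (hy : 0 ≤ y) :
      ((x + y) / 2) ^ 2 + ((x - y) / 2) ^ 2 / 3 ≤
        (((x ^ (4 / 3 : ℝ) + y ^ (4 / 3 : ℝ)) / 2) ^ (3 / 4 : ℝ)) ^ 2 := by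
    have cube {z : ℝ} (hz : 0 ≤ z) : (z ^ (1 / 3 : ℝ)) ^ 3 = z := by
      rw [← Real.rpow_natCast, ← Real.rpow_mul hz]; norm_num
    have four {z : ℝ} (hz : 0 ≤ z) : (z ^ (1 / 3 : ℝ)) ^ 4 = z ^ (4 / 3 : ℝ) := by
      rw [← Real.rpow_natCast, ← Real.rpow_mul hz]; norm_num
    have := two_point_norm_aux (Real.rpow_nonneg hx (1 / 3)) (Real.rpow_nonneg hy (1 / 3))
    rw [cube hx, cube hy, four hx, four hy] at this
    refine le_of_sq_le_sq ?_ (by positivity)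
    refine this.trans_eq ?_
    have hQ : 0 ≤ (x ^ (4 / 3 : ℝ) + y ^ (4 / 3 : ℝ)) / 2 := by positivity
    rw [← pow_mul, ← Real.rpow_natCast (_ ^ (3 / 4 : ℝ)), ← Real.rpow_mul hQ, ← Real.rpow_natCast]
    norm_num
  have hf := key hf₁ hf₂
  have hg := key hg₁ hg₂
  have hA : 0 ≤ ((f₁ ^ (4 / 3 : ℝ) + f₂ ^ (4 / 3 : ℝ)) / 2) ^ (3 / 4 : ℝ) := by positivity
  have hB : 0 ≤ ((g₁ ^ (4 / 3 : ℝ) + g₂ ^ (4 / 3 : ℝ)) / 2) ^ (3 / 4 : ℝ) := by positivity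
  refine le_of_sq_le_sq ?_ (by positivity)
  rw [mul_pow]
  refine le_trans ?_ (mul_le_mul hf hg (by positivity) (by positivity))
  obtain ⟨a, b, rfl, rfl⟩ : ∃ a b : ℝ, f₁ = a + b ∧ f₂ = a - b :=
    ⟨(f₁ + f₂) / 2, (f₁ - f₂) / 2, by ring, by ring⟩
  obtain ⟨c, d, rfl, rfl⟩ : ∃ c d : ℝ, g₁ = c + d ∧ g₂ = c - d :=
    ⟨(g₁ + g₂) / 2, (g₁ - g₂) / 2, by ring, by ring⟩
  have e : (1 + ρ) / 4 * ((a + b) * (c + d) + (a - b) * (c - d)) +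
      (1 - ρ) / 4 * ((a + b) * (c - d) + (a - b) * (c + d)) = a * c + ρ * (b * d) := by ring
  rw [e]
  have e' : ((a + b + (a - b)) / 2) ^ 2 + ((a + b - (a - b)) / 2) ^ 2 / 3 = a ^ 2 + b ^ 2 / 3 := by
    ring
  have e'' : ((c + d + (c - d)) / 2) ^ 2 + ((c + d - (c - d)) / 2) ^ 2 / 3 = c ^ 2 + d ^ 2 / 3 := by
    ring
  rw [e', e'']
  have s1 : (a * c + ρ * (b * d)) ^ 2 ≤ (a ^ 2 + ρ * b ^ 2) * (c ^ 2 + ρ * d ^ 2) := by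
    nlinarith [mul_nonneg h0 (sq_nonneg (a * d - b * c))]
  refine s1.trans ?_
  gcongr <;> nlinarith [sq_nonneg b, sq_nonneg d]

lemma two_point_inequality_ennreal {ρ : ℝ} (h0 : 0 ≤ ρ) (h1 : ρ ≤ 1 / 3) (f₁ f₂ g₁ g₂ : ℝ≥0∞) :
    ENNReal.ofReal ((1 + ρ) / 4) * (f₁ * g₁ + f₂ * g₂) +
        ENNReal.ofReal ((1 - ρ) / 4) * (f₁ * g₂ + f₂ * g₁) ≤
      ((f₁ ^ (4 / 3 : ℝ) + f₂ ^ (4 / 3 : ℝ)) / 2) ^ (3 / 4 : ℝ) *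
        ((g₁ ^ (4 / 3 : ℝ) + g₂ ^ (4 / 3 : ℝ)) / 2) ^ (3 / 4 : ℝ) := by
  have top {x y : ℝ≥0∞} (h : x = ⊤ ∨ y = ⊤) :
      ((x ^ (4 / 3 : ℝ) + y ^ (4 / 3 : ℝ)) / 2) ^ (3 / 4 : ℝ) = ⊤ := by
    have : x ^ (4 / 3 : ℝ) + y ^ (4 / 3 : ℝ) = ⊤ := by
      rcases h with rfl | rfl <;> simp
    rw [this, ENNReal.top_div_of_ne_top (by simp), ENNReal.top_rpow_of_pos (by norm_num)]
  have ne_zero {x y : ℝ≥0∞} (h : ¬(x = 0 ∧ y = 0)) :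
      ((x ^ (4 / 3 : ℝ) + y ^ (4 / 3 : ℝ)) / 2) ^ (3 / 4 : ℝ) ≠ 0 := by
    intro h'
    apply h
    rw [ENNReal.rpow_eq_zero_iff_of_pos (by norm_num), ENNReal.div_eq_zero_iff] at h'
    rcases h' with h' | h'
    · rw [add_eq_zero, ENNReal.rpow_eq_zero_iff_of_pos (by norm_num),
        ENNReal.rpow_eq_zero_iff_of_pos (by norm_num)] at h'
      exact h'
    · simp at h'
  by_cases hg0 : g₁ = 0 ∧ g₂ = 0
  · simp [hg0.1, hg0.2]
  by_cases hf0 : f₁ = 0 ∧ f₂ = 0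
  · simp [hf0.1, hf0.2]
  by_cases hf : f₁ = ⊤ ∨ f₂ = ⊤
  · rw [top hf, ENNReal.top_mul (ne_zero hg0)]
    exact le_top
  by_cases hg : g₁ = ⊤ ∨ g₂ = ⊤
  · rw [top hg, ENNReal.mul_top (ne_zero hf0)]
    exact le_top
  push Not at hf hg
  obtain ⟨hf₁, hf₂⟩ := hf
  obtain ⟨hg₁, hg₂⟩ := hg
  have := ENNReal.ofReal_le_ofReal (two_point_inequality h0 h1 (f₁ := f₁.toReal)
    (f₂ := f₂.toReal) (g₁ := g₁.toReal) (g₂ := g₂.toReal) (by positivity) (by positivity)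
    (by positivity) (by positivity))
  rw [ENNReal.ofReal_add (by positivity) (mul_nonneg (by linarith) (by positivity)),
    ENNReal.ofReal_mul (by positivity), ENNReal.ofReal_mul (by linarith),
    ENNReal.ofReal_add (by positivity) (by positivity),
    ENNReal.ofReal_add (by positivity) (by positivity),
    ENNReal.ofReal_mul (by positivity), ENNReal.ofReal_mul (by positivity),
    ENNReal.ofReal_mul (by positivity), ENNReal.ofReal_mul (by positivity),
    ENNReal.ofReal_mul (by positivity)] at this
  have e {x y : ℝ≥0∞} (hx : x ≠ ⊤) (hy : y ≠ ⊤) :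
      ENNReal.ofReal (((x.toReal ^ (4 / 3 : ℝ) + y.toReal ^ (4 / 3 : ℝ)) / 2) ^ (3 / 4 : ℝ)) =
        ((x ^ (4 / 3 : ℝ) + y ^ (4 / 3 : ℝ)) / 2) ^ (3 / 4 : ℝ) := by
    rw [← ENNReal.ofReal_rpow_of_nonneg (by positivity) (by norm_num),
      ENNReal.ofReal_div_of_pos (by norm_num), ENNReal.ofReal_add (by positivity) (by positivity),
      ← ENNReal.ofReal_rpow_of_nonneg (by positivity) (by norm_num),
      ← ENNReal.ofReal_rpow_of_nonneg (by positivity) (by norm_num),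
      ENNReal.ofReal_toReal hx, ENNReal.ofReal_toReal hy]
    simp
  rw [e hf₁ hf₂, e hg₁ hg₂] at this
  simpa [ENNReal.ofReal_toReal, hf₁, hf₂, hg₁, hg₂] using this

open Complex in
/-- The law of `ε + i ε'` for two `ρ`-correlated Rademacher variables `ε, ε'`. -/
noncomputable def rademacherCoupling (ρ : ℝ) : Measure ℂ :=
  ENNReal.ofReal ((1 + ρ) / 4) • (Measure.dirac (1 + I) + Measure.dirac (-1 - I)) +
    ENNReal.ofReal ((1 - ρ) / 4) • (Measure.dirac (1 - I) + Measure.dirac (-1 + I))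

lemma ofReal_add_ofReal_eq_half {ρ : ℝ} (h0 : 0 ≤ ρ) (h1 : ρ ≤ 1) :
    ENNReal.ofReal ((1 + ρ) / 4) + ENNReal.ofReal ((1 - ρ) / 4) = 2⁻¹ := by
  rw [← ENNReal.ofReal_add (by linarith) (by linarith)]
  have : (1 + ρ) / 4 + (1 - ρ) / 4 = 2⁻¹ := by ring
  rw [this, ENNReal.ofReal_inv_of_pos (by norm_num)]
  simp

lemma isProbabilityMeasure_rademacherCoupling {ρ : ℝ} (h0 : 0 ≤ ρ) (h1 : ρ ≤ 1) :
    IsProbabilityMeasure (rademacherCoupling ρ) := by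
  constructor
  simp only [rademacherCoupling, Measure.coe_add, Measure.coe_smul, Pi.add_apply, Pi.smul_apply,
    measure_univ, smul_eq_mul]
  rw [← add_mul, ofReal_add_ofReal_eq_half h0 h1, one_add_one_eq_two]
  exact ENNReal.inv_mul_cancel (by simp) (by simp)

lemma hypercontractiveCoupling_rademacher {ρ : ℝ} (h0 : 0 ≤ ρ) (h1 : ρ ≤ 1 / 3) :
    HypercontractiveCoupling (rademacherCoupling ρ) Complex.re Complex.im := by
  intro F G hF hG
  have e (x y : ℝ≥0∞) : ENNReal.ofReal ((1 + ρ) / 4) * (x + y) +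
      ENNReal.ofReal ((1 - ρ) / 4) * (x + y) = (x + y) / 2 := by
    rw [← add_mul, ofReal_add_ofReal_eq_half h0 (by linarith), ENNReal.div_eq_inv_mul]
  have := two_point_inequality_ennreal h0 h1 (F 1) (F (-1)) (G 1) (G (-1))
  simp only [rademacherCoupling, lintegral_add_measure, lintegral_smul_measure, lintegral_dirac,
    smul_eq_mul]
  simp only [Complex.add_re, Complex.sub_re, Complex.add_im, Complex.sub_im, Complex.one_re,
    Complex.one_im, Complex.neg_re, Complex.neg_im, Complex.I_re, Complex.I_im, add_zero, sub_zero,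
    zero_add, zero_sub, neg_zero]
  rw [e, add_comm (G (-1) ^ (4 / 3 : ℝ)) (G 1 ^ (4 / 3 : ℝ)), e]
  exact this

open Complex in
lemma charFun_rademacherCoupling {ρ : ℝ} (h0 : 0 ≤ ρ) (h1 : ρ ≤ 1) (t : ℂ) :
    charFun (rademacherCoupling ρ) t =
      ((1 + ρ) / 2 * Real.cos (t.re + t.im) + (1 - ρ) / 2 * Real.cos (t.re - t.im) : ℝ) := by
  rw [charFun_apply]
  simp only [rademacherCoupling]
  rw [integral_add_measure, integral_smul_measure, integral_smul_measure, integral_add_measure,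
    integral_add_measure]
  · simp only [integral_dirac, Complex.inner]
    rw [ENNReal.toReal_ofReal (by linarith), ENNReal.toReal_ofReal (by linarith)]
    simp only [map_add, map_sub, map_one, map_neg, conj_I]
    push_cast
    simp only [Complex.cos, Complex.real_smul]
    push_cast
    simp
    ring_nf
  all_goals
    first
    | exact integrable_dirac (by simp)
    | exact ((integrable_dirac (by simp)).add_measure (integrable_dirac (by simp))).smul_measure
        (by simp)

/-- The law of the normalized sum of `n` independent correlated Rademacher pairs. -/
noncomputable def rademacherSum (ρ : ℝ) (n : ℕ) : Measure ℂ :=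
  (Measure.pi fun _ : Fin n ↦ rademacherCoupling ρ).map fun ω ↦ (√n)⁻¹ • ∑ j, ω j

lemma hypercontractiveCoupling_rademacherSum {ρ : ℝ} (h0 : 0 ≤ ρ) (h1 : ρ ≤ 1 / 3) (n : ℕ) :
    HypercontractiveCoupling (rademacherSum ρ n) Complex.re Complex.im := by
  have := isProbabilityMeasure_rademacherCoupling h0 (h1.trans (by norm_num))
  refine .map (by fun_prop) (by fun_prop) (by fun_prop) ?_
  have h := ((hypercontractiveCoupling_rademacher h0 h1).pi (by fun_prop) (by fun_prop) n).comp
    (φ := fun x : Fin n → ℝ ↦ (√n)⁻¹ * ∑ j, x j) (ψ := fun x : Fin n → ℝ ↦ (√n)⁻¹ * ∑ j, x j)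
    (by fun_prop) (by fun_prop)
  convert h using 1 <;> ext <;>
    simp only [Function.comp_apply, Complex.smul_re, Complex.smul_im, Complex.re_sum,
      Complex.im_sum, smul_eq_mul]

lemma charFun_rademacherSum {ρ : ℝ} (h0 : 0 ≤ ρ) (h1 : ρ ≤ 1) (n : ℕ) (t : ℂ) :
    charFun (rademacherSum ρ n) t = charFun (rademacherCoupling ρ) ((√n)⁻¹ • t) ^ n := by
  have := isProbabilityMeasure_rademacherCoupling h0 h1
  rw [rademacherSum, charFun_apply, integral_map (by fun_prop) (by fun_prop), charFun_apply]
  have : ∀ ω : Fin n → ℂ, Complex.exp (inner ℝ ((√n)⁻¹ • ∑ j, ω j) t * Complex.I) =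
      ∏ j, Complex.exp (inner ℝ (ω j) ((√n)⁻¹ • t) * Complex.I) := by
    intro ω
    rw [← Complex.exp_sum, ← Finset.sum_mul, real_inner_smul_left, sum_inner, Finset.mul_sum]
    simp only [real_inner_smul_right, Complex.ofReal_sum]
  simp_rw [this]
  rw [integral_fintype_prod_eq_prod (fun _ z ↦ Complex.exp (inner ℝ z ((√n)⁻¹ • t) * Complex.I))]
  simp

/-- The law of `X + i Y` for two `ρ`-correlated standard Gaussian variables `X, Y`. -/
noncomputable def gaussianCoupling (ρ : ℝ) : Measure ℂ :=
  ((gaussianReal 0 1).prod (gaussianReal 0 1)).map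
    fun p ↦ ⟨p.1, ρ * p.1 + √(1 - ρ ^ 2) * p.2⟩

lemma measurable_complex_mk {α : Type*} [MeasurableSpace α] {f g : α → ℝ} (hf : Measurable f)
    (hg : Measurable g) : Measurable fun x ↦ (⟨f x, g x⟩ : ℂ) :=
  Complex.measurableEquivRealProd.symm.measurable.comp (hf.prodMk hg)

lemma charFun_gaussianCoupling {ρ : ℝ} (h : ρ ^ 2 ≤ 1) (t : ℂ) :
    charFun (gaussianCoupling ρ) t =
      Complex.exp (-(t.re ^ 2 + 2 * ρ * t.re * t.im + t.im ^ 2) / 2 : ℝ) := by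
  rw [gaussianCoupling, charFun_apply,
    integral_map (measurable_complex_mk (by fun_prop) (by fun_prop)).aemeasurable (by fun_prop)]
  have : ∀ p : ℝ × ℝ, Complex.exp (inner ℝ (⟨p.1, ρ * p.1 + √(1 - ρ ^ 2) * p.2⟩ : ℂ) t *
      Complex.I) = Complex.exp (p.1 * (t.re + ρ * t.im : ℝ) * Complex.I) *
        Complex.exp (p.2 * (√(1 - ρ ^ 2) * t.im : ℝ) * Complex.I) := by
    intro p
    rw [← Complex.exp_add, Complex.inner]
    congr 1
    simp only [Complex.mul_re, Complex.conj_re, Complex.conj_im]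
    push_cast
    ring
  simp_rw [this]
  rw [integral_prod_mul (fun x : ℝ ↦ Complex.exp (x * (t.re + ρ * t.im : ℝ) * Complex.I))
    (fun x : ℝ ↦ Complex.exp (x * (√(1 - ρ ^ 2) * t.im : ℝ) * Complex.I))]
  have hc (s : ℝ) := charFun_gaussianReal (μ := 0) (v := 1) s
  simp only [charFun_apply_real] at hc
  simp_rw [mul_comm (Complex.ofReal _) (Complex.ofReal (_ + _)),
    mul_comm (Complex.ofReal _) (Complex.ofReal (_ * _)), hc, ← Complex.exp_add]
  congr 1
  have hs : (√(1 - ρ ^ 2)) ^ 2 = 1 - ρ ^ 2 := Real.sq_sqrt (by linarith)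
  have hs' : ((√(1 - ρ ^ 2) : ℝ) : ℂ) ^ 2 = 1 - (ρ : ℂ) ^ 2 := by exact_mod_cast hs
  push_cast
  rw [mul_pow, hs']
  ring

lemma tendsto_cos_div_sqrt (a : ℝ) :
    Tendsto (fun n : ℕ ↦ (n : ℝ) * (Real.cos ((√n)⁻¹ * a) - 1)) atTop (𝓝 (-a ^ 2 / 2)) := by
  have hy : Tendsto (fun n : ℕ ↦ (√n)⁻¹ * a / 2) atTop (𝓝 0) := by
    have : Tendsto (fun n : ℕ ↦ (√n)⁻¹) atTop (𝓝 0) :=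
      tendsto_inv_atTop_zero.comp (Real.tendsto_sqrt_atTop.comp tendsto_natCast_atTop_atTop)
    simpa using (this.mul_const a).div_const 2
  have hs : Tendsto (fun n : ℕ ↦ -a ^ 2 / 2 * Real.sinc ((√n)⁻¹ * a / 2) ^ 2) atTop
      (𝓝 (-a ^ 2 / 2)) := by
    have := ((Real.continuous_sinc.tendsto 0).comp hy).pow 2
    simpa using this.const_mul (-a ^ 2 / 2)
  refine hs.congr' ?_
  filter_upwards [eventually_gt_atTop 0] with n hn
  obtain ⟨y, hy⟩ : ∃ y, y = (√n)⁻¹ * a / 2 := ⟨_, rfl⟩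
  have hn' : (0 : ℝ) < n := by exact_mod_cast hn
  have ha : a = √n * (2 * y) := by
    rw [hy]; field_simp
  have hsin : Real.sin y = y * Real.sinc y := by
    rcases eq_or_ne y 0 with rfl | h
    · simp
    · rw [Real.sinc_of_ne_zero h]; field_simp
  have hx : (√n)⁻¹ * a = 2 * y := by rw [hy]; ring
  rw [← hy, hx, Real.cos_two_mul, Real.cos_sq', hsin]
  nth_rewrite 1 [ha]
  rw [mul_pow, Real.sq_sqrt hn'.le]
  ring

lemma tendsto_charFun_rademacherSum {ρ : ℝ} (h0 : 0 ≤ ρ) (h1 : ρ ≤ 1) (t : ℂ) :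
    Tendsto (fun n ↦ charFun (rademacherSum ρ n) t) atTop (𝓝 (charFun (gaussianCoupling ρ) t)) := by
  rw [charFun_gaussianCoupling (by nlinarith)]
  simp_rw [charFun_rademacherSum h0 h1, charFun_rademacherCoupling h0 h1]
  norm_cast
  have := Real.tendsto_one_add_pow_exp_of_tendsto
    (g := fun n : ℕ ↦ (1 + ρ) / 2 * (Real.cos ((√n)⁻¹ * (t.re + t.im)) - 1) +
      (1 - ρ) / 2 * (Real.cos ((√n)⁻¹ * (t.re - t.im)) - 1))
    (t := -(t.re ^ 2 + 2 * ρ * t.re * t.im + t.im ^ 2) / 2) ?_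
  · convert (Complex.continuous_ofReal.tendsto _).comp this using 2 with n
    simp only [Function.comp_apply, Complex.ofReal_inj, Complex.real_smul, Complex.mul_re,
      Complex.mul_im, Complex.ofReal_re, Complex.ofReal_im]
    ring_nf
  · convert ((tendsto_cos_div_sqrt (t.re + t.im)).const_mul ((1 + ρ) / 2)).add
      ((tendsto_cos_div_sqrt (t.re - t.im)).const_mul ((1 - ρ) / 2)) using 2 <;> ring

lemma isProbabilityMeasure_rademacherSum {ρ : ℝ} (h0 : 0 ≤ ρ) (h1 : ρ ≤ 1) (n : ℕ) :
    IsProbabilityMeasure (rademacherSum ρ n) := by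
  have := isProbabilityMeasure_rademacherCoupling h0 h1
  exact Measure.isProbabilityMeasure_map (by fun_prop)

instance (ρ : ℝ) : IsProbabilityMeasure (gaussianCoupling ρ) :=
  Measure.isProbabilityMeasure_map
    (measurable_complex_mk (by fun_prop) (by fun_prop)).aemeasurable

/-- Hypercontractivity for `N` independent pairs of `ρ`-correlated Gaussian variables. -/
lemma lintegral_pi_gaussianCoupling_le {ρ : ℝ} (h0 : 0 ≤ ρ) (h1 : ρ ≤ 1 / 3) (N : ℕ)
    (F : BoundedContinuousFunction (Fin N → ℝ) ℝ≥0) :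
    ∫⁻ z : Fin N → ℂ, F (fun i ↦ (z i).re) * F (fun i ↦ (z i).im)
        ∂(Measure.pi fun _ ↦ gaussianCoupling ρ) ≤
      (∫⁻ z : Fin N → ℂ, (F (fun i ↦ (z i).re) : ℝ≥0∞) ^ (4 / 3 : ℝ)
        ∂(Measure.pi fun _ ↦ gaussianCoupling ρ)) ^ (3 / 4 : ℝ) *
      (∫⁻ z : Fin N → ℂ, (F (fun i ↦ (z i).im) : ℝ≥0∞) ^ (4 / 3 : ℝ)
        ∂(Measure.pi fun _ ↦ gaussianCoupling ρ)) ^ (3 / 4 : ℝ) := by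
  have h1' : ρ ≤ 1 := h1.trans (by norm_num)
  have inst (n : ℕ) := isProbabilityMeasure_rademacherSum h0 h1' n
  let κ (n : ℕ) : ProbabilityMeasure ℂ := ⟨rademacherSum ρ n, inst n⟩
  let Γ : ProbabilityMeasure ℂ := ⟨gaussianCoupling ρ, inferInstance⟩
  have hκ : Tendsto κ atTop (𝓝 Γ) :=
    ProbabilityMeasure.tendsto_of_tendsto_charFun fun t ↦ tendsto_charFun_rademacherSum h0 h1' t
  have hpi : Tendsto (fun n ↦ ProbabilityMeasure.pi fun _ : Fin N ↦ κ n) atTop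
      (𝓝 (ProbabilityMeasure.pi fun _ : Fin N ↦ Γ)) :=
    (ProbabilityMeasure.continuous_pi.tendsto _).comp (tendsto_pi_nhds.2 fun _ ↦ hκ)
  rw [ProbabilityMeasure.tendsto_iff_forall_lintegral_tendsto] at hpi
  obtain ⟨C, hC⟩ := F.isBounded_range.bddAbove
  have hFC (x) : F x ≤ C := hC ⟨x, rfl⟩
  let re : C(Fin N → ℂ, Fin N → ℝ) := ⟨fun z i ↦ (z i).re, by fun_prop⟩
  let im : C(Fin N → ℂ, Fin N → ℝ) := ⟨fun z i ↦ (z i).im, by fun_prop⟩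
  let F₁ := F.compContinuous re
  let F₂ := F.compContinuous im
  let P : BoundedContinuousFunction (Fin N → ℝ) ℝ≥0 :=
    BoundedContinuousFunction.mkOfBound ⟨fun x ↦ F x ^ (4 / 3 : ℝ),
      (NNReal.continuous_rpow_const (by norm_num)).comp F.continuous⟩ (C ^ (4 / 3 : ℝ)) (by
      intro x y
      have hx : (F x : ℝ≥0) ^ (4 / 3 : ℝ) ≤ C ^ (4 / 3 : ℝ) := by gcongr; exact hFC x
      have hy : (F y : ℝ≥0) ^ (4 / 3 : ℝ) ≤ C ^ (4 / 3 : ℝ) := by gcongr; exact hFC y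
      simp only [ContinuousMap.coe_mk, NNReal.dist_eq]
      rw [← NNReal.coe_le_coe] at hx hy
      push_cast at hx hy ⊢
      have hx0 : (0 : ℝ) ≤ (F x : ℝ) ^ (4 / 3 : ℝ) := by positivity
      have hy0 : (0 : ℝ) ≤ (F y : ℝ) ^ (4 / 3 : ℝ) := by positivity
      rw [abs_le]
      constructor <;> linarith)
  have hP (x) : ((P x : ℝ≥0) : ℝ≥0∞) = (F x : ℝ≥0∞) ^ (4 / 3 : ℝ) := by
    exact ENNReal.coe_rpow_of_nonneg _ (by norm_num)
  have l₁ := hpi (F₁ * F₂)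
  have l₂ := hpi (P.compContinuous re)
  have l₃ := hpi (P.compContinuous im)
  have l₂' := (ENNReal.continuous_rpow_const (y := 3 / 4)).tendsto _ |>.comp l₂
  have l₃' := (ENNReal.continuous_rpow_const (y := 3 / 4)).tendsto _ |>.comp l₃
  have hfin (G : BoundedContinuousFunction (Fin N → ℂ) ℝ≥0) (ν : Measure (Fin N → ℂ))
      [IsProbabilityMeasure ν] : (∫⁻ z, G z ∂ν) ^ (3 / 4 : ℝ) ≠ ⊤ :=
    ENNReal.rpow_ne_top_of_nonneg (by norm_num) (G.lintegral_lt_top_of_nnreal ν).ne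
  have := le_of_tendsto_of_tendsto' l₁
    (ENNReal.Tendsto.mul l₂' (Or.inr (hfin _ _)) l₃' (Or.inr (hfin _ _))) ?_
  · simp only [hP, F₁, F₂, re, im, Γ, BoundedContinuousFunction.coe_mul, Pi.mul_apply,
      ENNReal.coe_mul, BoundedContinuousFunction.compContinuous_apply, ContinuousMap.coe_mk] at this
    exact this
  · intro n
    have := ((hypercontractiveCoupling_rademacherSum h0 h1 n).pi (by fun_prop) (by fun_prop) N)
      (fun x ↦ F x) (fun x ↦ F x) (by fun_prop) (by fun_prop)
    simp only [Function.comp_apply, hP, F₁, F₂, re, im, BoundedContinuousFunction.coe_mul,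
      Pi.mul_apply, ENNReal.coe_mul, BoundedContinuousFunction.compContinuous_apply,
      ContinuousMap.coe_mk]
    exact this

instance (N : ℕ) : IsProbabilityMeasure (gaussN N) := by
  unfold gaussN; infer_instance

/-- The standard Gaussian measure on pairs is invariant under planar reflections. -/
lemma measurePreserving_gaussianReal_reflection {c s : ℝ} (h : c ^ 2 + s ^ 2 = 1) :
    MeasurePreserving (fun p : ℝ × ℝ ↦ (c * p.1 + s * p.2, s * p.1 - c * p.2))
      ((gaussianReal 0 1).prod (gaussianReal 0 1)) ((gaussianReal 0 1).prod (gaussianReal 0 1)) := by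
  obtain ⟨θ, rfl, rfl⟩ : ∃ θ, c = Real.cos θ ∧ s = Real.sin θ := by
    have hn : ‖(⟨c, s⟩ : ℂ)‖ = 1 := by
      rw [Complex.norm_def, Complex.normSq_mk, ← sq, ← sq, h, Real.sqrt_one]
    refine ⟨(⟨c, s⟩ : ℂ).arg, ?_, ?_⟩
    · rw [Complex.cos_arg (by rw [← norm_ne_zero_iff, hn]; norm_num), hn, div_one]
    · rw [Complex.sin_arg, hn, div_one]
  have rot : MeasurePreserving (ContinuousLinearMap.rotation θ : ℝ × ℝ →L[ℝ] ℝ × ℝ)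
      ((gaussianReal 0 1).prod (gaussianReal 0 1)) ((gaussianReal 0 1).prod (gaussianReal 0 1)) :=
    ⟨by fun_prop, IsGaussian.map_rotation_eq_self (by simp [integral_id_gaussianReal]) θ⟩
  have neg : MeasurePreserving (fun x : ℝ ↦ -x) (gaussianReal 0 1) (gaussianReal 0 1) :=
    ⟨by fun_prop, by simp [gaussianReal_map_neg]⟩
  have := ((MeasurePreserving.id (gaussianReal 0 1)).prod neg).comp rot
  convert this using 1
  ext p
  · simp [ContinuousLinearMap.rotation_apply]
  · simp [ContinuousLinearMap.rotation_apply]; ring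

lemma measurePreserving_gaussN_reflection (N : ℕ) {c s : ℝ} (h : c ^ 2 + s ^ 2 = 1) :
    MeasurePreserving (fun p : (Fin N → ℝ) × (Fin N → ℝ) ↦ (c • p.1 + s • p.2, s • p.1 - c • p.2))
      ((gaussN N).prod (gaussN N)) ((gaussN N).prod (gaussN N)) := by
  have e := measurePreserving_arrowProdEquivProdArrow ℝ ℝ (Fin N) (fun _ ↦ gaussianReal 0 1)
    (fun _ ↦ gaussianReal 0 1)
  exact (e.comp (measurePreserving_pi _ _
    fun _ : Fin N ↦ measurePreserving_gaussianReal_reflection h)).comp e.symm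

/-- The law of a correlated Gaussian pair in `ℝ^N` is a product of planar couplings. -/
lemma measurePreserving_gaussianCoupling (N : ℕ) (ρ : ℝ) :
    MeasurePreserving (fun (p : (Fin N → ℝ) × (Fin N → ℝ)) (i : Fin N) ↦
        (⟨p.1 i, ρ * p.1 i + √(1 - ρ ^ 2) * p.2 i⟩ : ℂ))
      ((gaussN N).prod (gaussN N)) (Measure.pi fun _ ↦ gaussianCoupling ρ) := by
  have e := measurePreserving_arrowProdEquivProdArrow ℝ ℝ (Fin N) (fun _ ↦ gaussianReal 0 1)
    (fun _ ↦ gaussianReal 0 1)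
  have m : MeasurePreserving (fun p : ℝ × ℝ ↦ (⟨p.1, ρ * p.1 + √(1 - ρ ^ 2) * p.2⟩ : ℂ))
      ((gaussianReal 0 1).prod (gaussianReal 0 1)) (gaussianCoupling ρ) :=
    ⟨measurable_complex_mk (by fun_prop) (by fun_prop), rfl⟩
  exact (measurePreserving_pi _ _ fun _ : Fin N ↦ m).comp e.symm

lemma integrable_id_gaussianReal_one : Integrable (fun x : ℝ ↦ x) (gaussianReal 0 1) :=
  (memLp_id_gaussianReal 1).integrable (by simp)

lemma integrable_gaussianReal_iff {f : ℝ → ℝ} :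
    Integrable f (gaussianReal 0 1) ↔ Integrable (fun x ↦ gaussianPDFReal 0 1 x * f x) := by
  rw [gaussianReal_of_var_ne_zero _ one_ne_zero, gaussianPDF_def,
    integrable_withDensity_iff_integrable_smul' (by fun_prop) (by simp)]
  simp [ENNReal.toReal_ofReal, gaussianPDFReal_nonneg]

lemma hasDerivAt_gaussianPDFReal (x : ℝ) :
    HasDerivAt (gaussianPDFReal 0 1) (-(x * gaussianPDFReal 0 1 x)) x := by
  have h : HasDerivAt (fun x : ℝ ↦ -(x - 0) ^ 2 / (2 * (1 : ℝ≥0))) (-x) x := by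
    refine ((((hasDerivAt_id x).sub_const 0).pow 2).neg.div_const
      (2 * ((1 : ℝ≥0) : ℝ))).congr_deriv ?_
    simp
    ring
  rw [gaussianPDFReal_def]
  exact (h.exp.const_mul (√(2 * Real.pi * (1 : ℝ≥0)))⁻¹).congr_deriv (by ring)

/-- One-dimensional Gaussian integration by parts (Stein's identity). -/
lemma integral_mul_gaussianReal {φ φ' : ℝ → ℝ} {M : ℝ} (hφ : ∀ x, HasDerivAt φ (φ' x) x)
    (hM : ∀ x, |φ x| ≤ M) (hφ' : Integrable φ' (gaussianReal 0 1)) :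
    ∫ x, x * φ x ∂gaussianReal 0 1 = ∫ x, φ' x ∂gaussianReal 0 1 := by
  have hc : Continuous φ := continuous_iff_continuousAt.2 fun x ↦ (hφ x).continuousAt
  have i1 : Integrable (fun x ↦ gaussianPDFReal 0 1 x * φ x) :=
    integrable_gaussianReal_iff.1 (.of_bound (by fun_prop) M (ae_of_all _ hM))
  have i2 : Integrable (fun x ↦ gaussianPDFReal 0 1 x * (x * φ x)) :=
    integrable_gaussianReal_iff.1
      (integrable_id_gaussianReal_one.mul_bdd (by fun_prop) (ae_of_all _ hM))
  have i3 := integrable_gaussianReal_iff.1 hφ'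
  have d (x : ℝ) : HasDerivAt (fun x ↦ gaussianPDFReal 0 1 x * φ x)
      (gaussianPDFReal 0 1 x * φ' x - gaussianPDFReal 0 1 x * (x * φ x)) x := by
    exact ((hasDerivAt_gaussianPDFReal x).mul (hφ x)).congr_deriv (by ring)
  have := integral_eq_zero_of_hasDerivAt_of_integrable d (i3.sub i2) i1
  rw [integral_sub i3 i2, sub_eq_zero] at this
  simp_rw [integral_gaussianReal_eq_integral_smul one_ne_zero, smul_eq_mul]
  exact this.symm

lemma integrable_eval_gaussN (N : ℕ) (i : Fin N) : Integrable (fun v ↦ v i) (gaussN N) :=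
  (measurePreserving_eval (fun _ : Fin N ↦ gaussianReal 0 1) i).integrable_comp_of_integrable
    integrable_id_gaussianReal_one

lemma integral_abs_eval_gaussN_le (N : ℕ) (i : Fin N) : ∫ v, |v i| ∂gaussN N ≤ 1 := by
  have h := (measurePreserving_eval (fun _ : Fin N ↦ gaussianReal 0 1) i)
  have e : ∫ v, |v i| ∂gaussN N = ∫ x, |x| ∂gaussianReal 0 1 := by
    rw [← h.map_eq, integral_map h.measurable.aemeasurable (by fun_prop)]
    rfl
  have i2 : Integrable (fun x : ℝ ↦ x ^ 2) (gaussianReal 0 1) :=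
    (memLp_id_gaussianReal 2).integrable_sq
  have v : ∫ x, x ^ 2 ∂gaussianReal 0 1 = 1 := by
    have := variance_fun_id_gaussianReal (μ := 0) (v := 1)
    rw [variance_of_integral_eq_zero (by fun_prop) integral_id_gaussianReal] at this
    simpa using this
  rw [e]
  calc ∫ x, |x| ∂gaussianReal 0 1 ≤ ∫ x, (1 / 2 + x ^ 2 * (1 / 2)) ∂gaussianReal 0 1 := by
        refine integral_mono integrable_id_gaussianReal_one.abs
          ((integrable_const _).add (i2.mul_const _)) fun x ↦ ?_
        have := sq_nonneg (|x| - 1)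
        have := sq_abs x
        simp only
        nlinarith
    _ = 1 := by
        rw [integral_add (integrable_const _) (i2.mul_const _), integral_mul_const, v]
        simp; norm_num

/-- Gaussian integration by parts in `ℝ^N`. -/
lemma integral_eval_mul_gaussN {N : ℕ} (i : Fin N) {φ : (Fin N → ℝ) → ℝ} {M : ℝ}
    (hφ : Differentiable ℝ φ) (hM : ∀ x, |φ x| ≤ M) (hφ' : Integrable (pderiv N i φ) (gaussN N)) :
    ∫ v, v i * φ v ∂gaussN N = ∫ v, pderiv N i φ v ∂gaussN N := by
  obtain _ | n := N
  · exact i.elim0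
  have e := (measurePreserving_piFinSuccAbove (fun _ : Fin (n + 1) ↦ gaussianReal 0 1) i).symm
  have i1 : Integrable (fun v ↦ v i * φ v) (gaussN (n + 1)) :=
    (integrable_eval_gaussN _ i).mul_bdd hφ.continuous.aestronglyMeasurable (ae_of_all _ hM)
  have i1' := e.integrable_comp_of_integrable i1
  have i2' := e.integrable_comp_of_integrable hφ'
  have s1 := integral_prod_symm _ i1'
  have s2 := integral_prod_symm _ i2'
  simp only [Function.comp_def] at s1 s2
  rw [gaussN, ← e.integral_comp (MeasurableEquiv.measurableEmbedding _),
    ← e.integral_comp (MeasurableEquiv.measurableEmbedding _), s1, s2]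
  refine integral_congr_ae ?_
  filter_upwards [i2'.prod_left_ae] with w hw
  have key := integral_mul_gaussianReal (φ := fun t ↦ φ (i.insertNth t w))
    (φ' := fun t ↦ pderiv (n + 1) i φ (i.insertNth t w)) (M := M) (fun t ↦ ?_) (fun _ ↦ hM _) hw
  · have hx (x : ℝ) : (MeasurableEquiv.piFinSuccAbove (fun _ ↦ ℝ) i).symm (x, w) =
        i.insertNth x w := rfl
    simpa only [hx, Fin.insertNth_apply_same] using key
  · have h1 : HasDerivAt (fun t : ℝ ↦ (i.insertNth t w : Fin (n + 1) → ℝ)) (Pi.single i 1) t := by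
      rw [hasDerivAt_pi]
      intro j
      refine Fin.succAboveCases i ?_ (fun k ↦ ?_) j
      · simpa using hasDerivAt_id' t
      · simpa using hasDerivAt_const t (w k)
    exact (hφ _).hasFDerivAt.comp_hasDerivAt t h1

/-- Hypercontractivity, interpolated between `L¹` and `L^∞`. -/
lemma integral_mul_ornsteinUhlenbeck_le {N : ℕ} {ρ : ℝ} (h0 : 0 ≤ ρ) (h1 : ρ ≤ 1 / 3)
    {h : (Fin N → ℝ) → ℝ} {M a : ℝ} (hc : Continuous h) (hM : ∀ x, |h x| ≤ M)
    (ha : ∫ x, |h x| ∂gaussN N ≤ a) :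
    ∫ p, |h p.1| * |h (ρ • p.1 + √(1 - ρ ^ 2) • p.2)| ∂(gaussN N).prod (gaussN N) ≤
      a ^ (3 / 2 : ℝ) * M ^ (1 / 2 : ℝ) := by
  have hM0 : 0 ≤ M := (abs_nonneg _).trans (hM 0)
  have ha0 : 0 ≤ a := (integral_nonneg fun _ ↦ abs_nonneg _).trans ha
  have hi : Integrable h (gaussN N) := .of_bound (by fun_prop) M (ae_of_all _ hM)
  let F : BoundedContinuousFunction (Fin N → ℝ) ℝ≥0 :=
    BoundedContinuousFunction.mkOfBound ⟨fun x ↦ ‖h x‖₊, by fun_prop⟩ M fun x y ↦ by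
      have hx := hM x
      have hy := hM y
      simp only [ContinuousMap.coe_mk, NNReal.dist_eq, coe_nnnorm, Real.norm_eq_abs]
      rw [abs_le]
      constructor <;> linarith [abs_nonneg (h x), abs_nonneg (h y)]
  have hF (x) : (F x : ℝ≥0∞) = ‖h x‖ₑ := rfl
  have hρ : ρ ^ 2 + √(1 - ρ ^ 2) ^ 2 = 1 := by
    rw [Real.sq_sqrt (by nlinarith)]; ring
  have key := lintegral_pi_gaussianCoupling_le h0 h1 N F
  have e := measurePreserving_gaussianCoupling N ρ
  rw [← e.lintegral_comp (by fun_prop), ← e.lintegral_comp (by fun_prop),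
    ← e.lintegral_comp (by fun_prop)] at key
  have m₁ : MeasurePreserving (Prod.fst : (Fin N → ℝ) × (Fin N → ℝ) → _)
      ((gaussN N).prod (gaussN N)) (gaussN N) := measurePreserving_fst
  have m₂ := m₁.comp (measurePreserving_gaussN_reflection N hρ)
  have b : ∫⁻ x, (F x : ℝ≥0∞) ^ (4 / 3 : ℝ) ∂gaussN N ≤ ENNReal.ofReal (a * M ^ (1 / 3 : ℝ)) := by
    calc ∫⁻ x, (F x : ℝ≥0∞) ^ (4 / 3 : ℝ) ∂gaussN N
        ≤ ∫⁻ x, ‖h x‖ₑ * ENNReal.ofReal (M ^ (1 / 3 : ℝ)) ∂gaussN N := by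
          refine lintegral_mono fun x ↦ ?_
          have : (4 / 3 : ℝ) = 1 + 1 / 3 := by norm_num
          rw [hF, this, ENNReal.rpow_add_of_nonneg _ _ (by norm_num) (by norm_num),
            ENNReal.rpow_one, ← ENNReal.ofReal_rpow_of_nonneg hM0 (by norm_num)]
          gcongr
          rw [← ofReal_norm]
          exact ENNReal.ofReal_le_ofReal (hM x)
      _ = ENNReal.ofReal ((∫ x, |h x| ∂gaussN N) * M ^ (1 / 3 : ℝ)) := by
          rw [lintegral_mul_const _ (by fun_prop), ENNReal.ofReal_mul (by positivity),
            ← ofReal_integral_norm_eq_lintegral_enorm hi]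
          rfl
      _ ≤ _ := by gcongr
  have k₁ : ∫⁻ p : (Fin N → ℝ) × (Fin N → ℝ), (F (fun i ↦ p.1 i) : ℝ≥0∞) ^ (4 / 3 : ℝ)
      ∂(gaussN N).prod (gaussN N) ≤ ENNReal.ofReal (a * M ^ (1 / 3 : ℝ)) := by
    rw [← m₁.lintegral_comp (by fun_prop)] at b
    exact b
  have k₂ : ∫⁻ p : (Fin N → ℝ) × (Fin N → ℝ),
      (F (fun i ↦ ρ * p.1 i + √(1 - ρ ^ 2) * p.2 i) : ℝ≥0∞) ^ (4 / 3 : ℝ)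
      ∂(gaussN N).prod (gaussN N) ≤ ENNReal.ofReal (a * M ^ (1 / 3 : ℝ)) := by
    rw [← m₂.lintegral_comp (by fun_prop)] at b
    exact b
  have key' := key.trans (mul_le_mul' (ENNReal.rpow_le_rpow k₁ (by norm_num))
    (ENNReal.rpow_le_rpow k₂ (by norm_num)))
  rw [ENNReal.ofReal_rpow_of_nonneg (by positivity) (by norm_num),
    ← ENNReal.ofReal_mul (by positivity)] at key'
  have fin : (a * M ^ (1 / 3 : ℝ)) ^ (3 / 4 : ℝ) * (a * M ^ (1 / 3 : ℝ)) ^ (3 / 4 : ℝ) =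
      a ^ (3 / 2 : ℝ) * M ^ (1 / 2 : ℝ) := by
    rw [← Real.mul_rpow (by positivity) (by positivity), mul_mul_mul_comm,
      Real.mul_rpow (by positivity) (by positivity), ← sq, ← sq, ← Real.rpow_natCast,
      ← Real.rpow_mul ha0, ← Real.rpow_natCast, ← Real.rpow_mul hM0, ← Real.rpow_mul hM0]
    norm_num
  rw [fin] at key'
  rw [integral_eq_lintegral_of_nonneg_ae (ae_of_all _ fun _ ↦ by positivity) (by fun_prop)]
  refine ENNReal.toReal_le_of_le_ofReal (by positivity) (le_trans (le_of_eq ?_) key')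
  refine lintegral_congr fun p ↦ ?_
  rw [ENNReal.ofReal_mul (by positivity), hF, hF, ← ofReal_norm, ← ofReal_norm]
  rfl

/-- The Ornstein-Uhlenbeck operator `P_ρ h(x) = ∫ h(ρ x + √(1 - ρ²) y) dγ(y)`. -/
noncomputable def ornsteinUhlenbeck (N : ℕ) (ρ : ℝ) (h : (Fin N → ℝ) → ℝ) (x : Fin N → ℝ) : ℝ :=
  ∫ y, h (ρ • x + √(1 - ρ ^ 2) • y) ∂gaussN N

lemma integrable_of_continuous_of_bound {α : Type*} [TopologicalSpace α] [MeasurableSpace α]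
    [OpensMeasurableSpace α] [SecondCountableTopologyEither α ℝ] {μ : Measure α} [IsFiniteMeasure μ]
    {h : α → ℝ} {M : ℝ} (hc : Continuous h) (hM : ∀ x, |h x| ≤ M) : Integrable h μ :=
  .of_bound hc.aestronglyMeasurable M (ae_of_all _ hM)

lemma abs_integral_le_of_abs_le {α : Type*} [MeasurableSpace α] {μ : Measure α}
    [IsProbabilityMeasure μ] {h : α → ℝ} {M : ℝ} (hM : ∀ x, |h x| ≤ M) : |∫ x, h x ∂μ| ≤ M := by
  simpa using norm_integral_le_of_norm_le_const (μ := μ) (f := h) (ae_of_all _ hM)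

lemma sq_integral_mul_le_s11 {α : Type*} [MeasurableSpace α] {μ : Measure α} {u w : α → ℝ}
    (hu : MemLp u 2 μ) (hw : MemLp w 2 μ) :
    (∫ x, u x * w x ∂μ) ^ 2 ≤ (∫ x, u x ^ 2 ∂μ) * ∫ x, w x ^ 2 ∂μ := by
  have h (t : ℝ) : 0 ≤ (∫ x, u x ^ 2 ∂μ) * (t * t) + (2 * ∫ x, u x * w x ∂μ) * t +
      ∫ x, w x ^ 2 ∂μ := by
    have e : ∫ x, (t * u x + w x) ^ 2 ∂μ = (∫ x, u x ^ 2 ∂μ) * (t * t) +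
        (2 * ∫ x, u x * w x ∂μ) * t + ∫ x, w x ^ 2 ∂μ := by
      have i1 : Integrable (fun x ↦ u x * w x) μ := hu.integrable_mul hw
      have : ∀ x, (t * u x + w x) ^ 2 = (t * t) * u x ^ 2 + (2 * t) * (u x * w x) + w x ^ 2 :=
        fun x ↦ by ring
      simp_rw [this]
      have j1 := hu.integrable_sq.const_mul (t * t)
      have j2 := i1.const_mul (2 * t)
      rw [integral_add (by exact j1.add j2) hw.integrable_sq, integral_add j1 j2,
        integral_const_mul, integral_const_mul]
      ring
    rw [← e]
    positivity
  have := discrim_le_zero h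
  rw [discrim] at this
  nlinarith

section OrnsteinUhlenbeck

variable {N : ℕ} {ρ : ℝ} {h : (Fin N → ℝ) → ℝ} {M : ℝ}

lemma abs_ornsteinUhlenbeck_le (hM : ∀ x, |h x| ≤ M) (x : Fin N → ℝ) :
    |ornsteinUhlenbeck N ρ h x| ≤ M :=
  abs_integral_le_of_abs_le fun _ ↦ hM _

lemma continuous_ornsteinUhlenbeck (hc : Continuous h) (hM : ∀ x, |h x| ≤ M) :
    Continuous (ornsteinUhlenbeck N ρ h) :=
  continuous_of_dominated (bound := fun _ ↦ M) (fun _ ↦ by fun_prop)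
    (fun _ ↦ ae_of_all _ fun _ ↦ hM _) (integrable_const _) (ae_of_all _ fun _ ↦ by fun_prop)

lemma sq_add_sq_sqrt_one_sub (h0 : 0 ≤ ρ) (h1 : ρ ≤ 1) : ρ ^ 2 + √(1 - ρ ^ 2) ^ 2 = 1 := by
  rw [Real.sq_sqrt (by nlinarith)]; ring

/-- The correlated pair `(x, ρ x + √(1 - ρ²) y)` is exchangeable. -/
lemma integral_mul_comp_reflection (h0 : 0 ≤ ρ) (h1 : ρ ≤ 1) (u w : (Fin N → ℝ) → ℝ) :
    ∫ p, u p.1 * w (ρ • p.1 + √(1 - ρ ^ 2) • p.2) ∂(gaussN N).prod (gaussN N) =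
      ∫ p, w p.1 * u (ρ • p.1 + √(1 - ρ ^ 2) • p.2) ∂(gaussN N).prod (gaussN N) := by
  have hρ := sq_add_sq_sqrt_one_sub h0 h1
  have e := measurePreserving_gaussN_reflection N hρ
  set s := √(1 - ρ ^ 2)
  have inv : Function.Involutive (fun p : (Fin N → ℝ) × (Fin N → ℝ) ↦
      (ρ • p.1 + s • p.2, s • p.1 - ρ • p.2)) := by
    intro p
    ext j
    · simp only [Pi.add_apply, Pi.sub_apply, Pi.smul_apply, smul_eq_mul]
      linear_combination (p.1 j) * hρ
    · simp only [Pi.add_apply, Pi.sub_apply, Pi.smul_apply, smul_eq_mul]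
      linear_combination (p.2 j) * hρ
  let E : (Fin N → ℝ) × (Fin N → ℝ) ≃ᵐ (Fin N → ℝ) × (Fin N → ℝ) :=
    { toEquiv := inv.toPerm, measurable_toFun := e.measurable, measurable_invFun := e.measurable }
  rw [← e.integral_comp E.measurableEmbedding]
  refine integral_congr_ae (ae_of_all _ fun p ↦ ?_)
  have := congrArg Prod.fst (inv p)
  simp only at this ⊢
  rw [this, mul_comm]

/-- The image of a standard Gaussian pair under a linear combination. -/
lemma integral_comp_smul_add_smul {c s t : ℝ} (ht : 0 < t) (hcs : c ^ 2 + s ^ 2 = t ^ 2)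
    {G : (Fin N → ℝ) → ℝ} (hG : Continuous G) :
    ∫ p, G (c • p.1 + s • p.2) ∂(gaussN N).prod (gaussN N) = ∫ y, G (t • y) ∂gaussN N := by
  have e := measurePreserving_gaussN_reflection N (c := c / t) (s := s / t) (by
    field_simp; exact hcs)
  have m := (measurePreserving_fst (μ := gaussN N) (ν := gaussN N)).comp e
  conv_rhs => rw [← m.map_eq, integral_map m.measurable.aemeasurable (by fun_prop)]
  refine integral_congr_ae (ae_of_all _ fun p ↦ ?_)
  simp only [Function.comp_apply, smul_add, smul_smul]
  congr 3 <;> field_simp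

lemma integral_mul_ornsteinUhlenbeck {u w : (Fin N → ℝ) → ℝ} {M' : ℝ} (hu : Continuous u)
    (hw : Continuous w) (hM : ∀ x, |u x| ≤ M) (hM' : ∀ x, |w x| ≤ M') :
    ∫ x, u x * ornsteinUhlenbeck N ρ w x ∂gaussN N =
      ∫ p, u p.1 * w (ρ • p.1 + √(1 - ρ ^ 2) • p.2) ∂(gaussN N).prod (gaussN N) := by
  rw [integral_prod _ (integrable_of_continuous_of_bound (M := M * M') (by fun_prop) fun p ↦ ?_)]
  · simp_rw [integral_const_mul]
    rfl
  · rw [abs_mul]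
    exact mul_le_mul (hM _) (hM' _) (abs_nonneg _) ((abs_nonneg _).trans (hM 0))

lemma ornsteinUhlenbeck_ornsteinUhlenbeck (h0 : 0 ≤ ρ) (h1 : ρ < 1) (hc : Continuous h)
    (hM : ∀ x, |h x| ≤ M) :
    ornsteinUhlenbeck N ρ (ornsteinUhlenbeck N ρ h) = ornsteinUhlenbeck N (ρ ^ 2) h := by
  ext x
  have hs : √(1 - ρ ^ 2) ^ 2 = 1 - ρ ^ 2 := Real.sq_sqrt (by nlinarith)
  have ht : 0 < 1 - (ρ ^ 2) ^ 2 := by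
    have : ρ ^ 2 < 1 := by nlinarith
    nlinarith [sq_nonneg ρ]
  have := integral_comp_smul_add_smul (N := N) (c := ρ * √(1 - ρ ^ 2)) (s := √(1 - ρ ^ 2))
    (Real.sqrt_pos.2 ht) (by rw [mul_pow, hs, Real.sq_sqrt ht.le]; ring)
    (G := fun y ↦ h (ρ ^ 2 • x + y)) (by fun_prop)
  rw [integral_prod _ (integrable_of_continuous_of_bound (by fun_prop) fun p ↦ hM _)] at this
  simp only [ornsteinUhlenbeck]
  rw [← this]
  refine integral_congr_ae (ae_of_all _ fun y ↦ integral_congr_ae (ae_of_all _ fun z ↦ ?_))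
  simp only
  congr 1
  module

lemma integral_sq_ornsteinUhlenbeck (h0 : 0 ≤ ρ) (h1 : ρ < 1) (hc : Continuous h)
    (hM : ∀ x, |h x| ≤ M) :
    ∫ x, ornsteinUhlenbeck N ρ h x ^ 2 ∂gaussN N =
      ∫ x, h x * ornsteinUhlenbeck N (ρ ^ 2) h x ∂gaussN N := by
  have hc' := continuous_ornsteinUhlenbeck (N := N) (ρ := ρ) hc hM
  have hM' := abs_ornsteinUhlenbeck_le (N := N) (ρ := ρ) hM
  rw [← ornsteinUhlenbeck_ornsteinUhlenbeck h0 h1 hc hM,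
    integral_mul_ornsteinUhlenbeck hc hc' hM hM', integral_mul_comp_reflection h0 h1.le,
    ← integral_mul_ornsteinUhlenbeck hc' hc hM' hM]
  simp_rw [sq]

/-- Iterating Cauchy-Schwarz down to the hypercontractive range gives `L²` smoothing of
Ornstein-Uhlenbeck operators with parameter arbitrarily close to `1`. -/
lemma integral_sq_ornsteinUhlenbeck_le {a : ℝ} (hc : Continuous h) (hM0 : 0 < M)
    (hM : ∀ x, |h x| ≤ M) (ha : ∫ x, |h x| ∂gaussN N ≤ a) (k : ℕ) (h0 : 0 ≤ ρ)
    (h1 : ρ ^ 2 ^ (k + 1) ≤ 1 / 3) :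
    ∫ x, ornsteinUhlenbeck N ρ h x ^ 2 ∂gaussN N ≤
      a * M * (a / M) ^ ((1 / 2) ^ (k + 1) : ℝ) := by
  have ha0 : 0 ≤ a := (integral_nonneg fun _ ↦ abs_nonneg _).trans ha
  have hρ1 : ρ < 1 := by
    by_contra! hρ
    linarith [one_le_pow₀ hρ (n := 2 ^ (k + 1))]
  induction k generalizing ρ with
  | zero =>
    rw [integral_sq_ornsteinUhlenbeck h0 hρ1 hc hM, integral_mul_ornsteinUhlenbeck hc hc hM hM]
    norm_num at h1
    refine le_trans ?_ ((integral_mul_ornsteinUhlenbeck_le (sq_nonneg ρ) (by linarith) hc hM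
      ha).trans_eq ?_)
    · simp_rw [← abs_mul]
      exact (le_abs_self _).trans abs_integral_le_integral_abs
    · have : (3 / 2 : ℝ) = 1 + 1 / 2 := by norm_num
      rw [this, Real.rpow_add_of_nonneg ha0 (by norm_num) (by norm_num), Real.rpow_one,
        Real.div_rpow ha0 hM0.le]
      have hM2 : M ^ (1 / 2 : ℝ) * M ^ (1 / 2 : ℝ) = M := by
        rw [← Real.rpow_add hM0]; norm_num
      have hp : M ^ (1 / 2 : ℝ) ≠ 0 := by positivity
      norm_num at hM2 hp ⊢
      field_simp
      linear_combination (a * a ^ (1 / 2 : ℝ)) * hM2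
  | succ k ih =>
    have hρ2 : ρ ^ 2 < 1 := by nlinarith
    have ih' := ih (ρ := ρ ^ 2) (by positivity) (by
      rw [← pow_mul, ← pow_succ']; exact h1) hρ2
    have hc' := continuous_ornsteinUhlenbeck (N := N) (ρ := ρ ^ 2) hc hM
    have hM' := abs_ornsteinUhlenbeck_le (N := N) (ρ := ρ ^ 2) hM
    have cs := sq_integral_mul_le_s11 (μ := gaussN N)
      (MemLp.of_bound hc.aestronglyMeasurable M (ae_of_all _ hM))
      (MemLp.of_bound hc'.aestronglyMeasurable M (ae_of_all _ hM'))
    rw [← integral_sq_ornsteinUhlenbeck h0 hρ1 hc hM] at cs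
    have h2 : ∫ x, h x ^ 2 ∂gaussN N ≤ a * M := by
      calc ∫ x, h x ^ 2 ∂gaussN N ≤ ∫ x, |h x| * M ∂gaussN N := by
            refine integral_mono (integrable_of_continuous_of_bound (M := M ^ 2) (by fun_prop)
              fun x ↦ ?_) (integrable_of_continuous_of_bound (M := M * M) (by fun_prop)
              fun x ↦ ?_) fun x ↦ ?_
            · rw [abs_pow]; gcongr; exact hM x
            · rw [abs_mul, abs_abs, abs_of_pos hM0]; gcongr; exact hM x
            · rw [← sq_abs, sq]; gcongr; exact hM x
        _ ≤ a * M := by rw [integral_mul_const]; gcongr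
    refine le_of_sq_le_sq (cs.trans ((mul_le_mul h2 ih' (by positivity)
      (by positivity)).trans_eq ?_)) (by positivity)
    have hq : 0 ≤ a / M := by positivity
    rw [mul_pow, ← Real.rpow_mul_natCast hq]
    have : ((1 / 2 : ℝ) ^ (k + 1 + 1)) * (2 : ℕ) = (1 / 2) ^ (k + 1) := by
      push_cast; ring
    rw [this]
    ring

end OrnsteinUhlenbeck

/-- The Gaussian integration by parts form of `P_r (∂_i f)`, which makes sense for bounded `f`. -/
noncomputable def smoothedPderiv (N : ℕ) (i : Fin N) (r : ℝ) (f : (Fin N → ℝ) → ℝ)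
    (u : Fin N → ℝ) : ℝ :=
  (√(1 - r ^ 2))⁻¹ * ∫ v, v i * f (r • u + √(1 - r ^ 2) • v) ∂gaussN N

section SmoothedPderiv

variable {N : ℕ} {i : Fin N} {r : ℝ} {f : (Fin N → ℝ) → ℝ}

lemma integrable_eval_mul_gaussN (i : Fin N) {φ : (Fin N → ℝ) → ℝ} (hφ : Continuous φ)
    (hM : ∀ x, |φ x| ≤ 1) : Integrable (fun v ↦ v i * φ v) (gaussN N) :=
  (integrable_eval_gaussN N i).mul_bdd hφ.aestronglyMeasurable (ae_of_all _ hM)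

lemma abs_integral_eval_mul_gaussN_le (i : Fin N) {φ : (Fin N → ℝ) → ℝ} (hφ : Continuous φ)
    (hM : ∀ x, |φ x| ≤ 1) : |∫ v, v i * φ v ∂gaussN N| ≤ 1 := by
  refine abs_integral_le_integral_abs.trans (le_trans ?_ (integral_abs_eval_gaussN_le N i))
  refine integral_mono (integrable_eval_mul_gaussN i hφ hM).abs (integrable_eval_gaussN N i).abs
    fun v ↦ ?_
  simp only [abs_mul]
  exact mul_le_of_le_one_right (abs_nonneg _) (hM v)

lemma abs_smoothedPderiv_le (hf : Continuous f) (hM : ∀ x, |f x| ≤ 1) (u : Fin N → ℝ) :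
    |smoothedPderiv N i r f u| ≤ (√(1 - r ^ 2))⁻¹ := by
  rw [smoothedPderiv, abs_mul, abs_of_nonneg (by positivity)]
  exact mul_le_of_le_one_right (by positivity)
    (abs_integral_eval_mul_gaussN_le i (by fun_prop) fun v ↦ hM _)

lemma continuous_smoothedPderiv (hf : Continuous f) (hM : ∀ x, |f x| ≤ 1) :
    Continuous (smoothedPderiv N i r f) := by
  refine continuous_const.mul (continuous_of_dominated (bound := fun v ↦ |v i|)
    (fun _ ↦ by fun_prop) (fun u ↦ ae_of_all _ fun v ↦ ?_) (integrable_eval_gaussN N i).abs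
    (ae_of_all _ fun _ ↦ by fun_prop))
  rw [norm_mul]
  exact mul_le_of_le_one_right (norm_nonneg _) (hM _)

lemma pderiv_comp_add_smul (hf : Differentiable ℝ f) (x : Fin N → ℝ) (s : ℝ) (v : Fin N → ℝ) :
    pderiv N i (fun v ↦ f (x + s • v)) v = s * pderiv N i f (x + s • v) := by
  have h : HasFDerivAt (fun v : Fin N → ℝ ↦ x + s • v)
      (s • ContinuousLinearMap.id ℝ (Fin N → ℝ)) v :=
    ((hasFDerivAt_id v).const_smul s).const_add x
  have h' : HasFDerivAt (fun v : Fin N → ℝ ↦ f (x + s • v))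
      ((fderiv ℝ f (x + s • v)).comp (s • ContinuousLinearMap.id ℝ (Fin N → ℝ))) v :=
    (hf _).hasFDerivAt.comp v h
  rw [pderiv, h'.fderiv]
  simp [pderiv]

lemma integrable_comp_reflection {g : (Fin N → ℝ) → ℝ} {c s : ℝ} (h : c ^ 2 + s ^ 2 = 1)
    (hg : Integrable g (gaussN N)) :
    Integrable (fun p : (Fin N → ℝ) × (Fin N → ℝ) ↦ g (c • p.1 + s • p.2))
      ((gaussN N).prod (gaussN N)) :=
  (measurePreserving_fst.comp (measurePreserving_gaussN_reflection N h)).integrable_comp_of_integrable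
    hg

lemma smoothedPderiv_ae_eq (h0 : 0 ≤ r) (h1 : r < 1) (hf : Differentiable ℝ f)
    (hM : ∀ x, |f x| ≤ 1) (hg : Integrable (pderiv N i f) (gaussN N)) :
    smoothedPderiv N i r f =ᵐ[gaussN N] ornsteinUhlenbeck N r (pderiv N i f) := by
  have hs : 0 < √(1 - r ^ 2) := Real.sqrt_pos.2 (by nlinarith)
  filter_upwards [(integrable_comp_reflection (sq_add_sq_sqrt_one_sub h0 h1.le) hg).prod_right_ae]
    with u hu
  rw [smoothedPderiv, integral_eval_mul_gaussN i (φ := fun v ↦ f (r • u + √(1 - r ^ 2) • v)) (M := 1)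
    (by fun_prop) (fun _ ↦ hM _)]
  · simp_rw [pderiv_comp_add_smul hf, integral_const_mul]
    rw [inv_mul_cancel_left₀ hs.ne']
    rfl
  · simp_rw [funext (pderiv_comp_add_smul hf _ _)]
    exact hu.const_mul _

lemma integral_abs_smoothedPderiv_le (h0 : 0 ≤ r) (h1 : r < 1) (hf : Differentiable ℝ f)
    (hM : ∀ x, |f x| ≤ 1) (hg : Integrable (pderiv N i f) (gaussN N)) :
    ∫ u, |smoothedPderiv N i r f u| ∂gaussN N ≤ ∫ u, |pderiv N i f u| ∂gaussN N := by
  have hr := sq_add_sq_sqrt_one_sub h0 h1.le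
  have hi := integrable_comp_reflection hr hg
  have m := measurePreserving_fst.comp (measurePreserving_gaussN_reflection N hr)
  calc ∫ u, |smoothedPderiv N i r f u| ∂gaussN N
      = ∫ u, |ornsteinUhlenbeck N r (pderiv N i f) u| ∂gaussN N :=
        integral_congr_ae ((smoothedPderiv_ae_eq h0 h1 hf hM hg).mono fun _ ↦ congrArg abs)
    _ ≤ ∫ u, ∫ v, |pderiv N i f (r • u + √(1 - r ^ 2) • v)| ∂gaussN N ∂gaussN N :=
        integral_mono hi.integral_prod_left.abs hi.abs.integral_prod_left
          fun _ ↦ abs_integral_le_integral_abs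
    _ = ∫ p, |pderiv N i f (r • p.1 + √(1 - r ^ 2) • p.2)| ∂(gaussN N).prod (gaussN N) :=
        (integral_prod _ hi.abs).symm
    _ = ∫ u, |pderiv N i f u| ∂gaussN N := by
        conv_rhs => rw [← m.map_eq]
        rw [integral_map m.measurable.aemeasurable (by rw [m.map_eq]; exact hg.abs.1)]
        rfl

lemma ornsteinUhlenbeck_smoothedPderiv (h0 : 0 ≤ r) (h1 : r < 1) (hf : Continuous f)
    (hM : ∀ x, |f x| ≤ 1) :
    ornsteinUhlenbeck N r (smoothedPderiv N i r f) = smoothedPderiv N i (r ^ 2) f := by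
  ext x
  have hs0 : 0 < 1 - r ^ 2 := by nlinarith
  obtain ⟨s, hs⟩ : ∃ s, s = √(1 - r ^ 2) := ⟨_, rfl⟩
  have hs2 : s ^ 2 = 1 - r ^ 2 := by rw [hs, Real.sq_sqrt hs0.le]
  have hsp : 0 < s := by rw [hs]; exact Real.sqrt_pos.2 hs0
  have ht0 : 0 < 1 - (r ^ 2) ^ 2 := by nlinarith [sq_nonneg r]
  obtain ⟨t, ht⟩ : ∃ t, t = √(1 - (r ^ 2) ^ 2) := ⟨_, rfl⟩
  have ht2 : t ^ 2 = 1 - (r ^ 2) ^ 2 := by rw [ht, Real.sq_sqrt ht0.le]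
  have htp : 0 < t := by rw [ht]; exact Real.sqrt_pos.2 ht0
  have hαβ : (r * s / t) ^ 2 + (s / t) ^ 2 = 1 := by
    field_simp
    rw [ht2, hs2]; ring
  have e := measurePreserving_gaussN_reflection N hαβ
  have hc : Continuous fun p : Fin N → ℝ ↦ f (r ^ 2 • x + t • p) := by fun_prop
  have i1 := integrable_eval_mul_gaussN i hc fun _ ↦ hM _
  have i2 := integrable_eval_gaussN N i
  have i3 : Integrable (fun p : Fin N → ℝ ↦ f (r ^ 2 • x + t • p)) (gaussN N) :=
    integrable_of_continuous_of_bound hc fun _ ↦ hM _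
  have I1 := (i1.mul_prod (integrable_const (1 : ℝ) (μ := gaussN N))).const_mul (s / t)
  have I2 := (i3.mul_prod i2).const_mul (r * s / t)
  have z : ∫ v, v i ∂gaussN N = 0 := by
    have h := measurePreserving_eval (fun _ : Fin N ↦ gaussianReal 0 1) i
    have := integral_id_gaussianReal (μ := 0) (v := 1)
    rwa [← h.map_eq, integral_map h.measurable.aemeasurable (by fun_prop)] at this
  have key : ∫ p : (Fin N → ℝ) × (Fin N → ℝ), p.2 i * f (r • (r • x + s • p.1) + s • p.2)
      ∂(gaussN N).prod (gaussN N) = s / t * ∫ v, v i * f (r ^ 2 • x + t • v) ∂gaussN N := by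
    calc _ = ∫ p : (Fin N → ℝ) × (Fin N → ℝ),
          (s / t * (p.1 i * f (r ^ 2 • x + t • p.1) * 1) -
            r * s / t * (f (r ^ 2 • x + t • p.1) * p.2 i)) ∂(gaussN N).prod (gaussN N) := by
          conv_rhs => rw [← e.map_eq, integral_map e.measurable.aemeasurable (by fun_prop)]
          refine integral_congr_ae (ae_of_all _ fun p ↦ ?_)
          have a1 : r ^ 2 • x + t • ((r * s / t) • p.1 + (s / t) • p.2) =
              r • (r • x + s • p.1) + s • p.2 := by
            simp only [smul_add, smul_smul, ← add_assoc]
            congr 3 <;> field_simp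
          simp only [a1, Pi.add_apply, Pi.sub_apply, Pi.smul_apply, smul_eq_mul]
          linear_combination (-p.2 i * f (r • (r • x + s • p.1) + s • p.2)) * hαβ
      _ = _ := by
          rw [integral_sub I1 I2, integral_const_mul, integral_const_mul,
            integral_prod_mul (fun v : Fin N → ℝ ↦ v i * f (r ^ 2 • x + t • v)) fun _ ↦ 1,
            integral_prod_mul (fun v : Fin N → ℝ ↦ f (r ^ 2 • x + t • v)) fun v : Fin N → ℝ ↦ v i, z]
          simp
  have ip : Integrable (fun p : (Fin N → ℝ) × (Fin N → ℝ) ↦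
      p.2 i * f (r • (r • x + s • p.1) + s • p.2)) ((gaussN N).prod (gaussN N)) := by
    have := (integrable_const (1 : ℝ) (μ := gaussN N)).mul_prod i2
    simp only [one_mul] at this
    exact this.mul_bdd (by fun_prop) (ae_of_all _ fun _ ↦ hM _)
  rw [integral_prod _ ip] at key
  simp only [ornsteinUhlenbeck, smoothedPderiv, ← hs, ← ht]
  rw [integral_const_mul, key]
  field_simp

lemma integral_pderiv_mul_eval (h0 : 0 ≤ r) (h1 : r < 1) (hf : Differentiable ℝ f)
    (hM : ∀ x, |f x| ≤ 1) (hg : Integrable (pderiv N i f) (gaussN N)) :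
    ∫ p, pderiv N i f p.1 * (p.2 i * f (r ^ 2 • p.1 + √(1 - (r ^ 2) ^ 2) • p.2))
      ∂(gaussN N).prod (gaussN N) =
        √(1 - (r ^ 2) ^ 2) * ∫ u, smoothedPderiv N i r f u ^ 2 ∂gaussN N := by
  have ht0 : 0 < 1 - (r ^ 2) ^ 2 := by
    have : 0 < 1 - r ^ 2 := by nlinarith
    nlinarith [sq_nonneg r]
  have hc := continuous_smoothedPderiv (N := N) (i := i) (r := r) hf.continuous hM
  have hb := abs_smoothedPderiv_le (N := N) (i := i) (r := r) hf.continuous hM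
  have hr := sq_add_sq_sqrt_one_sub h0 h1.le
  have I1 : Integrable (fun p : (Fin N → ℝ) × (Fin N → ℝ) ↦
      pderiv N i f p.1 * (p.2 i * f (r ^ 2 • p.1 + √(1 - (r ^ 2) ^ 2) • p.2)))
      ((gaussN N).prod (gaussN N)) := by
    simp_rw [← mul_assoc]
    exact (hg.mul_prod (integrable_eval_gaussN N i)).mul_bdd
      (hf.continuous.comp (by fun_prop)).aestronglyMeasurable (ae_of_all _ fun _ ↦ hM _)
  have I2 : Integrable (fun p : (Fin N → ℝ) × (Fin N → ℝ) ↦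
      pderiv N i f p.1 * smoothedPderiv N i r f (r • p.1 + √(1 - r ^ 2) • p.2))
      ((gaussN N).prod (gaussN N)) :=
    (hg.comp_fst _).mul_bdd (hc.comp (by fun_prop)).aestronglyMeasurable
      (ae_of_all _ fun _ ↦ hb _)
  have I3 : Integrable (fun p : (Fin N → ℝ) × (Fin N → ℝ) ↦
      smoothedPderiv N i r f p.1 * pderiv N i f (r • p.1 + √(1 - r ^ 2) • p.2))
      ((gaussN N).prod (gaussN N)) :=
    (integrable_comp_reflection hr hg).bdd_mul
      (hc.comp continuous_fst).aestronglyMeasurable (ae_of_all _ fun _ ↦ hb _)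
  calc _ = √(1 - (r ^ 2) ^ 2) * ∫ u, pderiv N i f u * smoothedPderiv N i (r ^ 2) f u
        ∂gaussN N := by
        rw [integral_prod _ I1, ← integral_const_mul]
        refine integral_congr_ae (ae_of_all _ fun u ↦ ?_)
        simp only [smoothedPderiv, integral_const_mul]
        rw [mul_left_comm (√_), mul_inv_cancel_left₀ (Real.sqrt_pos.2 ht0).ne']
    _ = √(1 - (r ^ 2) ^ 2) * ∫ p, pderiv N i f p.1 *
        smoothedPderiv N i r f (r • p.1 + √(1 - r ^ 2) • p.2) ∂(gaussN N).prod (gaussN N) := by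
        rw [← ornsteinUhlenbeck_smoothedPderiv h0 h1 hf.continuous hM, integral_prod _ I2]
        simp_rw [integral_const_mul]
        rfl
    _ = √(1 - (r ^ 2) ^ 2) * ∫ u, smoothedPderiv N i r f u *
        ornsteinUhlenbeck N r (pderiv N i f) u ∂gaussN N := by
        rw [integral_mul_comp_reflection h0 h1.le, integral_prod _ I3]
        simp_rw [integral_const_mul]
        rfl
    _ = _ := by
        congr 1
        refine integral_congr_ae ?_
        filter_upwards [smoothedPderiv_ae_eq h0 h1 hf hM hg] with u hu
        rw [← hu, sq]

/-- Decay of the correlations appearing in the covariance representation of the variance. -/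
lemma integral_pderiv_mul_eval_le (h0 : 0 ≤ r) (k : ℕ) (h1 : r ^ 2 ^ (k + 1) ≤ 1 / 3)
    (hf : Differentiable ℝ f) (hM : ∀ x, |f x| ≤ 1)
    (hg : Integrable (pderiv N i f) (gaussN N)) :
    ∫ p, pderiv N i f p.1 * (p.2 i * f (r ^ 4 • p.1 + √(1 - (r ^ 4) ^ 2) • p.2))
      ∂(gaussN N).prod (gaussN N) ≤
        2 * gaussNorm1 N (pderiv N i f) *
          gaussNorm1 N (pderiv N i f) ^ ((1 / 2) ^ (k + 1) : ℝ) := by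
  obtain ⟨a, ha⟩ : ∃ a, a = gaussNorm1 N (pderiv N i f) := ⟨_, rfl⟩
  have ha0 : 0 ≤ a := ha ▸ integral_nonneg fun _ ↦ abs_nonneg _
  have hr1 : r < 1 := by
    by_contra! hr
    linarith [one_le_pow₀ hr (n := 2 ^ (k + 1))]
  have hr2 : r ^ 2 < 1 := by nlinarith
  have hr4 : r ^ 4 < 1 := by nlinarith [sq_nonneg r]
  have hs : 0 < √(1 - r ^ 2) := Real.sqrt_pos.2 (by linarith)
  have e : r ^ 4 = (r ^ 2) ^ 2 := by ring
  have hc := continuous_smoothedPderiv (N := N) (i := i) (r := r) hf.continuous hM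
  have main := integral_sq_ornsteinUhlenbeck_le hc (inv_pos.2 hs)
    (abs_smoothedPderiv_le hf.continuous hM) (integral_abs_smoothedPderiv_le h0 hr1 hf hM hg) k h0 h1
  rw [ornsteinUhlenbeck_smoothedPderiv h0 hr1 hf.continuous hM] at main
  rw [e, integral_pderiv_mul_eval (sq_nonneg r) hr2 hf hM hg, ← ha]
  change _ ≤ gaussNorm1 N (pderiv N i f) * _ * (gaussNorm1 N (pderiv N i f) / _) ^ _ at main
  rw [← ha] at main
  have hs1 : √(1 - r ^ 2) ≤ 1 := Real.sqrt_le_one.2 (by nlinarith [sq_nonneg r])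
  calc √(1 - ((r ^ 2) ^ 2) ^ 2) * ∫ u, smoothedPderiv N i (r ^ 2) f u ^ 2 ∂gaussN N
      ≤ (2 * √(1 - r ^ 2)) * (a * (√(1 - r ^ 2))⁻¹ * a ^ ((1 / 2) ^ (k + 1) : ℝ)) := by
        gcongr
        · rw [Real.sqrt_le_left (by positivity), mul_pow, Real.sq_sqrt (by linarith)]
          have : 0 ≤ (1 - r ^ 2) * ((1 - r ^ 2) * (2 + r ^ 2) + (1 - r ^ 4) * (1 + r ^ 2)) := by
            have : 0 < 1 - r ^ 2 := by linarith
            have : 0 < 1 - r ^ 4 := by linarith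
            positivity
          nlinarith
        · refine main.trans ?_
          gcongr
          rw [div_inv_eq_mul]
          exact mul_le_of_le_one_right ha0 hs1
    _ = _ := by field_simp

end SmoothedPderiv

section Variance

variable {N : ℕ} {f : (Fin N → ℝ) → ℝ}

lemma integrable_pderiv_mul_eval {i : Fin N} (hf : Continuous f) (hM : ∀ x, |f x| ≤ 1)
    (hg : Integrable (pderiv N i f) (gaussN N)) (c s : ℝ) :
    Integrable (fun p : (Fin N → ℝ) × (Fin N → ℝ) ↦
      pderiv N i f p.1 * (p.2 i * f (c • p.1 + s • p.2))) ((gaussN N).prod (gaussN N)) := by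
  simp_rw [← mul_assoc]
  exact (hg.mul_prod (integrable_eval_gaussN N i)).mul_bdd
    (hf.comp (by fun_prop)).aestronglyMeasurable (ae_of_all _ fun _ ↦ hM _)

lemma integral_abs_pderiv_mul_eval_le {i : Fin N} (hf : Continuous f) (hM : ∀ x, |f x| ≤ 1)
    (hg : Integrable (pderiv N i f) (gaussN N)) (c s : ℝ) :
    ∫ p, |pderiv N i f p.1 * (p.2 i * f (c • p.1 + s • p.2))| ∂(gaussN N).prod (gaussN N) ≤
      gaussNorm1 N (pderiv N i f) := by
  have I := hg.abs.mul_prod (integrable_eval_gaussN N i).abs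
  calc _ ≤ ∫ p : (Fin N → ℝ) × (Fin N → ℝ), |pderiv N i f p.1| * |p.2 i|
        ∂(gaussN N).prod (gaussN N) := by
        refine integral_mono (integrable_pderiv_mul_eval hf hM hg c s).abs I fun p ↦ ?_
        simp only [abs_mul]
        gcongr
        exact mul_le_of_le_one_right (abs_nonneg _) (hM _)
    _ = gaussNorm1 N (pderiv N i f) * ∫ v, |v i| ∂gaussN N :=
        integral_prod_mul (fun u ↦ |pderiv N i f u|) fun v : Fin N → ℝ ↦ |v i|
    _ ≤ _ := mul_le_of_le_one_right (integral_nonneg fun _ ↦ abs_nonneg _)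
        (integral_abs_eval_gaussN_le N i)

lemma reflection_pderiv_mul_eval {i : Fin N} {c s : ℝ} (h : c ^ 2 + s ^ 2 = 1)
    (x y : Fin N → ℝ) :
    pderiv N i f (c • x + s • y) * ((s • x - c • y) i *
      f (c • (c • x + s • y) + s • (s • x - c • y))) =
        f x * (pderiv N i f (c • x + s • y) * (s * x i - c * y i)) := by
  have : c • (c • x + s • y) + s • (s • x - c • y) = x := by
    ext j
    simp only [Pi.add_apply, Pi.sub_apply, Pi.smul_apply, smul_eq_mul]
    linear_combination x j * h
  rw [this]
  simp only [Pi.sub_apply, Pi.smul_apply, smul_eq_mul]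
  ring

lemma integral_reflection_pderiv {i : Fin N} (hf : Continuous f) (hM : ∀ x, |f x| ≤ 1)
    (hg : Integrable (pderiv N i f) (gaussN N)) {c s : ℝ} (h : c ^ 2 + s ^ 2 = 1) :
    ∫ p, f p.1 * (pderiv N i f (c • p.1 + s • p.2) * (s * p.1 i - c * p.2 i))
      ∂(gaussN N).prod (gaussN N) =
        ∫ p, pderiv N i f p.1 * (p.2 i * f (c • p.1 + s • p.2)) ∂(gaussN N).prod (gaussN N) := by
  have e := measurePreserving_gaussN_reflection N h
  have I := (integrable_pderiv_mul_eval hf hM hg c s).1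
  conv_rhs => rw [← e.map_eq, integral_map e.measurable.aemeasurable (by rw [e.map_eq]; exact I)]
  simp only [reflection_pderiv_mul_eval h]

lemma integrable_reflection_pderiv {i : Fin N} (hf : Continuous f) (hM : ∀ x, |f x| ≤ 1)
    (hg : Integrable (pderiv N i f) (gaussN N)) {c s : ℝ} (h : c ^ 2 + s ^ 2 = 1) :
    Integrable (fun p : (Fin N → ℝ) × (Fin N → ℝ) ↦
      f p.1 * (pderiv N i f (c • p.1 + s • p.2) * (s * p.1 i - c * p.2 i)))
        ((gaussN N).prod (gaussN N)) := by
  have e := (measurePreserving_gaussN_reflection N h).integrable_comp_of_integrable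
    (integrable_pderiv_mul_eval hf hM hg c s)
  refine e.congr (ae_of_all _ fun p ↦ ?_)
  simp only [Function.comp_apply, reflection_pderiv_mul_eval h]

lemma integral_abs_reflection_pderiv_le {i : Fin N} (hf : Continuous f) (hM : ∀ x, |f x| ≤ 1)
    (hg : Integrable (pderiv N i f) (gaussN N)) {c s : ℝ} (h : c ^ 2 + s ^ 2 = 1) :
    ∫ p, |f p.1 * (pderiv N i f (c • p.1 + s • p.2) * (s * p.1 i - c * p.2 i))|
      ∂(gaussN N).prod (gaussN N) ≤ gaussNorm1 N (pderiv N i f) := by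
  refine le_of_eq_of_le ?_ (integral_abs_pderiv_mul_eval_le hf hM hg c s)
  have e := measurePreserving_gaussN_reflection N h
  have I := (integrable_pderiv_mul_eval hf hM hg c s).abs.1
  conv_rhs => rw [← e.map_eq, integral_map e.measurable.aemeasurable (by rw [e.map_eq]; exact I)]
  simp only [reflection_pderiv_mul_eval h]

lemma integrable_prod_reflection_pderiv {i : Fin N} (hf : Continuous f) (hM : ∀ x, |f x| ≤ 1)
    (hg : Integrable (pderiv N i f) (gaussN N)) (hc : Continuous (pderiv N i f)) :
    Integrable (fun q : ℝ × (Fin N → ℝ) × (Fin N → ℝ) ↦ f q.2.1 *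
      (pderiv N i f (Real.cos q.1 • q.2.1 + Real.sin q.1 • q.2.2) *
        (Real.sin q.1 * q.2.1 i - Real.cos q.1 * q.2.2 i)))
        ((volume.restrict (Ioc 0 (Real.pi / 2))).prod ((gaussN N).prod (gaussN N))) := by
  have m : Continuous (fun q : ℝ × (Fin N → ℝ) × (Fin N → ℝ) ↦ f q.2.1 *
      (pderiv N i f (Real.cos q.1 • q.2.1 + Real.sin q.1 • q.2.2) *
        (Real.sin q.1 * q.2.1 i - Real.cos q.1 * q.2.2 i))) := by
    have := Real.continuous_cos
    have := Real.continuous_sin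
    fun_prop
  have m' := m.aestronglyMeasurable
    (μ := (volume.restrict (Ioc 0 (Real.pi / 2))).prod ((gaussN N).prod (gaussN N)))
  rw [integrable_prod_iff m']
  constructor
  · refine ae_of_all _ fun θ ↦ ?_
    exact integrable_reflection_pderiv (c := Real.cos θ) (s := Real.sin θ) hf hM hg
      (Real.cos_sq_add_sin_sq θ)
  refine .of_bound m'.norm.integral_prod_right' (gaussNorm1 N (pderiv N i f))
    (ae_of_all _ fun θ ↦ ?_)
  rw [Real.norm_of_nonneg (integral_nonneg fun _ ↦ norm_nonneg _)]
  exact integral_abs_reflection_pderiv_le (c := Real.cos θ) (s := Real.sin θ) hf hM hg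
    (Real.cos_sq_add_sin_sq θ)

lemma fderiv_apply_eq_sum_pderiv (x v : Fin N → ℝ) :
    fderiv ℝ f x v = ∑ i, pderiv N i f x * v i := by
  conv_lhs => rw [pi_eq_sum_univ' v]
  rw [map_sum]
  refine Finset.sum_congr rfl fun i _ ↦ ?_
  have : (fun j ↦ if i = j then (1 : ℝ) else 0) = Pi.single i 1 := by
    ext j; simp [Pi.single_apply, eq_comm]
  rw [map_smul, pderiv, smul_eq_mul, mul_comm]

lemma hasDerivAt_comp_cos_add_sin (hf : Differentiable ℝ f) (x y : Fin N → ℝ) (θ : ℝ) :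
    HasDerivAt (fun θ : ℝ ↦ f (Real.cos θ • x + Real.sin θ • y))
      (-∑ i, pderiv N i f (Real.cos θ • x + Real.sin θ • y) *
        (Real.sin θ * x i - Real.cos θ * y i)) θ := by
  have h : HasDerivAt (fun θ : ℝ ↦ Real.cos θ • x + Real.sin θ • y)
      (-Real.sin θ • x + Real.cos θ • y) θ :=
    ((Real.hasDerivAt_cos θ).smul_const x).add ((Real.hasDerivAt_sin θ).smul_const y)
  refine ((hf _).hasFDerivAt.comp_hasDerivAt θ h).congr_deriv ?_
  rw [fderiv_apply_eq_sum_pderiv, ← Finset.sum_neg_distrib]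
  refine Finset.sum_congr rfl fun i _ ↦ ?_
  simp only [Pi.add_apply, Pi.smul_apply, smul_eq_mul]
  ring

lemma sub_eq_sum_integral_pderiv (hf : Differentiable ℝ f) (hc : ∀ i, Continuous (pderiv N i f))
    (x y : Fin N → ℝ) :
    f x - f y = ∑ i, ∫ θ in Ioc 0 (Real.pi / 2),
      pderiv N i f (Real.cos θ • x + Real.sin θ • y) * (Real.sin θ * x i - Real.cos θ * y i) := by
  have c (i) : Continuous fun θ : ℝ ↦
      pderiv N i f (Real.cos θ • x + Real.sin θ • y) * (Real.sin θ * x i - Real.cos θ * y i) := by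
    have := hc i
    have := Real.continuous_cos
    have := Real.continuous_sin
    fun_prop
  have h := intervalIntegral.integral_eq_sub_of_hasDerivAt (a := 0) (b := Real.pi / 2)
    (fun θ _ ↦ hasDerivAt_comp_cos_add_sin hf x y θ)
    ((continuous_finsetSum _ fun i _ ↦ c i).neg.intervalIntegrable _ _)
  rw [intervalIntegral.integral_neg, intervalIntegral.integral_finsetSum
    fun i _ ↦ (c i).intervalIntegrable _ _] at h
  simp only [Real.cos_pi_div_two, Real.sin_pi_div_two, Real.cos_zero, Real.sin_zero, zero_smul,
    one_smul, zero_add, add_zero] at h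
  simp only [← intervalIntegral.integral_of_le (show 0 ≤ Real.pi / 2 by positivity)]
  linarith

/-- The covariance representation of the Gaussian variance. -/
lemma gaussVar_eq_sum (hf : Differentiable ℝ f) (hM : ∀ x, |f x| ≤ 1)
    (hg : ∀ i, Integrable (pderiv N i f) (gaussN N)) (hc : ∀ i, Continuous (pderiv N i f)) :
    gaussVar N f = ∑ i, ∫ θ in Ioc 0 (Real.pi / 2), ∫ p,
      pderiv N i f p.1 * (p.2 i * f (Real.cos θ • p.1 + Real.sin θ • p.2))
        ∂(gaussN N).prod (gaussN N) := by
  have I (i) := integrable_prod_reflection_pderiv hf.continuous hM (hg i) (hc i)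
  have If : Integrable f (gaussN N) := integrable_of_continuous_of_bound hf.continuous hM
  have If2 : Integrable (fun x ↦ f x ^ 2) (gaussN N) :=
    integrable_of_continuous_of_bound (M := 1) (hf.continuous.pow 2) fun x ↦ by
      rw [abs_pow]; exact pow_le_one₀ (abs_nonneg _) (hM x)
  calc gaussVar N f
      = ∫ p, f p.1 * (f p.1 - f p.2) ∂(gaussN N).prod (gaussN N) := by
        have e1 : ∫ p, f p.1 ^ 2 ∂(gaussN N).prod (gaussN N) = ∫ x, f x ^ 2 ∂gaussN N := by
          rw [integral_fun_fst (fun x ↦ f x ^ 2)]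
          simp
        simp only [mul_sub, ← sq]
        rw [integral_sub (If2.comp_fst _) (If.mul_prod If), e1, integral_prod_mul f f, gaussVar, sq]
    _ = ∫ p, ∑ i, (∫ θ in Ioc 0 (Real.pi / 2), f p.1 *
          (pderiv N i f (Real.cos θ • p.1 + Real.sin θ • p.2) *
            (Real.sin θ * p.1 i - Real.cos θ * p.2 i))) ∂(gaussN N).prod (gaussN N) := by
        simp only [integral_const_mul, ← Finset.mul_sum, ← sub_eq_sum_integral_pderiv hf hc]
    _ = _ := by
        rw [integral_finsetSum _ fun i _ ↦ (I i).integral_prod_right]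
        refine Finset.sum_congr rfl fun i _ ↦ ?_
        rw [← integral_integral_swap (I i)]
        simp only [integral_reflection_pderiv hf.continuous hM (hg i) (Real.cos_sq_add_sin_sq _)]

end Variance

section AngularBounds

lemma cos_le_exp_neg_sq_div_five {θ : ℝ} (h : |θ| ≤ Real.pi) :
    Real.cos θ ≤ Real.exp (-(θ ^ 2 / 5)) := by
  refine (Real.cos_le_one_sub_mul_cos_sq h).trans (le_trans ?_ (Real.one_sub_le_exp_neg _))
  have hp : Real.pi ^ 2 ≤ 10 := by nlinarith [Real.pi_lt_d2, Real.pi_pos]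
  have : 1 / 5 ≤ 2 / Real.pi ^ 2 := by
    rw [div_le_div_iff₀ (by norm_num) (by positivity)]
    linarith
  nlinarith [sq_nonneg θ]

lemma exists_pow_le_third {θ : ℝ} (h0 : 0 < θ) (h1 : θ ≤ Real.pi / 2) :
    ∃ (r : ℝ) (k : ℕ), 0 ≤ r ∧ r ^ 4 = Real.cos θ ∧ r ^ 2 ^ (k + 1) ≤ 1 / 3 ∧
      θ ^ 2 / 80 ≤ (1 / 2) ^ (k + 1) := by
  have hπ := Real.pi_lt_d2
  have hc0 : 0 ≤ Real.cos θ := Real.cos_nonneg_of_mem_Icc ⟨by linarith, h1⟩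
  have hc := cos_le_exp_neg_sq_div_five (θ := θ) (by rw [abs_of_pos h0]; linarith)
  have hθ : 0 < θ ^ 2 := by positivity
  obtain ⟨k, hk1, hk2⟩ := exists_nat_pow_near (x := 40 / θ ^ 2) (y := 2)
    (by rw [le_div_iff₀ hθ]; nlinarith) one_lt_two
  obtain ⟨r, hr0, hr⟩ : ∃ r : ℝ, 0 ≤ r ∧ r ^ 4 = Real.cos θ :=
    ⟨Real.cos θ ^ (4⁻¹ : ℝ), by positivity, Real.rpow_inv_natCast_pow hc0 four_ne_zero⟩
  refine ⟨r, k, hr0, hr, ?_, ?_⟩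
  · have hr1 : r ≤ Real.exp (-(θ ^ 2 / 20)) := by
      refine le_of_pow_le_pow_left₀ four_ne_zero (Real.exp_pos _).le ?_
      rw [hr, ← Real.exp_nat_mul]
      refine hc.trans_eq (congrArg _ ?_)
      push_cast
      ring
    calc r ^ 2 ^ (k + 1) ≤ Real.exp (-(θ ^ 2 / 20)) ^ 2 ^ (k + 1) := by gcongr
      _ = Real.exp (-(2 ^ (k + 1) * θ ^ 2 / 20)) := by
        rw [← Real.exp_nat_mul]
        congr 1
        push_cast
        ring
      _ ≤ Real.exp (-2) := by
        rw [div_lt_iff₀ hθ] at hk2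
        gcongr
        linarith
      _ ≤ 1 / 3 := by
        rw [Real.exp_neg, ← one_div]
        gcongr
        linarith [Real.add_one_le_exp 2]
  · rw [le_div_iff₀ hθ] at hk1
    rw [one_div, inv_pow, ← one_div, le_div_iff₀ (by positivity), pow_succ (2 : ℝ)]
    linarith

variable {N : ℕ} {i : Fin N} {f : (Fin N → ℝ) → ℝ}

lemma integral_pderiv_mul_eval_le_norm (hf : Continuous f) (hM : ∀ x, |f x| ≤ 1)
    (hg : Integrable (pderiv N i f) (gaussN N)) (c s : ℝ) :
    ∫ p, pderiv N i f p.1 * (p.2 i * f (c • p.1 + s • p.2)) ∂(gaussN N).prod (gaussN N) ≤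
      gaussNorm1 N (pderiv N i f) :=
  ((le_abs_self _).trans abs_integral_le_integral_abs).trans
    (integral_abs_pderiv_mul_eval_le hf hM hg c s)

lemma integral_pderiv_mul_eval_le_exp (hf : Differentiable ℝ f) (hM : ∀ x, |f x| ≤ 1)
    (hg : Integrable (pderiv N i f) (gaussN N)) (ha0 : 0 < gaussNorm1 N (pderiv N i f))
    (ha1 : gaussNorm1 N (pderiv N i f) ≤ 1) {θ : ℝ} (h0 : 0 < θ) (h1 : θ ≤ Real.pi / 2) :
    ∫ p, pderiv N i f p.1 * (p.2 i * f (Real.cos θ • p.1 + Real.sin θ • p.2))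
      ∂(gaussN N).prod (gaussN N) ≤ 6 * gaussNorm1 N (pderiv N i f) *
        Real.exp (-((1 + Real.log (1 / gaussNorm1 N (pderiv N i f))) / 80) * θ ^ 2) := by
  obtain ⟨r, k, hr0, hr, hk, hθ⟩ := exists_pow_le_third h0 h1
  have main := integral_pderiv_mul_eval_le hr0 k hk hf hM hg
  have hs : √(1 - Real.cos θ ^ 2) = Real.sin θ := by
    rw [← Real.sin_sq, Real.sqrt_sq (Real.sin_nonneg_of_nonneg_of_le_pi h0.le
      (by linarith [Real.pi_pos]))]
  rw [hr, hs] at main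
  refine main.trans ?_
  obtain ⟨a, ha⟩ : ∃ a, a = gaussNorm1 N (pderiv N i f) := ⟨_, rfl⟩
  rw [← ha] at ha0 ha1 ⊢
  have h3 : Real.exp (θ ^ 2 / 80) ≤ 3 := by
    have : θ ^ 2 / 80 ≤ 1 := by nlinarith [Real.pi_lt_d2]
    exact (Real.exp_le_exp.2 this).trans (by linarith [Real.exp_one_lt_d9])
  calc 2 * a * a ^ ((1 / 2) ^ (k + 1) : ℝ) ≤ 2 * a * a ^ (θ ^ 2 / 80) := by
        gcongr ?_ * ?_
        exact Real.rpow_le_rpow_of_exponent_ge ha0 ha1 hθ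
    _ = 2 * a * Real.exp (θ ^ 2 / 80) * Real.exp (-((1 + Real.log (1 / a)) / 80) * θ ^ 2) := by
        rw [mul_assoc (2 * a), ← Real.exp_add, Real.rpow_def_of_pos ha0, one_div, Real.log_inv]
        ring_nf
    _ ≤ 2 * a * 3 * Real.exp (-((1 + Real.log (1 / a)) / 80) * θ ^ 2) := by gcongr
    _ = _ := by ring

lemma continuous_integral_pderiv_mul_eval (hf : Continuous f) (hM : ∀ x, |f x| ≤ 1)
    (hg : Integrable (pderiv N i f) (gaussN N)) :
    Continuous fun θ : ℝ ↦
      ∫ p, pderiv N i f p.1 * (p.2 i * f (Real.cos θ • p.1 + Real.sin θ • p.2))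
        ∂(gaussN N).prod (gaussN N) := by
  have := Real.continuous_cos
  have := Real.continuous_sin
  refine continuous_of_dominated
    (bound := fun p : (Fin N → ℝ) × (Fin N → ℝ) ↦ |pderiv N i f p.1| * |p.2 i|)
    (fun θ ↦ (integrable_pderiv_mul_eval hf hM hg _ _).1) (fun θ ↦ ae_of_all _ fun p ↦ ?_)
    (hg.abs.mul_prod (integrable_eval_gaussN N i).abs) (ae_of_all _ fun p ↦ by fun_prop)
  simp only [norm_mul, Real.norm_eq_abs]
  gcongr
  exact mul_le_of_le_one_right (abs_nonneg _) (hM _)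

lemma integral_integral_pderiv_mul_eval_le (hf : Differentiable ℝ f) (hM : ∀ x, |f x| ≤ 1)
    (hg : Integrable (pderiv N i f) (gaussN N)) :
    ∫ θ in Ioc 0 (Real.pi / 2), ∫ p,
      pderiv N i f p.1 * (p.2 i * f (Real.cos θ • p.1 + Real.sin θ • p.2))
        ∂(gaussN N).prod (gaussN N) ≤
      48 * (gaussNorm1 N (pderiv N i f) * (1 + gaussNorm1 N (pderiv N i f)) /
        √(1 + max (Real.log (1 / gaussNorm1 N (pderiv N i f))) 0)) := by
  have hb (θ : ℝ) := integral_pderiv_mul_eval_le_norm hf.continuous hM hg (Real.cos θ) (Real.sin θ)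
  have he (ha0) (ha1) (θ : ℝ) := integral_pderiv_mul_eval_le_exp hf hM hg (θ := θ) ha0 ha1
  have hA := continuous_integral_pderiv_mul_eval hf.continuous hM hg
  obtain ⟨A, hAe⟩ : ∃ A : ℝ → ℝ, A = fun θ ↦
      ∫ p, pderiv N i f p.1 * (p.2 i * f (Real.cos θ • p.1 + Real.sin θ • p.2))
        ∂(gaussN N).prod (gaussN N) := ⟨_, rfl⟩
  have ha0 : 0 ≤ gaussNorm1 N (pderiv N i f) := integral_nonneg fun _ ↦ abs_nonneg _
  simp only [← congrFun hAe _] at *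
  generalize gaussNorm1 N (pderiv N i f) = a at *
  have iA : IntegrableOn A (Ioc 0 (Real.pi / 2)) :=
    hA.integrableOn_Icc.mono_set Ioc_subset_Icc_self
  have hπ := Real.pi_lt_d2
  have hπ0 := Real.pi_pos
  rcases le_or_gt (Real.log (1 / a)) 0 with hl | hl
  · rw [max_eq_right hl, add_zero, Real.sqrt_one, div_one]
    calc ∫ θ in Ioc 0 (Real.pi / 2), A θ ≤ ∫ θ in Ioc 0 (Real.pi / 2), a :=
          integral_mono iA (integrable_const _) hb
      _ = Real.pi / 2 * a := by
          simp [show 0 ≤ Real.pi / 2 by positivity]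
      _ ≤ _ := by nlinarith
  · have ha : 0 < a := ha0.lt_of_ne fun h ↦ by simp [← h] at hl
    have ha1 : a ≤ 1 := by
      by_contra! h
      rw [one_div, Real.log_inv] at hl
      linarith [Real.log_pos h]
    rw [max_eq_left hl.le]
    generalize Real.log (1 / a) = L at *
    have ib : Integrable fun θ : ℝ ↦ 6 * a * Real.exp (-((1 + L) / 80) * θ ^ 2) :=
      (integrable_exp_neg_mul_sq (by positivity)).const_mul _
    calc ∫ θ in Ioc 0 (Real.pi / 2), A θ
        ≤ ∫ θ in Ioc 0 (Real.pi / 2), 6 * a * Real.exp (-((1 + L) / 80) * θ ^ 2) :=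
          setIntegral_mono_on iA ib.integrableOn measurableSet_Ioc
            fun θ hθ ↦ he ha ha1 θ hθ.1 hθ.2
      _ ≤ ∫ θ in Ioi 0, 6 * a * Real.exp (-((1 + L) / 80) * θ ^ 2) :=
          setIntegral_mono_set ib.integrableOn (ae_of_all _ fun _ ↦ by positivity)
            Ioc_subset_Ioi_self.eventuallyLE
      _ = 3 * a * √(80 * Real.pi / (1 + L)) := by
          rw [integral_const_mul, integral_gaussian_Ioi, div_div_eq_mul_div, mul_comm Real.pi]
          ring
      _ ≤ 3 * a * (16 / √(1 + L)) := by
          rw [Real.sqrt_div (by positivity)]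
          gcongr
          rw [Real.sqrt_le_left (by norm_num)]
          linarith
      _ = 48 * (a * 1 / √(1 + L)) := by ring
      _ ≤ _ := by
          gcongr
          linarith

end AngularBounds

/-- The `L¹` form of Talagrand's inequality for the standard Gaussian measure on `ℝ^N`,
suited to geometric influences. -/
theorem stmt11 :
    ∃ C : ℝ, 0 < C ∧ ∀ N : ℕ, 1 ≤ N → ∀ f : (Fin N → ℝ) → ℝ,
      ContDiff ℝ (⊤ : ℕ∞) f → (∀ x, |f x| ≤ 1) →
      (∀ i, Integrable (pderiv N i f) (gaussN N)) →
      gaussVar N f ≤ C * ∑ i : Fin N,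
        gaussNorm1 N (pderiv N i f) * (1 + gaussNorm1 N (pderiv N i f)) /
          Real.sqrt (1 + max (Real.log (1 / gaussNorm1 N (pderiv N i f))) 0) := by
  refine ⟨48, by norm_num, fun N _ f hf hM hg ↦ ?_⟩
  have hd : Differentiable ℝ f := hf.differentiable (by simp)
  have hc (i) : Continuous (pderiv N i f) :=
    (hf.continuous_fderiv (by simp)).clm_apply continuous_const
  rw [gaussVar_eq_sum hd hM hg hc, Finset.mul_sum]
  exact Finset.sum_le_sum fun i _ ↦ integral_integral_pderiv_mul_eval_le hd hM (hg i)
end
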